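/- There exist a constant C ≥ 1 and a threshold A₀ ≥ 1 such that for every dyadic number A ≥ A₀ the following holds. For every 0 < ε ≤ 1/2 with ε ∉ [1/A, (log A)^{−1/2}], one can find smooth maps φ_n: H → ℝ^{29} for each integer n obeying: (smoothness at scale A^n) ‖φ_n‖_{C⁶_{A^n}} ≤ C·A^n for all n (in particular |Xφ_n(p)|, |Yφ_n(p)| ≤ C and |Zφ_n(p)| ≤ C·A^{−n} for all p); (orthogonality) if ε ≤ 1/A, then for every integer n the absolutely convergent sum Σ_{n'>n} A^{−ε(n'−n)} B(φ_n, φ_{n'}) vanishes identically on H; (non-degeneracy) |Xφ_n(p)|, |Yφ_n(p)| ≥ C^{−1} for all n and p; (immersion) |⋀_{W=X,Y,Z} Σ_{n'≥n} A^{−ε(n'−n)} Wφ_{n'}(p)| ≥ C^{−1}·A^{−n}·Σ_{n'≥n} A^{−2ε(n'−n)} for all n and p, the sums converging absolutely. -/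

import Mathlib

open scoped ENNReal NNReal RealInnerProductSpace BigOperators

noncomputable section

/-- The Heisenberg group `H`, identified as a set with `ℝ³`. -/
abbrev H : Type := ℝ × ℝ × ℝ

namespace Heisenberg

/-- The group law `[a,b,c]·[x,y,z] = [x+a, y+b, z+c+a·y]`. -/
def mul (p q : H) : H := (q.1 + p.1, q.2.1 + p.2.1, q.2.2 + p.2.2 + p.1 * q.2.1)

/-- The group inverse `[x,y,z]⁻¹ = [−x,−y,−z+xy]`. -/
def inv (p : H) : H := (-p.1, -p.2.1, -p.2.2 + p.1 * p.2.1)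

/-- Membership in the integer lattice `Γ`. -/
def inGamma (p : H) : Prop :=
  (∃ a : ℤ, p.1 = (a : ℝ)) ∧ (∃ b : ℤ, p.2.1 = (b : ℝ)) ∧ (∃ c : ℤ, p.2.2 = (c : ℝ))

/-- Flow along the vector field `X`: `exp(tX)[x,y,z] = [x+t, y, z+t·y]`. -/
def flowX (t : ℝ) (p : H) : H := (p.1 + t, p.2.1, p.2.2 + t * p.2.1)

/-- Flow along the vector field `Y`: `exp(tY)[x,y,z] = [x, y+t, z]`. -/
def flowY (t : ℝ) (p : H) : H := (p.1, p.2.1 + t, p.2.2)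

def flow : Bool → ℝ → H → H
  | true => flowX
  | false => flowY

/-- `applyFlows [(W₁,t₁),…,(W_k,t_k)] p = exp(t₁W₁)⋯exp(t_kW_k) p`. -/
def applyFlows : List (Bool × ℝ) → H → H
  | [], p => p
  | wt :: l, p => flow wt.1 wt.2 (applyFlows l p)

/-- The Carnot–Carathéodory metric on `H`. -/
def ccDist (p p' : H) : ℝ :=
  sInf { s | ∃ l : List (Bool × ℝ), applyFlows l p = p' ∧ s = (l.map fun wt => |wt.2|).sum }

/-- The parabolic dilation `δ_λ[x,y,z] = [λx, λy, λ²z]`. -/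
def dilate (lam : ℝ) (p : H) : H := (lam * p.1, lam * p.2.1, lam ^ 2 * p.2.2)

variable {E : Type*} [NormedAddCommGroup E] [NormedSpace ℝ E]

/-- The right-invariant vector field `X = ∂/∂x + y ∂/∂z` acting on functions. -/
def XD (φ : H → E) : H → E := fun p => fderiv ℝ φ p (1, 0, p.2.1)

/-- The right-invariant vector field `Y = ∂/∂y` acting on functions. -/
def YD (φ : H → E) : H → E := fun p => fderiv ℝ φ p (0, 1, 0)

/-- The vector field `Z = ∂/∂z` acting on functions. -/
def ZD (φ : H → E) : H → E := fun p => fderiv ℝ φ p (0, 0, 1)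

def WD : Bool → (H → E) → H → E
  | true => XD
  | false => YD

/-- `X`, `Y`, `Z` indexed by `Fin 3`. -/
def WD3 : Fin 3 → (H → E) → H → E := ![XD, YD, ZD]

/-- The pointwise (Euclidean) norm `|∇^j φ(p)|` of the `j`-th iterated horizontal
gradient `∇^jφ`, computed via the words of length `j` in `X, Y`. -/
def gradNorm (j : ℕ) (φ : H → E) (p : H) : ℝ :=
  Real.sqrt (∑ w : Fin j → Bool, ‖(List.ofFn w).foldr WD φ p‖ ^ 2)

/-- `‖∇^m φ‖_{C^k_R}`, valued in `ℝ≥0∞`. -/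
def CkRS (m k : ℕ) (R : ℝ) (φ : H → E) : ℝ≥0∞ :=
  ∑ j ∈ Finset.range (k + 1),
    ENNReal.ofReal (R ^ j) * ⨆ p : H, ENNReal.ofReal (gradNorm (m + j) φ p)

/-- The homogeneous Hölder seminorm `‖∇^m φ‖_{Ċ^{0,α}}`, valued in `ℝ≥0∞`. -/
def gradHolderS (m : ℕ) (α : ℝ) (φ : H → E) : ℝ≥0∞ :=
  ⨆ (p : H) (q : H) (_ : p ≠ q),
    ENNReal.ofReal (Real.sqrt (∑ w : Fin m → Bool,
        ‖(List.ofFn w).foldr WD φ p - (List.ofFn w).foldr WD φ q‖ ^ 2)) /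
      ENNReal.ofReal (ccDist p q ^ α)

/-- `‖∇^m φ‖_{C^{k,α}_R}`, valued in `ℝ≥0∞`. -/
def CkAS (m k : ℕ) (α R : ℝ) (φ : H → E) : ℝ≥0∞ :=
  CkRS m k R φ + ENNReal.ofReal (R ^ ((k : ℝ) + α)) * gradHolderS (m + k) α φ

/-- `‖φ‖_{C^k_R}`. -/
abbrev CkR (k : ℕ) (R : ℝ) (φ : H → E) : ℝ≥0∞ := CkRS 0 k R φ

/-- `‖φ‖_{C^{k,α}_R}`. -/
abbrev CkA (k : ℕ) (α R : ℝ) (φ : H → E) : ℝ≥0∞ := CkAS 0 k α R φ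

/-- A dyadic number is one of the form `2^m`, `m ∈ ℤ`. -/
def IsDyadic (A : ℝ) : Prop := ∃ m : ℤ, A = 2 ^ m

/-- The norm `|v₁ ∧ ⋯ ∧ v_k|` of a wedge product of vectors of `ℝ^D`, via the
Cauchy–Binet (Gram determinant) formula. -/
def wedgeNorm {D k : ℕ} (v : Fin k → EuclideanSpace ℝ (Fin D)) : ℝ :=
  Real.sqrt (Matrix.det (Matrix.of fun i j => ⟪v i, v j⟫))

end Heisenberg

open Heisenberg
open scoped RealInnerProductSpace

namespace HeisenbergEmbedding

section Calculus

variable {E F G : Type*} [NormedAddCommGroup E] [NormedSpace ℝ E] [NormedAddCommGroup F]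
  [NormedSpace ℝ F] [NormedAddCommGroup G] [NormedSpace ℝ G]

/-- Smoothness of maps on `H`. -/
abbrev Smooth (f : H → E) : Prop := ContDiff ℝ (⊤ : ℕ∞) f

/-- The coefficient vector of `X` (`true`) or `Y` (`false`). -/
def vec : Bool → H → H
  | true, p => (1, 0, p.2.1)
  | false, _ => (0, 1, 0)

theorem WD_eq (b : Bool) (f : H → E) (p : H) : WD b f p = fderiv ℝ f p (vec b p) := by
  cases b <;> rfl

theorem smooth_vec (b : Bool) : Smooth (vec b) := by
  cases b
  · exact contDiff_const
  · exact contDiff_const.prodMk (contDiff_const.prodMk (contDiff_fst.comp contDiff_snd))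

theorem Smooth.wd {f : H → E} (hf : Smooth f) (b : Bool) : Smooth (WD b f) := by
  have : WD b f = fun p => fderiv ℝ f p (vec b p) := funext (WD_eq b f)
  rw [this]
  exact (contDiff_infty_iff_fderiv.1 hf).2.clm_apply (smooth_vec b)

theorem Smooth.diff {f : H → E} (hf : Smooth f) : Differentiable ℝ f :=
  hf.differentiable (by simp)

theorem Smooth.foldr {f : H → E} (hf : Smooth f) (l : List Bool) : Smooth (l.foldr WD f) := by
  induction l with
  | nil => exact hf
  | cons b l ih => exact Smooth.wd ih b

theorem wd_const (b : Bool) (v : E) : WD b (fun _ => v) = fun _ => 0 := by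
  funext p; rw [WD_eq]; simp

theorem wd_add (b : Bool) {f g : H → E} (hf : Smooth f) (hg : Smooth g) :
    WD b (fun p => f p + g p) = fun p => WD b f p + WD b g p := by
  funext p
  simp only [WD_eq]
  rw [fderiv_fun_add (hf.diff p) (hg.diff p)]; rfl

theorem wd_sub (b : Bool) {f g : H → E} (hf : Smooth f) (hg : Smooth g) :
    WD b (fun p => f p - g p) = fun p => WD b f p - WD b g p := by
  funext p
  simp only [WD_eq]
  rw [fderiv_fun_sub (hf.diff p) (hg.diff p)]; rfl

theorem wd_const_smul (b : Bool) (c : ℝ) {f : H → E} (hf : Smooth f) :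
    WD b (fun p => c • f p) = fun p => c • WD b f p := by
  funext p
  simp only [WD_eq]
  rw [fderiv_fun_const_smul (hf.diff p)]; rfl

theorem wd_sum (b : Bool) {ι : Type*} (s : Finset ι) {f : ι → H → E} (hf : ∀ i, Smooth (f i)) :
    WD b (fun p => ∑ i ∈ s, f i p) = fun p => ∑ i ∈ s, WD b (f i) p := by
  funext p
  simp only [WD_eq]
  rw [fderiv_fun_sum (fun i _ => (hf i).diff p)]; simp

theorem wd_clm (b : Bool) (L : E →L[ℝ] F) {f : H → E} (hf : Smooth f) :
    WD b (fun p => L (f p)) = fun p => L (WD b f p) := by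
  funext p
  simp only [WD_eq]
  rw [show (fun p => L (f p)) = L ∘ f from rfl,
    fderiv_comp p L.differentiableAt (hf.diff p), L.fderiv]; rfl

theorem wd_bilin (b : Bool) (B : E →L[ℝ] F →L[ℝ] G) {f : H → E} {g : H → F} (hf : Smooth f)
    (hg : Smooth g) :
    WD b (fun p => B (f p) (g p)) = fun p => B (WD b f p) (g p) + B (f p) (WD b g p) := by
  funext p
  simp only [WD_eq]
  have := B.hasFDerivAt_of_bilinear (hf.diff p).hasFDerivAt (hg.diff p).hasFDerivAt
  rw [this.fderiv]
  simp [add_comm]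

theorem Smooth.bilin (B : E →L[ℝ] F →L[ℝ] G) {f : H → E} {g : H → F} (hf : Smooth f)
    (hg : Smooth g) : Smooth (fun p => B (f p) (g p)) :=
  (B.contDiff.comp hf).clm_apply hg

theorem wd_smul (b : Bool) {f : H → ℝ} {g : H → E} (hf : Smooth f) (hg : Smooth g) :
    WD b (fun p => f p • g p) = fun p => WD b f p • g p + f p • WD b g p :=
  wd_bilin b (ContinuousLinearMap.lsmul ℝ ℝ) hf hg

theorem Smooth.inner {V : Type*} [NormedAddCommGroup V] [InnerProductSpace ℝ V] {f g : H → V}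
    (hf : Smooth f) (hg : Smooth g) : Smooth (fun p => ⟪f p, g p⟫) :=
  ContDiff.inner ℝ hf hg

theorem wd_inner {V : Type*} [NormedAddCommGroup V] [InnerProductSpace ℝ V] (b : Bool)
    {f g : H → V} (hf : Smooth f) (hg : Smooth g) :
    WD b (fun p => ⟪f p, g p⟫) = fun p => ⟪WD b f p, g p⟫ + ⟪f p, WD b g p⟫ :=
  wd_bilin b (innerSL ℝ) hf hg

/-- The commutator of `Y` and `X` is `Z`. -/
theorem zd_eq {f : H → E} (hf : Smooth f) (p : H) :
    ZD f p = WD false (WD true f) p - WD true (WD false f) p := by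
  have h2 : Differentiable ℝ (fderiv ℝ f) :=
    (contDiff_infty_iff_fderiv.1 hf).2.differentiable (by simp)
  have hsymm : IsSymmSndFDerivAt ℝ f p := by
    apply ContDiffAt.isSymmSndFDerivAt (n := (⊤ : ℕ∞)) hf.contDiffAt
    simp only [minSmoothness_of_isRCLikeNormedField]
    exact WithTop.coe_le_coe.2 (le_top : (2 : ℕ∞) ≤ ⊤)
  have key : ∀ b b' : Bool, WD b (WD b' f) p =
      fderiv ℝ (fderiv ℝ f) p (vec b p) (vec b' p)
        + fderiv ℝ f p (fderiv ℝ (vec b') p (vec b p)) := by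
    intro b b'
    rw [WD_eq, show WD b' f = fun p => fderiv ℝ f p (vec b' p) from funext (WD_eq b' f)]
    have hv := ((smooth_vec b').diff p).hasFDerivAt
    rw [((h2 p).hasFDerivAt.clm_apply hv).fderiv]
    simp [add_comm]
  have hvt : ∀ v : H, fderiv ℝ (vec true) p v = (0, 0, v.2.1) := by
    intro v
    have : HasFDerivAt (vec true) ((0 : H →L[ℝ] ℝ).prod ((0 : H →L[ℝ] ℝ).prod
        ((ContinuousLinearMap.fst ℝ ℝ ℝ).comp (ContinuousLinearMap.snd ℝ ℝ (ℝ × ℝ))))) p := by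
      refine HasFDerivAt.prodMk (hasFDerivAt_const _ _) (HasFDerivAt.prodMk (hasFDerivAt_const _ _) ?_)
      exact ((ContinuousLinearMap.fst ℝ ℝ ℝ).comp
        (ContinuousLinearMap.snd ℝ ℝ (ℝ × ℝ))).hasFDerivAt
    rw [this.fderiv]; rfl
  have hvf : ∀ v : H, fderiv ℝ (vec false) p v = 0 := by
    intro v
    have : vec false = fun _ => ((0, 1, 0) : H) := rfl
    rw [this]; simp
  rw [key, key, hvt, hvf, hsymm.eq (vec false p) (vec true p)]
  simp [ZD, vec]

end Calculus

section AnalyticNorm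

variable {E F G : Type*} [NormedAddCommGroup E] [NormedSpace ℝ E] [NormedAddCommGroup F]
  [NormedSpace ℝ F] [NormedAddCommGroup G] [NormedSpace ℝ G]

/-- The sum of `‖W f p‖` over all words `W` of length `k` in `X, Y`. -/
def wordSum : ℕ → (H → E) → H → ℝ
  | 0, f, p => ‖f p‖
  | k + 1, f, p => wordSum k (WD true f) p + wordSum k (WD false f) p

theorem wordSum_nonneg (k : ℕ) (f : H → E) (p : H) : 0 ≤ wordSum k f p := by
  induction k generalizing f with
  | zero => exact norm_nonneg _
  | succ k ih => exact add_nonneg (ih _) (ih _)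

theorem wordSum_add_le (k : ℕ) {f g : H → E} (hf : Smooth f) (hg : Smooth g) (p : H) :
    wordSum k (fun p => f p + g p) p ≤ wordSum k f p + wordSum k g p := by
  induction k generalizing f g with
  | zero => exact norm_add_le _ _
  | succ k ih =>
    simp only [wordSum, wd_add _ hf hg]
    linarith [ih (hf.wd true) (hg.wd true), ih (hf.wd false) (hg.wd false)]

theorem wordSum_clm_le (k : ℕ) (L : E →L[ℝ] F) {K : ℝ} (hL : ∀ x, ‖L x‖ ≤ K * ‖x‖) {f : H → E}
    (hf : Smooth f) (p : H) : wordSum k (fun p => L (f p)) p ≤ K * wordSum k f p := by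
  induction k generalizing f with
  | zero => exact hL _
  | succ k ih =>
    simp only [wordSum, wd_clm _ L hf]
    linarith [ih (hf.wd true), ih (hf.wd false)]

theorem wordSum_bilin_le (k : ℕ) (B : E →L[ℝ] F →L[ℝ] G) (hB : ∀ x y, ‖B x y‖ ≤ ‖x‖ * ‖y‖)
    {f : H → E} {g : H → F} (hf : Smooth f) (hg : Smooth g) (p : H) :
    wordSum k (fun p => B (f p) (g p)) p ≤
      ∑ ij ∈ Finset.HasAntidiagonal.antidiagonal k, (k.choose ij.1 : ℝ) * (wordSum ij.1 f p * wordSum ij.2 g p) := by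
  induction k generalizing f g with
  | zero => simpa [wordSum] using hB _ _
  | succ k ih =>
    rw [Finset.sum_antidiagonal_choose_succ_mul (fun i j => wordSum i f p * wordSum j g p)]
    simp only [wordSum, wd_bilin _ B hf hg]
    have h : ∀ b, wordSum k (fun p => B (WD b f p) (g p) + B (f p) (WD b g p)) p ≤
        ∑ ij ∈ Finset.HasAntidiagonal.antidiagonal k,
          (k.choose ij.1 : ℝ) * (wordSum ij.1 (WD b f) p * wordSum ij.2 g p) +
        ∑ ij ∈ Finset.HasAntidiagonal.antidiagonal k,
          (k.choose ij.1 : ℝ) * (wordSum ij.1 f p * wordSum ij.2 (WD b g) p) := fun b =>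
      (wordSum_add_le k ((hf.wd b).bilin B hg) (hf.bilin B (hg.wd b)) p).trans
        (add_le_add (ih (hf.wd b) hg) (ih hf (hg.wd b)))
    refine (add_le_add (h true) (h false)).trans (le_of_eq ?_)
    have hc : ∀ ij ∈ Finset.HasAntidiagonal.antidiagonal k, (k.choose ij.2 : ℝ) = k.choose ij.1 := by
      intro ij hij
      rw [Finset.HasAntidiagonal.mem_antidiagonal] at hij
      rw [← hij, Nat.choose_symm_add]
    rw [Finset.sum_congr rfl (fun ij hij => by rw [hc ij hij] : ∀ ij ∈ Finset.HasAntidiagonal.antidiagonal k,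
      (k.choose ij.2 : ℝ) * ((wordSum ij.1 (WD true f) p + wordSum ij.1 (WD false f) p) *
        wordSum ij.2 g p) = (k.choose ij.1 : ℝ) * ((wordSum ij.1 (WD true f) p +
          wordSum ij.1 (WD false f) p) * wordSum ij.2 g p))]
    simp only [← Finset.sum_add_distrib]
    exact Finset.sum_congr rfl fun ij _ => by ring

theorem wordSum_zero (k : ℕ) (p : H) : wordSum k (fun _ => (0 : E)) p = 0 := by
  induction k with
  | zero => simp [wordSum]
  | succ k ih => simp [wordSum, wd_const, ih]

theorem wordSum_const (k : ℕ) (v : E) (p : H) : wordSum (k + 1) (fun _ => v) p = 0 := by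
  simp [wordSum, wd_const, wordSum_zero]

/-- Partial sums of the analytic norm of radius `r` at `p`. -/
def partialNorm (r : ℝ) (n : ℕ) (f : H → E) (p : H) : ℝ :=
  ∑ k ∈ Finset.range n, r ^ k / k.factorial * wordSum k f p

theorem partialNorm_nonneg {r : ℝ} (hr : 0 ≤ r) (n : ℕ) (f : H → E) (p : H) :
    0 ≤ partialNorm r n f p :=
  Finset.sum_nonneg fun k _ => mul_nonneg (by positivity) (wordSum_nonneg _ _ _)

/-- `f` is smooth with analytic norm of radius `r` bounded by `K`, uniformly on `H`. -/
def Bd (r K : ℝ) (f : H → E) : Prop := Smooth f ∧ ∀ p n, partialNorm r n f p ≤ K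

theorem Bd.le {r K K' : ℝ} {f : H → E} (h : Bd r K f) (hK : K ≤ K') : Bd r K' f :=
  ⟨h.1, fun p n => (h.2 p n).trans hK⟩

theorem Bd.nonneg {r K : ℝ} {f : H → E} (h : Bd r K f) : 0 ≤ K := by
  simpa [partialNorm] using h.2 0 0

theorem Bd.norm_le {r K : ℝ} {f : H → E} (h : Bd r K f) (p : H) : ‖f p‖ ≤ K := by
  simpa [partialNorm, wordSum] using h.2 p 1

theorem Bd.abs_le {r K : ℝ} {f : H → ℝ} (h : Bd r K f) (p : H) : |f p| ≤ K := h.norm_le p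

theorem Bd.radius {r r' K : ℝ} {f : H → E} (h : Bd r K f) (h0 : 0 ≤ r') (hr : r' ≤ r) :
    Bd r' K f := by
  refine ⟨h.1, fun p n => le_trans ?_ (h.2 p n)⟩
  refine Finset.sum_le_sum fun k _ => mul_le_mul_of_nonneg_right ?_ (wordSum_nonneg _ _ _)
  gcongr

theorem Bd.mono {r r' K K' : ℝ} {f : H → E} (h : Bd r K f) (h0 : 0 ≤ r') (hr : r' ≤ r)
    (hK : K ≤ K') : Bd r' K' f := (h.radius h0 hr).le hK

theorem Bd.wordSum_le {r K : ℝ} {f : H → E} (h : Bd r K f) (hr : 0 ≤ r) (k : ℕ) (p : H) :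
    r ^ k * wordSum k f p ≤ k.factorial * K := by
  have h1 : r ^ k / k.factorial * wordSum k f p ≤ partialNorm r (k + 1) f p :=
    Finset.single_le_sum (f := fun k : ℕ => r ^ k / k.factorial * wordSum k f p)
      (fun i _ => mul_nonneg (by positivity) (wordSum_nonneg _ _ _)) (by simp)
  have h2 := h1.trans (h.2 p (k + 1))
  have h3 : (0 : ℝ) < k.factorial := by positivity
  rw [div_mul_eq_mul_div, div_le_iff₀ h3] at h2
  linarith

theorem Bd.add {r K K' : ℝ} {f g : H → E} (hf : Bd r K f) (hg : Bd r K' g) (hr : 0 ≤ r) :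
    Bd r (K + K') (fun p => f p + g p) := by
  refine ⟨hf.1.add hg.1, fun p n => le_trans ?_ (add_le_add (hf.2 p n) (hg.2 p n))⟩
  simp only [partialNorm, ← Finset.sum_add_distrib, ← mul_add]
  exact Finset.sum_le_sum fun k _ =>
    mul_le_mul_of_nonneg_left (wordSum_add_le k hf.1 hg.1 p) (by positivity)

theorem Bd.clm {r K C : ℝ} (hr : 0 ≤ r) (L : E →L[ℝ] F) (hC : 0 ≤ C) (hL : ∀ x, ‖L x‖ ≤ C * ‖x‖)
    {f : H → E} (hf : Bd r K f) : Bd r (C * K) (fun p => L (f p)) := by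
  refine ⟨L.contDiff.comp hf.1, fun p n =>
    le_trans ?_ (mul_le_mul_of_nonneg_left (hf.2 p n) hC)⟩
  simp only [partialNorm, Finset.mul_sum]
  refine Finset.sum_le_sum fun k _ => ?_
  have := mul_le_mul_of_nonneg_left (wordSum_clm_le k L hL hf.1 p)
    (show (0 : ℝ) ≤ r ^ k / k.factorial by positivity)
  linarith

theorem Bd.const_smul {r K : ℝ} (hr : 0 ≤ r) (c : ℝ) {f : H → E} (hf : Bd r K f) :
    Bd r (|c| * K) (fun p => c • f p) :=
  hf.clm hr (c • ContinuousLinearMap.id ℝ E) (abs_nonneg c) (fun x => by simp [norm_smul])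

theorem Bd.neg {r K : ℝ} (hr : 0 ≤ r) {f : H → E} (hf : Bd r K f) : Bd r K (fun p => -f p) := by
  simpa using hf.const_smul hr (-1)

theorem Bd.sub {r K K' : ℝ} {f g : H → E} (hf : Bd r K f) (hg : Bd r K' g) (hr : 0 ≤ r) :
    Bd r (K + K') (fun p => f p - g p) := by
  simpa [sub_eq_add_neg] using hf.add (hg.neg hr) hr

theorem bd_const (r : ℝ) (v : E) : Bd r ‖v‖ (fun _ => v) := by
  refine ⟨contDiff_const, fun p n => ?_⟩
  unfold partialNorm
  cases n with
  | zero => simp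
  | succ n => rw [Finset.sum_range_succ']; simp [wordSum_const]; simp [wordSum]

theorem bd_zero (r : ℝ) : Bd r 0 (fun _ => (0 : E)) := by simpa using bd_const r (0 : E)

theorem Bd.sum {r : ℝ} (hr : 0 ≤ r) {ι : Type*} (s : Finset ι) {f : ι → H → E} {K : ι → ℝ}
    (hf : ∀ i ∈ s, Bd r (K i) (f i)) : Bd r (∑ i ∈ s, K i) (fun p => ∑ i ∈ s, f i p) := by
  classical
  induction s using Finset.induction_on with
  | empty => simpa using bd_zero r
  | insert a s ha ih =>
    simp only [Finset.sum_insert ha]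
    exact (hf a (by simp)).add (ih fun i hi => hf i (by simp [hi])) hr

theorem Bd.sum_const {r K : ℝ} (hr : 0 ≤ r) {m : ℕ} {f : Fin m → H → E}
    (hf : ∀ i, Bd r K (f i)) : Bd r (m * K) (fun p => ∑ i, f i p) := by
  simpa using Bd.sum hr Finset.univ (fun i _ => hf i)

theorem sum_range_antidiagonal_le (n : ℕ) {a b : ℕ → ℝ} (ha : ∀ i, 0 ≤ a i) (hb : ∀ i, 0 ≤ b i) :
    ∑ k ∈ Finset.range n, ∑ ij ∈ Finset.HasAntidiagonal.antidiagonal k, a ij.1 * b ij.2 ≤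
      (∑ i ∈ Finset.range n, a i) * ∑ j ∈ Finset.range n, b j := by
  classical
  rw [Finset.sum_mul_sum, ← Finset.sum_product', ← Finset.sum_biUnion]
  · refine Finset.sum_le_sum_of_subset_of_nonneg ?_ fun ij _ _ => mul_nonneg (ha _) (hb _)
    intro ij
    simp only [Finset.mem_biUnion, Finset.mem_range, Finset.HasAntidiagonal.mem_antidiagonal, Finset.mem_product]
    rintro ⟨k, hk, h⟩
    omega
  · intro k _ l _ hkl
    exact Finset.disjoint_left.2 fun ij h1 h2 => hkl (by
      rw [Finset.HasAntidiagonal.mem_antidiagonal] at h1 h2; omega)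

theorem Bd.bilin {r K K' : ℝ} (hr : 0 ≤ r) (B : E →L[ℝ] F →L[ℝ] G)
    (hB : ∀ x y, ‖B x y‖ ≤ ‖x‖ * ‖y‖) {f : H → E} {g : H → F} (hf : Bd r K f) (hg : Bd r K' g) :
    Bd r (K * K') (fun p => B (f p) (g p)) := by
  refine ⟨hf.1.bilin B hg.1, fun p n => ?_⟩
  refine le_trans ?_ (mul_le_mul (hf.2 p n) (hg.2 p n) (partialNorm_nonneg hr n g p) hf.nonneg)
  refine le_trans ?_ (sum_range_antidiagonal_le n
    (a := fun k => r ^ k / k.factorial * wordSum k f p)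
    (b := fun k => r ^ k / k.factorial * wordSum k g p)
    (fun k => mul_nonneg (by positivity) (wordSum_nonneg _ _ _))
    (fun k => mul_nonneg (by positivity) (wordSum_nonneg _ _ _)))
  refine Finset.sum_le_sum fun k _ => ?_
  refine (mul_le_mul_of_nonneg_left (wordSum_bilin_le k B hB hf.1 hg.1 p)
    (by positivity)).trans (le_of_eq ?_)
  rw [Finset.mul_sum]
  refine Finset.sum_congr rfl fun ij hij => ?_
  rw [Finset.HasAntidiagonal.mem_antidiagonal] at hij
  subst hij
  have h := Nat.add_choose_mul_factorial_mul_factorial ij.1 ij.2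
  have h' : ((ij.1 + ij.2).choose ij.1 : ℝ) * ij.1.factorial * ij.2.factorial =
      (ij.1 + ij.2).factorial := by
    rw [← Nat.choose_symm_add] at h
    exact_mod_cast h
  have h1 : (ij.1.factorial : ℝ) ≠ 0 := by positivity
  have h2 : (ij.2.factorial : ℝ) ≠ 0 := by positivity
  have h3 : ((ij.1 + ij.2).choose ij.1 : ℝ) ≠ 0 := by
    exact_mod_cast (Nat.choose_pos (Nat.le_add_right _ _)).ne'
  rw [← h', pow_add]
  field_simp

theorem Bd.smul {r K K' : ℝ} (hr : 0 ≤ r) {f : H → ℝ} {g : H → E} (hf : Bd r K f)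
    (hg : Bd r K' g) : Bd r (K * K') (fun p => f p • g p) :=
  Bd.bilin hr (ContinuousLinearMap.lsmul ℝ ℝ) (fun x y => by simp [norm_smul]) hf hg

theorem Bd.mul {r K K' : ℝ} (hr : 0 ≤ r) {f g : H → ℝ} (hf : Bd r K f) (hg : Bd r K' g) :
    Bd r (K * K') (fun p => f p * g p) := hf.smul hr hg

theorem Bd.inner {V : Type*} [NormedAddCommGroup V] [InnerProductSpace ℝ V] {r K K' : ℝ}
    (hr : 0 ≤ r) {f g : H → V} (hf : Bd r K f) (hg : Bd r K' g) :
    Bd r (K * K') (fun p => ⟪f p, g p⟫) :=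
  Bd.bilin (E := V) (F := V) hr (innerSL ℝ)
    (fun x y => norm_inner_le_norm (𝕜 := ℝ) x y) hf hg

theorem partialNorm_succ (r : ℝ) (n : ℕ) (f : H → E) (p : H) :
    partialNorm r (n + 1) f p =
      ‖f p‖ + ∑ k ∈ Finset.range n, r ^ (k + 1) / (k + 1).factorial * wordSum (k + 1) f p := by
  unfold partialNorm
  rw [Finset.sum_range_succ']
  simp [wordSum, add_comm]

theorem natCast_succ_le_two_pow (k : ℕ) : ((k : ℝ) + 1) ≤ 2 ^ k := by
  have : k + 1 ≤ 2 ^ k := Nat.lt_two_pow_self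
  exact_mod_cast this

/-- Cauchy estimate: halving the radius pays for one derivative. -/
theorem Bd.wd {r K : ℝ} (hr : 0 < r) {f : H → E} (hf : Bd r K f) (b : Bool) :
    Bd (r / 2) (K / r) (WD b f) := by
  refine ⟨hf.1.wd b, fun p n => ?_⟩
  rw [le_div_iff₀ hr]
  refine le_trans ?_ (hf.2 p (n + 1))
  rw [partialNorm_succ]
  refine le_trans ?_ (le_add_of_nonneg_left (norm_nonneg _))
  rw [partialNorm, Finset.sum_mul]
  refine Finset.sum_le_sum fun k _ => ?_
  have h1 : wordSum k (WD b f) p ≤ wordSum (k + 1) f p := by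
    cases b
    · exact le_add_of_nonneg_left (wordSum_nonneg _ _ _)
    · exact le_add_of_nonneg_right (wordSum_nonneg _ _ _)
  have h2 : (r / 2) ^ k / k.factorial * r ≤ r ^ (k + 1) / (k + 1).factorial := by
    rw [Nat.factorial_succ, div_pow, div_div, div_mul_eq_mul_div, ← pow_succ]
    push_cast
    have := natCast_succ_le_two_pow k
    gcongr
  calc _ = ((r / 2) ^ k / k.factorial * r) * wordSum k (WD b f) p := by ring
    _ ≤ _ := mul_le_mul h2 h1 (wordSum_nonneg _ _ _) (by positivity)

theorem Bd.wd_wd {r K : ℝ} (hr : 0 < r) {f : H → E} (hf : Bd r K f) (b b' : Bool) :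
    Bd (r / 4) (2 * K / r ^ 2) (WD b (WD b' f)) := by
  have := (hf.wd hr b').wd (by positivity) b
  convert this using 1 <;> field_simp
  norm_num

theorem bd_of_norm_le_of_wd {r B K : ℝ} (hr : 0 ≤ r) {f : H → E} (hs : Smooth f)
    (hB : ∀ p, ‖f p‖ ≤ B) (hf : ∀ b, Bd r K (WD b f)) : Bd r (B + 2 * r * K) f := by
  refine ⟨hs, fun p n => ?_⟩
  have hK := (hf true).nonneg
  cases n with
  | zero =>
    have := (norm_nonneg _).trans (hB p)
    simp only [partialNorm, Finset.range_zero, Finset.sum_empty]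
    positivity
  | succ n =>
    rw [partialNorm_succ]
    refine add_le_add (hB p) ?_
    have h := add_le_add ((hf true).2 p n) ((hf false).2 p n)
    have h' := mul_le_mul_of_nonneg_left h hr
    refine le_trans ?_ (h'.trans (le_of_eq (by ring)))
    simp only [partialNorm, ← Finset.sum_add_distrib, ← mul_add, Finset.mul_sum]
    refine Finset.sum_le_sum fun k _ => ?_
    rw [← mul_assoc]
    refine mul_le_mul_of_nonneg_right ?_ (wordSum_nonneg (k + 1) f p)
    rw [pow_succ, mul_div_assoc', mul_comm]
    gcongr
    exact Nat.le_succ k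

/-- Shrinking the radius makes the derivative part of the norm small. -/
theorem Bd.shrink {r B K : ℝ} (hr : 0 ≤ r) {f : H → E} (hf : Bd r K f) (hB : ∀ p, ‖f p‖ ≤ B) :
    Bd (r / 4) (B + K / 4) f := by
  refine ⟨hf.1, fun p n => ?_⟩
  have hK := hf.nonneg
  cases n with
  | zero =>
    have := (norm_nonneg _).trans (hB p)
    simp only [partialNorm, Finset.range_zero, Finset.sum_empty]
    positivity
  | succ n =>
    rw [partialNorm_succ]
    refine add_le_add (hB p) ?_
    rw [le_div_iff₀ (by norm_num)]
    refine le_trans ?_ (hf.2 p (n + 1))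
    rw [partialNorm_succ]
    refine le_trans ?_ (le_add_of_nonneg_left (norm_nonneg _))
    rw [Finset.sum_mul]
    refine Finset.sum_le_sum fun k _ => ?_
    rw [mul_right_comm]
    refine mul_le_mul_of_nonneg_right ?_ (wordSum_nonneg (k + 1) f p)
    rw [div_pow, div_right_comm, div_mul_eq_mul_div]
    rw [div_le_iff₀ (by positivity)]
    refine mul_le_mul_of_nonneg_left ?_ (by positivity)
    rw [pow_succ]
    nlinarith [one_le_pow₀ (show (1 : ℝ) ≤ 4 by norm_num) (n := k)]

end AnalyticNorm

section Projection

variable {V : Type*} [NormedAddCommGroup V] [InnerProductSpace ℝ V]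

theorem Bd.congr {E : Type*} [NormedAddCommGroup E] [NormedSpace ℝ E] {r K : ℝ} {f g : H → E}
    (h : Bd r K f) (hfg : ∀ p, g p = f p) : Bd r K g := by
  rwa [show g = f from funext hfg]

theorem bd_one (r : ℝ) : Bd r 1 (fun _ => (1 : ℝ)) := by simpa using bd_const r (1 : ℝ)

/-- The Kronecker symbol with real values. -/
def kd {ι : Type*} [DecidableEq ι] (i j : ι) : ℝ := if i = j then 1 else 0

theorem bd_kd {ι : Type*} [DecidableEq ι] (r : ℝ) (i j : ι) : Bd r 1 (fun _ => kd i j) := by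
  unfold kd
  split_ifs
  · exact bd_one r
  · exact (bd_zero r).le zero_le_one

/-- The component of `m` orthogonal to `u`, multiplied by `‖u‖²`. -/
def rej (u m : V) : V := ⟪u, u⟫ • m - ⟪m, u⟫ • u

theorem inner_rej_self (u m : V) : ⟪rej u m, u⟫ = 0 := by
  simp only [rej, inner_sub_left, inner_smul_left, conj_trivial]
  ring

theorem inner_rej_rej (u m n : V) :
    ⟪rej u m, rej u n⟫ = ⟪u, u⟫ * (⟪u, u⟫ * ⟪m, n⟫ - ⟪n, u⟫ * ⟪m, u⟫) := by
  have h : ⟪rej u m, rej u n⟫ = ⟪u, u⟫ * ⟪rej u m, n⟫ := by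
    conv_lhs => rw [rej.eq_1 u n]
    rw [inner_sub_right, inner_smul_right, inner_smul_right, inner_rej_self]; simp
  rw [h, rej, inner_sub_left, inner_smul_left, inner_smul_left, real_inner_comm n u]
  simp only [conj_trivial]
  ring

theorem Smooth.rej {u m : H → V} (hu : Smooth u) (hm : Smooth m) :
    Smooth (fun p => rej (u p) (m p)) :=
  ((hu.inner hu).smul hm).sub ((hm.inner hu).smul hu)

variable (V) in
theorem exists_projection (k : ℕ) : ∀ K : ℝ, 1 ≤ K → ∃ C : ℝ, 1 ≤ C ∧
    ∀ ρ η : ℝ, 0 ≤ ρ → 0 ≤ η → C * η ≤ 1 / 2 → ∀ w : Fin k → H → V,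
      (∀ i, Bd ρ K (w i)) → (∀ i j, Bd ρ η (fun p => ⟪w i p, w j p⟫ - kd i j)) →
      ∃ σ : H → ℝ, Bd ρ (C * η) (fun p => σ p - 1) ∧
        ∀ (M : H → V) (η' : ℝ), Smooth M → 0 ≤ η' → (∀ i, Bd ρ η' (fun p => ⟪M p, w i p⟫)) →
          ∃ N : H → V, (∀ i p, ⟪N p, w i p⟫ = 0) ∧ Bd ρ (C * η') (fun p => N p - σ p • M p) ∧
            ∀ p q, ⟪M p, q⟫ = 0 → (∀ i, ⟪w i p, q⟫ = 0) → ⟪N p, q⟫ = 0 := by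
  induction k with
  | zero =>
    intro K _
    refine ⟨1, le_rfl, fun ρ η _ hη _ w _ _ => ⟨fun _ => 1, ?_, ?_⟩⟩
    · simpa using (bd_zero ρ).le hη
    · intro M η' _ hη' _
      exact ⟨M, fun i => i.elim0, by simpa using (bd_zero ρ).le hη', fun p q h _ => h⟩
  | succ k ih =>
    intro K hK
    obtain ⟨C', hC', ih⟩ := ih (2 * K) (by linarith)
    refine ⟨10 * C' + 2 * K, by linarith, fun ρ η hρ hη hCη w hw hG => ?_⟩
    have hη2 : η ≤ 1 / 20 := by nlinarith
    have hCη' : C' * (6 * η) ≤ 1 / 2 := by nlinarith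
    set u := w 0 with hu
    have ha : Bd ρ η (fun p => ⟪u p, u p⟫ - 1) := by simpa [kd] using hG 0 0
    have ha' : Bd ρ (3 / 2) (fun p => ⟪u p, u p⟫) :=
      ((ha.add (bd_one ρ) hρ).congr (fun p => by ring)).le (by linarith)
    have hb : ∀ i : Fin k, Bd ρ η (fun p => ⟪w i.succ p, u p⟫) := fun i =>
      (hG i.succ 0).congr (fun p => by simp [kd, hu])
    let w' : Fin k → H → V := fun i p => rej (u p) (w i.succ p)
    have hw' : ∀ i, Bd ρ (2 * K) (w' i) := fun i =>
      ((ha'.smul hρ (hw i.succ)).sub ((hb i).smul hρ (hw 0)) hρ).le (by nlinarith)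
    have hG' : ∀ i j, Bd ρ (6 * η) (fun p => ⟪w' i p, w' j p⟫ - kd i j) := by
      intro i j
      have h1 : Bd ρ η (fun p => ⟪w i.succ p, w j.succ p⟫ - kd i j) :=
        (hG i.succ j.succ).congr (fun p => by simp [kd])
      have h2 := ((ha'.mul hρ (ha'.mul hρ h1)).sub (ha'.mul hρ ((hb j).mul hρ (hb i))) hρ).add
        ((bd_kd ρ i j).mul hρ (ha.mul hρ (ha'.add (bd_one ρ) hρ))) hρ
      refine (h2.congr fun p => ?_).le (by nlinarith)
      rw [inner_rej_rej]; ring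
    obtain ⟨σ', hσ', hM'⟩ := ih ρ (6 * η) hρ (by linarith) hCη' w' hw' hG'
    have hσ'1 : Bd ρ (3 / 2) σ' := ((hσ'.add (bd_one ρ) hρ).congr (fun p => by ring)).le (by linarith)
    refine ⟨fun p => σ' p * ⟪u p, u p⟫, ?_, ?_⟩
    · refine (((hσ'.mul hρ ha').add ha hρ).congr (fun p => by ring)).le ?_
      nlinarith
    · intro M η' hM hη' hMw
      obtain ⟨N, hN1, hN2, hN3⟩ := hM' (fun p => rej (u p) (M p)) (3 * η') ((hw 0).1.rej hM)
        (by linarith) (fun i => by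
          have h := ha'.mul hρ ((ha'.mul hρ (hMw i.succ)).sub ((hb i).mul hρ (hMw 0)) hρ)
          refine (h.congr fun p => inner_rej_rej _ _ _).le ?_
          nlinarith)
      have hNu : ∀ p, ⟪N p, u p⟫ = 0 := fun p =>
        hN3 p (u p) (inner_rej_self _ _) fun i => inner_rej_self _ _
      refine ⟨N, ?_, ?_, ?_⟩
      · intro i p
        refine Fin.cases (hNu p) (fun i => ?_) i
        have h := hN1 i p
        simp only [w', rej, inner_sub_right, inner_smul_right, hNu, mul_zero, sub_zero] at h
        refine (mul_eq_zero.1 h).resolve_left ?_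
        have := (abs_le.1 (ha.abs_le p)).1
        intro h0
        rw [h0] at this
        linarith
      · have h := hN2.sub (hσ'1.smul hρ ((hMw 0).smul hρ (hw 0))) hρ
        refine (h.congr fun p => ?_).le ?_
        · simp only [rej, smul_sub, smul_smul]
          abel
        · nlinarith
      · intro p q hq hqw
        refine hN3 p q ?_ fun i => ?_
        · simp [rej, inner_sub_left, inner_smul_left, hq, hqw 0, hu]
        · simp [w', rej, inner_sub_left, inner_smul_left, hqw i.succ, hqw 0, hu]

end Projection

section Frames

variable {V : Type*} [NormedAddCommGroup V] [InnerProductSpace ℝ V]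

/-- The defect of the Gram matrix of `r`. -/
def gd {m : ℕ} (r : Fin m → V) (i j : Fin m) : ℝ := ⟪r i, r j⟫ - kd i j

/-- One Newton–Schulz step towards an orthonormal system. -/
def newton {m : ℕ} (r : Fin m → V) (i : Fin m) : V := r i - (1 / 2 : ℝ) • ∑ k, gd r i k • r k

theorem gd_symm {m : ℕ} (r : Fin m → V) (i j : Fin m) : gd r i j = gd r j i := by
  simp [gd, kd, real_inner_comm, eq_comm]

theorem gd_newton {m : ℕ} (r : Fin m → V) (i j : Fin m) :
    gd (newton r) i j = (1 / 4) * (∑ k, ∑ l, gd r i k * (gd r j l * gd r k l))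
      - (3 / 4) * ∑ k, gd r i k * gd r j k := by
  have h : ∀ k l, ⟪r k, r l⟫ = kd k l + gd r k l := fun k l => by simp [gd]
  have h1 : ⟪newton r i, newton r j⟫ = ⟪r i, r j⟫ - (1 / 2) * ∑ k, gd r j k * ⟪r i, r k⟫
      - (1 / 2) * ∑ k, gd r i k * ⟪r k, r j⟫
      + (1 / 4) * ∑ k, ∑ l, gd r i k * (gd r j l * ⟪r k, r l⟫) := by
    simp only [newton, inner_sub_left, inner_sub_right, inner_smul_left, inner_smul_right,
      sum_inner, inner_sum, conj_trivial, Finset.mul_sum]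
    rw [Finset.sum_comm (f := fun x l => 1 / 4 * (gd r i x * (gd r j l * ⟪r x, r l⟫)))]
    have h5 : ∑ l, ∑ k, 1 / 4 * (gd r i k * (gd r j l * ⟪r k, r l⟫)) =
        ∑ l, 1 / 2 * (gd r j l * ∑ k, 1 / 2 * (gd r i k * ⟪r k, r l⟫)) := by
      simp only [Finset.mul_sum]
      exact Finset.sum_congr rfl fun k _ => Finset.sum_congr rfl fun l _ => by ring
    rw [h5]
    simp only [mul_sub, Finset.sum_sub_distrib]
    ring
  have h2 : ∑ k, gd r j k * ⟪r i, r k⟫ = gd r i j + ∑ k, gd r i k * gd r j k := by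
    simp only [h, mul_add, Finset.sum_add_distrib]
    congr 1
    · simp [kd, gd_symm r i j]
    · exact Finset.sum_congr rfl fun k _ => mul_comm _ _
  have h3 : ∑ k, gd r i k * ⟪r k, r j⟫ = gd r i j + ∑ k, gd r i k * gd r j k := by
    simp only [h, mul_add, Finset.sum_add_distrib]
    congr 1
    · simp [kd]
    · exact Finset.sum_congr rfl fun k _ => by rw [gd_symm r k j]
  have h4 : ∑ k, ∑ l, gd r i k * (gd r j l * ⟪r k, r l⟫) = ∑ k, gd r i k * gd r j k +
      ∑ k, ∑ l, gd r i k * (gd r j l * gd r k l) := by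
    simp only [h, mul_add, Finset.sum_add_distrib]
    congr 1
    simp [kd]
  rw [gd, h1, h2, h3, h4, h]
  ring

theorem Bd.const_mul {r K : ℝ} (hr : 0 ≤ r) {c : ℝ} (hc : 0 ≤ c) {f : H → ℝ} (hf : Bd r K f) :
    Bd r (c * K) (fun p => c * f p) := by
  simpa [abs_of_nonneg hc] using hf.const_smul hr c

theorem bd_gd_newton {ρ γ : ℝ} (hρ : 0 ≤ ρ) (hγ : γ ≤ 1) {r : Fin 8 → H → V}
    (h : ∀ i j, Bd ρ γ (fun p => gd (fun k => r k p) i j)) (i j : Fin 8) :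
    Bd ρ (22 * γ ^ 2) (fun p => gd (newton fun k => r k p) i j) := by
  have h0 := (h i j).nonneg
  have h1 := (Bd.sum_const hρ fun k => Bd.sum_const hρ fun l =>
    (h i k).mul hρ ((h j l).mul hρ (h k l))).const_mul hρ (show (0 : ℝ) ≤ 1 / 4 by norm_num)
  have h2 := (Bd.sum_const hρ fun k => (h i k).mul hρ (h j k)).const_mul hρ
    (show (0 : ℝ) ≤ 3 / 4 by norm_num)
  refine ((h1.sub h2 hρ).congr fun p => gd_newton _ _ _).le ?_
  push_cast
  nlinarith [sq_nonneg γ, mul_nonneg h0 h0]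

theorem bd_half_sum {E : Type*} [NormedAddCommGroup E] [NormedSpace ℝ E] {ρ a b : ℝ} (hρ : 0 ≤ ρ)
    {f : Fin 8 → H → ℝ} {g : Fin 8 → H → E} (hf : ∀ i, Bd ρ a (f i)) (hg : ∀ i, Bd ρ b (g i)) :
    Bd ρ (4 * a * b) (fun p => (1 / 2 : ℝ) • ∑ k, f k p • g k p) := by
  refine ((Bd.sum_const hρ fun k => (hf k).smul hρ (hg k)).const_smul hρ (1 / 2)).le ?_
  rw [abs_of_pos (by norm_num)]
  push_cast
  linarith

/-- Gram matrices of perturbed frames. -/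
theorem Bd.gram_perturb {ρ e d K : ℝ} (hρ : 0 ≤ ρ) {P M : Fin 8 → H → V}
    (hP : ∀ j, Bd ρ K (P j)) (hG : ∀ i j, Bd ρ e (fun p => gd (fun k => P k p) i j))
    (hM : ∀ j, Bd ρ d (fun p => M j p - P j p)) (i j : Fin 8) :
    Bd ρ (e + 2 * K * d + d ^ 2) (fun p => gd (fun k => M k p) i j) := by
  refine (((((hG i j).add ((hM i).inner hρ (hP j)) hρ).add ((hP i).inner hρ (hM j)) hρ).add
    ((hM i).inner hρ (hM j)) hρ).congr fun p => ?_).le (le_of_eq (by ring))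
  simp only [gd, inner_sub_left, inner_sub_right]
  ring

/-- The part of `P` orthogonal (to first order) to `Q`. -/
def corr {m : ℕ} (P : V) (Q : Fin m → V) : V := P - ∑ k, ⟪P, Q k⟫ • Q k

variable (V) in
/-- Construction of an almost orthonormal frame exactly orthogonal to four prescribed vector
fields and almost orthogonal to `Q`. -/
theorem exists_frame (K : ℝ) (hK : 1 ≤ K) : ∃ C : ℝ, 1 ≤ C ∧ ∀ e ρ : ℝ, 0 ≤ e → C * e ≤ 1 → 0 ≤ ρ →
    ∀ (P Q : Fin 8 → H → V) (w : Fin 4 → H → V),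
      (∀ j, Bd ρ 2 (P j)) → (∀ j, Bd ρ 2 (Q j)) →
      (∀ i j, Bd ρ e (fun p => gd (fun k => P k p) i j)) →
      (∀ i j, Bd ρ e (fun p => gd (fun k => Q k p) i j)) →
      (∀ i j, Bd ρ e (fun p => ⟪P i p, Q j p⟫)) →
      (∀ i, Bd ρ K (w i)) → (∀ i j, Bd ρ (K * e) (fun p => ⟪w i p, w j p⟫ - kd i j)) →
      (∀ j i, Bd ρ (K * e ^ 2) (fun p => ⟪corr (P j p) (fun k => Q k p), w i p⟫)) →
      ∃ N : Fin 8 → H → V, (∀ j, Bd (ρ / 4) 2 (N j)) ∧ (∀ j i p, ⟪N j p, w i p⟫ = 0) ∧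
        (∀ i j, Bd ρ e (fun p => gd (fun k => N k p) i j)) ∧
        (∀ i j, Bd ρ e (fun p => ⟪Q i p, N j p⟫)) := by
  obtain ⟨C, hC, hproj⟩ := exists_projection V 4 K hK
  set B := C * K with hB
  have hB1 : 1 ≤ B := by nlinarith
  refine ⟨10 ^ 6 * B ^ 2, by nlinarith, fun e ρ he hCe hρ P Q w hP hQ hPP hQQ hPQ hw hww hMw => ?_⟩
  have hBe : B * e ≤ 1 / 10 ^ 6 := by
    have : B * e ≤ B ^ 2 * e := mul_le_mul_of_nonneg_right (by nlinarith) he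
    linarith
  have he1 : e ≤ 1 / 10 ^ 6 := by nlinarith
  have hBe0 : 0 ≤ B * e := by positivity
  obtain ⟨σ, hσ, hproj⟩ := hproj ρ (K * e) hρ (by positivity) (by nlinarith) w hw hww
  have hσ' : Bd ρ (B * e) (fun p => σ p - 1) := hσ.le (by rw [hB]; linarith)
  set M : Fin 8 → H → V := fun j p => corr (P j p) (fun k => Q k p) with hM
  have hMP : ∀ j, Bd ρ (16 * e) (fun p => M j p - P j p) := fun j => by
    refine (((Bd.sum_const hρ fun k => (hPQ j k).smul hρ (hQ k)).neg hρ).congr fun p => ?_).le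
      (by push_cast; linarith)
    simp [hM, corr]
  have hMQ : ∀ j l, Bd ρ (8 * e ^ 2) (fun p => ⟪Q l p, M j p⟫) := fun j l => by
    refine (((Bd.sum_const hρ fun k => (hPQ j k).mul hρ (hQQ k l)).neg hρ).congr fun p => ?_).le
      (by push_cast; nlinarith)
    rw [real_inner_comm]
    simp only [hM, corr, gd, inner_sub_left, sum_inner, inner_smul_left, conj_trivial, mul_sub,
      Finset.sum_sub_distrib]
    simp [kd]
  have hM18 : ∀ j, Bd ρ 3 (M j) := fun j =>
    (((hMP j).add (hP j) hρ).congr fun p => by simp).le (by linarith)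
  have hex : ∀ j, ∃ N : H → V, (∀ i p, ⟪N p, w i p⟫ = 0) ∧
      Bd ρ (B * e ^ 2) (fun p => N p - σ p • M j p) := fun j => by
    obtain ⟨N, h1, h2, -⟩ := hproj (M j) (K * e ^ 2) (hM18 j).1 (by positivity) (hMw j)
    exact ⟨N, h1, h2.le (by rw [hB]; linarith)⟩
  choose r hrw hrM using hex
  have hrM' : ∀ j, Bd ρ (4 * (B * e)) (fun p => r j p - M j p) := fun j => by
    refine (((hrM j).add (hσ'.smul hρ (hM18 j)) hρ).congr fun p => ?_).le ?_
    · rw [sub_smul, one_smul]; abel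
    · nlinarith
  have hrP : ∀ j, Bd ρ (20 * (B * e)) (fun p => r j p - P j p) := fun j =>
    (((hrM' j).add (hMP j) hρ).congr fun p => by abel).le (by nlinarith)
  have hr3 : ∀ j, Bd ρ 3 (r j) := fun j =>
    (((hrP j).add (hP j) hρ).congr fun p => by simp).le (by linarith)
  have hrr : ∀ i j, Bd ρ (100 * (B * e)) (fun p => gd (fun k => r k p) i j) := fun i j =>
    (Bd.gram_perturb hρ hP hPP hrP i j).le (by nlinarith)
  have hrQ : ∀ i j, Bd ρ (18 * (B * e ^ 2)) (fun p => ⟪Q i p, r j p⟫) := fun i j => by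
    have hσ2 : Bd ρ 2 σ := ((hσ'.add (bd_one ρ) hρ).congr fun p => by ring).le (by linarith)
    refine (((hσ2.mul hρ (hMQ j i)).add ((hQ i).inner hρ (hrM j)) hρ).congr fun p => ?_).le ?_
    · rw [inner_sub_right, inner_smul_right]; ring
    · nlinarith [sq_nonneg e]
  have hN3 : ∀ j, Bd ρ (7 / 2) (fun p => newton (fun k => r k p) j) := fun j =>
    ((hr3 j).sub (bd_half_sum hρ (hrr j) hr3) hρ).le (by linarith)
  have hNN : ∀ i j, Bd ρ e (fun p => gd (newton fun k => r k p) i j) := fun i j => by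
    refine (bd_gd_newton hρ (by linarith) hrr i j).le ?_
    nlinarith
  refine ⟨fun j p => newton (fun k => r k p) j, fun j => ?_, fun j i p => ?_, hNN, fun i j => ?_⟩
  · refine ((hN3 j).shrink hρ (B := 11 / 10) fun p => ?_).le (by norm_num)
    have h := (abs_le.1 ((hNN j j).abs_le p)).2
    simp only [gd, kd, if_true, real_inner_self_eq_norm_sq] at h
    exact abs_le_of_sq_le_sq' (by linarith) (by norm_num) |>.2
  · simp [newton, inner_sub_left, inner_smul_left, sum_inner, hrw]
  · refine (((hrQ i j).sub (bd_half_sum hρ (hrr j) (hrQ i)) hρ).congr fun p => ?_).le ?_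
    · simp [newton, inner_sub_right, inner_smul_right, inner_sum]
    · have : B * e ^ 2 ≤ 1 / 10 ^ 6 * e := by nlinarith
      nlinarith [mul_nonneg hBe0 (mul_nonneg hBe0 he), mul_le_mul hBe hBe hBe0 (by norm_num)]

end Frames

section Induction

variable {V : Type*} [NormedAddCommGroup V] [InnerProductSpace ℝ V]

/-- A family of oscillating functions at scale `R` whose gradients and pure second derivatives are
almost orthonormal and whose `Z`-derivative is bounded below. -/
structure Good (r L μ ζ R : ℝ) (g : Fin 8 → H → ℝ) : Prop where
  bd : ∀ j, Bd (r * R) (L * R) (g j)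
  wd : ∀ j b, Bd (r * R / 2) L (WD b (g j))
  wdwd : ∀ j b b', Bd (r * R / 4) (L / R) (WD b (WD b' (g j)))
  grad : ∀ b b', Bd (r * R / 4) μ (fun p => ∑ j, WD b (g j) p * WD b' (g j) p - kd b b')
  hess : ∀ b b', Bd (r * R / 4) μ (fun p =>
    ∑ j, (R * WD b (WD b (g j)) p) * (R * WD b' (WD b' (g j)) p) - kd b b')
  zlow : ∀ p, ζ ^ 2 ≤ ∑ j, (R * ZD (g j) p) ^ 2
  zcross : ∀ b p, |∑ j, WD b (g j) p * (R * ZD (g j) p)| ≤ ζ / 100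

/-- Data for the construction at scale `R`: an almost orthonormal frame `N` orthogonal to the
derivatives of the part `ψ` of the map already built at scales at least `A * R`. -/
structure Pre (r L e η A c R : ℝ) (N Q : Fin 8 → H → V) (ψ : H → V) : Prop where
  smooth : Smooth ψ
  N2 : ∀ j, Bd (r * (A * R) / 16) 2 (N j)
  Q2 : ∀ j, Bd (r * (A * R) / 16) 2 (Q j)
  NN : ∀ i j, Bd (r * (A * R) / 16) e (fun p => gd (fun k => N k p) i j)
  QQ : ∀ i j, Bd (r * (A * R) / 16) e (fun p => gd (fun k => Q k p) i j)
  QN : ∀ i j, Bd (r * (A * R) / 16) e (fun p => ⟪Q i p, N j p⟫)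
  orth : ∀ j b p, ⟪N j p, WD b ψ p⟫ = 0
  orth2 : ∀ j b p, ⟪N j p, WD b (WD b ψ) p⟫ = 0
  grad : ∀ b b', Bd (r * R) η (fun p => c ^ 2 * ⟪WD b ψ p, WD b' ψ p⟫ - kd b b')
  hess : ∀ b b', Bd (r * R) (32 * L / (A * R)) (WD b (WD b' ψ))
  Qgrad : ∀ j b, Bd (r * R) (50 * L) (fun p => ⟪Q j p, WD b ψ p⟫)

/-- Bounds for the partial map `ψ` built at scales at least `R`. -/
structure Inv (r L e η A c R : ℝ) (g : Fin 8 → H → ℝ) (P Q : Fin 8 → H → V) (ψ : H → V) :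
    Prop where
  smooth : Smooth ψ
  P2 : ∀ j, Bd (r * (A * R) / 16) 2 (P j)
  Q2 : ∀ j, Bd (r * (A * R) / 16) 2 (Q j)
  PP : ∀ i j, Bd (r * (A * R) / 16) e (fun p => gd (fun k => P k p) i j)
  QQ : ∀ i j, Bd (r * (A * R) / 16) e (fun p => gd (fun k => Q k p) i j)
  PQ : ∀ i j, Bd (r * (A * R) / 16) e (fun p => ⟪P i p, Q j p⟫)
  grad : ∀ b b', Bd (r * R / 4) η (fun p => c ^ 2 * ⟪WD b ψ p, WD b' ψ p⟫ - kd b b')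
  hess : ∀ b b', Bd (r * R / 4) (32 * L / R) (WD b (WD b' ψ))
  Qgrad : ∀ j b, Bd (r * R / 4) (50 * L) (fun p => ⟪Q j p, WD b ψ p⟫)
  Pgrad : ∀ j b, Bd (r * R / 4) (100 * L) (fun p => ⟪P j p, WD b ψ p⟫)
  hess_approx : ∀ b b', Bd (r * R / 4) (60 * L ^ 2 / A)
    (fun p => R • WD b (WD b' ψ) p - ∑ j, (R * WD b (WD b' (g j)) p) • Q j p)

/-- The map `∑ g_j N_j`. -/
def layer (g : Fin 8 → H → ℝ) (N : Fin 8 → H → V) (p : H) : V := ∑ j, g j p • N j p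

theorem smooth_sum_smul {g : Fin 8 → H → ℝ} {N : Fin 8 → H → V} (hg : ∀ j, Smooth (g j))
    (hN : ∀ j, Smooth (N j)) : Smooth (fun p => ∑ j, g j p • N j p) :=
  ContDiff.sum fun j _ => (hg j).smul (hN j)

theorem wd_layer {g : Fin 8 → H → ℝ} {N : Fin 8 → H → V} (hg : ∀ j, Smooth (g j))
    (hN : ∀ j, Smooth (N j)) (b : Bool) :
    WD b (layer g N) = fun p => layer (fun j => WD b (g j)) N p + layer g (fun j => WD b (N j)) p := by
  unfold layer
  rw [wd_sum b _ (f := fun j p => g j p • N j p) fun j => (hg j).smul (hN j)]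
  funext p
  rw [← Finset.sum_add_distrib]
  exact Finset.sum_congr rfl fun j _ => by rw [wd_smul b (hg j) (hN j)]

theorem smooth_layer {g : Fin 8 → H → ℝ} {N : Fin 8 → H → V} (hg : ∀ j, Smooth (g j))
    (hN : ∀ j, Smooth (N j)) : Smooth (layer g N) := smooth_sum_smul hg hN

theorem wd_wd_layer {g : Fin 8 → H → ℝ} {N : Fin 8 → H → V} (hg : ∀ j, Smooth (g j))
    (hN : ∀ j, Smooth (N j)) (b b' : Bool) :
    WD b (WD b' (layer g N)) = fun p =>
      (layer (fun j => WD b (WD b' (g j))) N p + layer (fun j => WD b' (g j)) (fun j => WD b (N j)) p)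
      + (layer (fun j => WD b (g j)) (fun j => WD b' (N j)) p
        + layer g (fun j => WD b (WD b' (N j))) p) := by
  rw [wd_layer hg hN, wd_add b (smooth_layer (fun j => (hg j).wd b') hN)
    (smooth_layer hg fun j => (hN j).wd b'), wd_layer (fun j => (hg j).wd b') hN,
    wd_layer hg fun j => (hN j).wd b']

theorem bd_layer {ρ a b : ℝ} (hρ : 0 ≤ ρ) {g : Fin 8 → H → ℝ} {N : Fin 8 → H → V}
    (hg : ∀ j, Bd ρ a (g j)) (hN : ∀ j, Bd ρ b (N j)) : Bd ρ (8 * a * b) (layer g N) :=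
  (Bd.sum_const hρ fun j => (hg j).smul hρ (hN j)).le (by push_cast; linarith)

theorem inner_layer_layer (f g : Fin 8 → H → ℝ) (N : Fin 8 → H → V) (p : H) :
    ⟪layer f N p, layer g N p⟫ = (∑ j, f j p * g j p) +
      ∑ i, ∑ j, f i p * (g j p * gd (fun k => N k p) i j) := by
  have h : ∀ k l, ⟪N k p, N l p⟫ = kd k l + gd (fun k => N k p) k l := fun k l => by simp [gd]
  simp only [layer, sum_inner, inner_sum, inner_smul_left, inner_smul_right, conj_trivial, h,
    mul_add, Finset.sum_add_distrib]
  congr 1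
  · simp [kd, mul_comm]
  · rw [Finset.sum_comm]
    simp only [Finset.mul_sum]
    exact Finset.sum_congr rfl fun k _ => Finset.sum_congr rfl fun l _ => by ring

theorem bd_inner_layer {ρ a e : ℝ} (hρ : 0 ≤ ρ) {f g : Fin 8 → H → ℝ} {N : Fin 8 → H → V} {δ μ : ℝ}
    (hf : ∀ j, Bd ρ a (f j)) (hg : ∀ j, Bd ρ a (g j))
    (hN : ∀ i j, Bd ρ e (fun p => gd (fun k => N k p) i j))
    (hfg : Bd ρ μ (fun p => ∑ j, f j p * g j p - δ)) :
    Bd ρ (64 * a ^ 2 * e + μ) (fun p => ⟪layer f N p, layer g N p⟫ - δ) := by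
  refine ((hfg.add (Bd.sum_const hρ fun i => Bd.sum_const hρ fun j =>
    (hf i).mul hρ ((hg j).mul hρ (hN i j))) hρ).congr fun p => ?_).le
    (by push_cast; linarith)
  rw [inner_layer_layer]; ring

end Induction

section AddLayer

variable {V : Type*} [NormedAddCommGroup V] [InnerProductSpace ℝ V]

/-- Standing assumptions on the parameters of the construction. -/
structure Par (r L e μ η A c lam : ℝ) : Prop where
  r_pos : 0 < r
  r_le : r ≤ 1
  rL : 32 ≤ L * r
  A_ge : 100 * L ^ 2 ≤ A
  c_pos : 0 < c
  lam_nonneg : 0 ≤ lam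
  c_lam : c ^ 2 + lam ^ 2 = 1
  e_nonneg : 0 ≤ e
  η_ge : 64 * L ^ 2 * e + μ + 2000 * L ^ 3 / A ≤ η

variable {r L e μ η A c lam ζ R : ℝ}

theorem Par.L_ge (hp : Par r L e μ η A c lam) : 32 ≤ L := by
  nlinarith [hp.r_pos, hp.r_le, hp.rL]

theorem Par.A_pos (hp : Par r L e μ η A c lam) : 3200 ≤ A := by
  nlinarith [hp.L_ge, hp.A_ge]

theorem Par.lam_le (hp : Par r L e μ η A c lam) : lam ≤ 1 := by
  nlinarith [hp.c_lam, hp.lam_nonneg, sq_nonneg c]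

theorem Par.T_le (hp : Par r L e μ η A c lam) : L ^ 2 / A ≤ 1 / 100 := by
  have := hp.A_pos
  rw [div_le_iff₀ (by linarith)]
  linarith [hp.A_ge]

section

variable {g : Fin 8 → H → ℝ} {N Q : Fin 8 → H → V} {ψ : H → V}

theorem Pre.bd_wd (hp : Par r L e μ η A c lam) (hR : 0 < R)
    (h : Pre r L e η A c R N Q ψ) (j : Fin 8) (b : Bool) :
    Bd (r * R / 4) (L / (A * R)) (WD b (N j)) := by
  have hA := hp.A_pos
  have hr := hp.r_pos
  refine ((h.N2 j).wd (by positivity) b).mono (by positivity) ?_ ?_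
  · have : r * R * 3200 ≤ r * R * A := mul_le_mul_of_nonneg_left hA (by positivity)
    nlinarith [mul_pos hr hR]
  · rw [div_le_div_iff₀ (by positivity) (by positivity)]
    have : 32 * (A * R) ≤ L * r * (A * R) := mul_le_mul_of_nonneg_right hp.rL (by positivity)
    linarith

theorem Pre.bd_wd_wd (hp : Par r L e μ η A c lam) (hR : 0 < R)
    (h : Pre r L e η A c R N Q ψ) (j : Fin 8) (b b' : Bool) :
    Bd (r * R / 4) (L ^ 2 / (A * R) ^ 2) (WD b (WD b' (N j))) := by
  have hA := hp.A_pos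
  have hr := hp.r_pos
  refine ((h.N2 j).wd_wd (by positivity) b b').mono (by positivity) ?_ ?_
  · have : r * R * 3200 ≤ r * R * A := mul_le_mul_of_nonneg_left hA (by positivity)
    nlinarith [mul_pos hr hR]
  · rw [div_le_div_iff₀ (by positivity) (by positivity)]
    have h1 : 32 ^ 2 ≤ (L * r) ^ 2 := pow_le_pow_left₀ (by norm_num) hp.rL 2
    have : 32 ^ 2 * (A * R) ^ 2 ≤ (L * r) ^ 2 * (A * R) ^ 2 :=
      mul_le_mul_of_nonneg_right h1 (by positivity)
    nlinarith

theorem Pre.bd_N (hp : Par r L e μ η A c lam) (hR : 0 < R)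
    (h : Pre r L e η A c R N Q ψ) (j : Fin 8) : Bd (r * R) 2 (N j) := by
  have hA := hp.A_pos
  have hr := hp.r_pos
  refine (h.N2 j).radius (by positivity) ?_
  have : r * R * 3200 ≤ r * R * A := mul_le_mul_of_nonneg_left hA (by positivity)
  nlinarith [mul_pos hr hR]

theorem Pre.bd_NN (hp : Par r L e μ η A c lam) (hR : 0 < R)
    (h : Pre r L e η A c R N Q ψ) (i j : Fin 8) :
    Bd (r * R) e (fun p => gd (fun k => N k p) i j) := by
  have hA := hp.A_pos
  have hr := hp.r_pos
  refine (h.NN i j).radius (by positivity) ?_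
  have : r * R * 3200 ≤ r * R * A := mul_le_mul_of_nonneg_left hA (by positivity)
  nlinarith [mul_pos hr hR]

theorem Pre.bd_layer (hp : Par r L e μ η A c lam) (hR : 0 < R)
    (hg : Good r L μ ζ R g) (h : Pre r L e η A c R N Q ψ) : Bd (r * R) (16 * L * R) (layer g N) :=
  (HeisenbergEmbedding.bd_layer (mul_pos hp.r_pos hR).le hg.bd (h.bd_N hp hR)).le (by linarith)

theorem Pre.smooth_layer (hg : Good r L μ ζ R g) (h : Pre r L e η A c R N Q ψ) :
    Smooth (layer g N) :=
  HeisenbergEmbedding.smooth_layer (fun j => (hg.bd j).1) fun j => (h.N2 j).1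

theorem Pre.inner_layer_wd (h : Pre r L e η A c R N Q ψ) (f : Fin 8 → H → ℝ) (b : Bool) (p : H) :
    ⟪layer f N p, WD b ψ p⟫ = 0 := by
  simp [layer, sum_inner, inner_smul_left, h.orth]

theorem Pre.inner_layer_wd_wd (h : Pre r L e η A c R N Q ψ) (f : Fin 8 → H → ℝ) (b : Bool)
    (p : H) : ⟪layer f N p, WD b (WD b ψ) p⟫ = 0 := by
  simp [layer, sum_inner, inner_smul_left, h.orth2]

theorem Pre.inner_wd_layer (hg : Good r L μ ζ R g) (h : Pre r L e η A c R N Q ψ) (b b' : Bool)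
    (p : H) : ⟪WD b (layer g N) p, WD b' ψ p⟫ = -⟪layer g N p, WD b (WD b' ψ) p⟫ := by
  have h1 := congrFun (wd_inner b (h.smooth_layer hg) (h.smooth.wd b')) p
  have h2 : (fun p => ⟪layer g N p, WD b' ψ p⟫) = fun _ => 0 :=
    funext fun p => h.inner_layer_wd g b' p
  rw [h2, wd_const] at h1
  linarith

/-- Exact orthogonality of the new layer to the old ones. -/
theorem Pre.inner_wd_layer_self (hg : Good r L μ ζ R g) (h : Pre r L e η A c R N Q ψ) (b : Bool)
    (p : H) : ⟪WD b (layer g N) p, WD b ψ p⟫ = 0 := by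
  rw [h.inner_wd_layer hg, h.inner_layer_wd_wd, neg_zero]

theorem Pre.bd_wd_layer (hp : Par r L e μ η A c lam) (hR : 0 < R)
    (hg : Good r L μ ζ R g) (h : Pre r L e η A c R N Q ψ) :
    (∀ b, Bd (r * R / 4) (16 * L) (layer (fun j => WD b (g j)) N)) ∧
    (∀ b, Bd (r * R / 4) (8 * (L ^ 2 / A)) (layer g (fun j => WD b (N j)))) ∧
    (∀ b, Bd (r * R / 4) (17 * L) (WD b (layer g N))) := by
  have hA := hp.A_pos
  have hr := hp.r_pos
  have hρ : 0 ≤ r * R / 4 := by positivity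
  have h1 : ∀ b, Bd (r * R / 4) (16 * L) (layer (fun j => WD b (g j)) N) := fun b =>
    (HeisenbergEmbedding.bd_layer hρ (fun j => (hg.wd j b).radius hρ (by nlinarith [mul_pos hr hR]))
      fun j => (h.bd_N hp hR j).radius hρ (by nlinarith [mul_pos hr hR])).le (by linarith)
  have h2 : ∀ b, Bd (r * R / 4) (8 * (L ^ 2 / A)) (layer g (fun j => WD b (N j))) := fun b =>
    (HeisenbergEmbedding.bd_layer hρ (fun j => (hg.bd j).radius hρ (by nlinarith [mul_pos hr hR]))
      fun j => h.bd_wd hp hR j b).le (by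
        apply le_of_eq
        field_simp)
  refine ⟨h1, h2, fun b => ?_⟩
  rw [wd_layer (fun j => (hg.bd j).1) (fun j => (h.N2 j).1)]
  exact ((h1 b).add (h2 b) hρ).le (by linarith [hp.T_le, hp.L_ge])

theorem Pre.gram_layer (hp : Par r L e μ η A c lam) (hR : 0 < R)
    (hg : Good r L μ ζ R g) (h : Pre r L e η A c R N Q ψ) (b b' : Bool) :
    Bd (r * R / 4) (64 * L ^ 2 * e + μ + 300 * L ^ 3 / A)
      (fun p => ⟪WD b (layer g N) p, WD b' (layer g N) p⟫ - kd b b') := by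
  have hA := hp.A_pos
  have hr := hp.r_pos
  have hL := hp.L_ge
  have hρ : 0 ≤ r * R / 4 := by positivity
  obtain ⟨h1, h2, -⟩ := h.bd_wd_layer hp hR hg
  have h3 := bd_inner_layer hρ (fun j => (hg.wd j b).radius hρ (by nlinarith [mul_pos hr hR]))
    (fun j => (hg.wd j b').radius hρ (by nlinarith [mul_pos hr hR]))
    (fun i j => (h.bd_NN hp hR i j).radius hρ (by nlinarith [mul_pos hr hR])) (hg.grad b b')
  refine ((((h3.add ((h1 b).inner hρ (h2 b')) hρ).add ((h2 b).inner hρ (h1 b')) hρ).add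
    ((h2 b).inner hρ (h2 b')) hρ).congr fun p => ?_).le ?_
  · rw [wd_layer (fun j => (hg.bd j).1) (fun j => (h.N2 j).1),
      wd_layer (fun j => (hg.bd j).1) (fun j => (h.N2 j).1)]
    simp only [inner_add_left, inner_add_right]
    ring
  · have hT := hp.T_le
    have hT0 : 0 ≤ L ^ 2 / A := by positivity
    rw [show 300 * L ^ 3 / A = 300 * L * (L ^ 2 / A) by ring]
    nlinarith [mul_nonneg hT0 hT0]

theorem Pre.hess_layer (hp : Par r L e μ η A c lam) (hR : 0 < R)
    (hg : Good r L μ ζ R g) (h : Pre r L e η A c R N Q ψ) (b b' : Bool) :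
    Bd (r * R / 4) (24 * L ^ 2 / A / R) (fun p => WD b (WD b' (layer g N)) p -
      layer (fun j => WD b (WD b' (g j))) N p) := by
  have hA := hp.A_pos
  have hr := hp.r_pos
  have hL := hp.L_ge
  have hρ : 0 ≤ r * R / 4 := by positivity
  have h1 : ∀ b b', Bd (r * R / 4) (8 * L ^ 2 / A / R)
      (layer (fun j => WD b (g j)) (fun j => WD b' (N j))) := fun b b' =>
    (HeisenbergEmbedding.bd_layer hρ (fun j => (hg.wd j b).radius hρ (by nlinarith [mul_pos hr hR]))
      fun j => h.bd_wd hp hR j b').le (by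
        apply le_of_eq
        field_simp)
  have h2 : Bd (r * R / 4) (8 * L ^ 2 / A / R) (layer g (fun j => WD b (WD b' (N j)))) :=
    (HeisenbergEmbedding.bd_layer hρ (fun j => (hg.bd j).radius hρ (by nlinarith [mul_pos hr hR]))
      fun j => h.bd_wd_wd hp hR j b b').le (by
        have : 8 * (L * R) * (L ^ 2 / (A * R) ^ 2) = 8 * L ^ 2 / A / R * (L / A) := by
          field_simp
        rw [this]
        refine mul_le_of_le_one_right (by positivity) ?_
        rw [div_le_one (by linarith)]
        nlinarith [hp.A_ge])
  refine ((((h1 b' b).add (h1 b b') hρ).add h2 hρ).congr fun p => ?_).le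
    (le_of_eq (by ring))
  rw [wd_wd_layer (fun j => (hg.bd j).1) (fun j => (h.N2 j).1)]
  beta_reduce
  rw [add_sub_right_comm, add_sub_cancel_left, add_assoc]

/-- Adding a layer at scale `R`. -/
theorem inv_add_layer (hp : Par r L e μ η A c lam) (hR : 0 < R)
    (hg : Good r L μ ζ R g) (h : Pre r L e η A c R N Q ψ) :
    Inv r L e η A c R g Q N (fun p => layer g N p + lam • ψ p) := by
  have hA := hp.A_pos
  have hr := hp.r_pos
  have hL := hp.L_ge
  have hρ : 0 ≤ r * R / 4 := by positivity
  have hρ' : r * R / 4 ≤ r * R := by nlinarith [mul_pos hr hR]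
  have hT := hp.T_le
  have hT0 : 0 ≤ L ^ 2 / A := by positivity
  have hlam := hp.lam_le
  have hlam0 := hp.lam_nonneg
  have hφs := h.smooth_layer hg
  obtain ⟨-, -, hφ⟩ := h.bd_wd_layer hp hR hg
  have hwd : ∀ b, WD b (fun p => layer g N p + lam • ψ p) =
      fun p => WD b (layer g N) p + lam • WD b ψ p := fun b => by
    rw [wd_add b hφs (h.smooth.const_smul lam), wd_const_smul b lam h.smooth]
  have hwdwd : ∀ b b', WD b (WD b' (fun p => layer g N p + lam • ψ p)) =
      fun p => WD b (WD b' (layer g N)) p + lam • WD b (WD b' ψ) p := fun b b' => by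
    rw [hwd, wd_add b (hφs.wd b') ((h.smooth.wd b').const_smul lam),
      wd_const_smul b lam (h.smooth.wd b')]
  have hψ2 : ∀ b b', Bd (r * R / 4) (32 * L / A / R) (fun p => lam • WD b (WD b' ψ) p) :=
    fun b b' => (((h.hess b b').radius hρ hρ').const_smul hρ lam).le (by
      rw [abs_of_nonneg hlam0, div_div]
      exact mul_le_of_le_one_left (by positivity) hlam)
  have hLT : 32 * L / A / R ≤ L ^ 2 / A / R := by
    gcongr
    nlinarith
  have hD : ∀ b b', Bd (r * R / 4) (60 * L ^ 2 / A / R) (fun p =>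
      WD b (WD b' (fun p => layer g N p + lam • ψ p)) p -
        layer (fun j => WD b (WD b' (g j))) N p) := fun b b' => by
    refine (((h.hess_layer hp hR hg b b').add (hψ2 b b') hρ).congr fun p => ?_).le ?_
    · rw [hwdwd]
      beta_reduce
      rw [add_sub_right_comm]
    · have : 24 * L ^ 2 / A / R + L ^ 2 / A / R ≤ 60 * L ^ 2 / A / R := by
        rw [← add_div, ← add_div]
        gcongr
        nlinarith
      linarith
  have hNR : ∀ j, Bd (r * R / 4) 2 (N j) := fun j => (h.bd_N hp hR j).radius hρ hρ'
  have hQR : ∀ j, Bd (r * R / 4) 2 (Q j) := fun j => (h.Q2 j).radius hρ (by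
    have : r * R * 3200 ≤ r * R * A := mul_le_mul_of_nonneg_left hA (by positivity)
    nlinarith [mul_pos hr hR])
  refine ⟨hφs.add (h.smooth.const_smul lam), h.Q2, h.N2, h.QQ, h.NN, h.QN, fun b b' => ?_,
    fun b b' => ?_, fun j b => ?_, fun j b => ?_, fun b b' => ?_⟩
  · have hcross : ∀ b b', Bd (r * R / 4) (512 * L ^ 3 / A)
        (fun p => lam * ⟪WD b (layer g N) p, WD b' ψ p⟫) := fun b b' => by
      refine ((((((h.bd_layer hp hR hg).radius hρ hρ').inner hρ
        ((h.hess b b').radius hρ hρ')).neg hρ).const_mul hρ hlam0).congr fun p => ?_).le ?_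
      · rw [h.inner_wd_layer hg]
      · refine (mul_le_of_le_one_left (by positivity) hlam).trans ?_
        have : 16 * L * R * (32 * L / (A * R)) = 512 * L ^ 2 / A := by field_simp; norm_num
        rw [this]
        gcongr
        · linarith
        · norm_num
    have h1 := ((((h.gram_layer hp hR hg b b').add (hcross b b') hρ).add (hcross b' b)
      hρ).const_mul hρ (sq_nonneg c)).add
      (((h.grad b b').radius hρ hρ').const_mul hρ (sq_nonneg lam)) hρ
    refine (h1.congr fun p => ?_).le ?_
    · rw [hwd, hwd]
      simp only [inner_add_left, inner_add_right, inner_smul_left, inner_smul_right, conj_trivial]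
      rw [real_inner_comm (WD b' (layer g N) p) (WD b ψ p)]
      linear_combination kd b b' * hp.c_lam
    · have h2 : 64 * L ^ 2 * e + μ + 300 * L ^ 3 / A + 512 * L ^ 3 / A + 512 * L ^ 3 / A ≤ η := by
        refine le_trans ?_ hp.η_ge
        have : 0 ≤ L ^ 3 / A := by positivity
        rw [mul_div_assoc, mul_div_assoc, mul_div_assoc]
        linarith
      calc _ ≤ c ^ 2 * η + lam ^ 2 * η := by gcongr
        _ = η := by rw [← add_mul, hp.c_lam, one_mul]
  · have h1 : Bd (r * R / 4) (16 * L / R) (layer (fun j => WD b (WD b' (g j))) N) :=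
      (HeisenbergEmbedding.bd_layer hρ (fun j => hg.wdwd j b b') hNR).le (le_of_eq (by ring))
    refine (((hD b b').add h1 hρ).congr fun p => by abel).le ?_
    rw [← add_div]
    gcongr
    rw [mul_div_assoc]
    linarith
  · refine (((hNR j).inner hρ (hφ b)).congr fun p => ?_).le (by linarith)
    rw [hwd, inner_add_right, inner_smul_right, h.orth, mul_zero, add_zero]
  · refine ((((hQR j).inner hρ (hφ b)).add (((h.Qgrad j b).radius hρ hρ').const_mul hρ hlam0)
      hρ).congr fun p => ?_).le (by nlinarith)
    rw [hwd, inner_add_right, inner_smul_right]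
  · refine (((hD b b').const_smul hρ R).congr fun p => ?_).le (le_of_eq ?_)
    · rw [smul_sub, layer, Finset.smul_sum]
      simp only [smul_smul]
    · rw [abs_of_pos hR]
      field_simp

end

end AddLayer

section NextFrame

variable {V : Type*} [NormedAddCommGroup V] [InnerProductSpace ℝ V]

/-- Smallness assumptions on the parameters of the construction. -/
structure Small (L e μ η A c : ℝ) : Prop where
  μ_le : μ ≤ e
  A_ge : 2000 * L ^ 3 / A ≤ e ^ 2
  c_le : 1000 * L ^ 2 * c ≤ e ^ 2
  η_le : η ≤ 66 * L ^ 2 * e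
  e_le : 1000 * L ^ 2 * e ≤ 1

variable {r L e μ η A c lam ζ R : ℝ} {g : Fin 8 → H → ℝ} {P Q : Fin 8 → H → V} {ψ : H → V}

/-- The four vector fields (rescaled) to which the next frame has to be orthogonal. -/
def obstruction (c R : ℝ) (ψ : H → V) : Bool × Bool → H → V
  | (true, b), p => c • WD b ψ p
  | (false, b), p => R • WD b (WD b ψ) p

/-- An enumeration of `Bool × Bool`. -/
def boolPair : Fin 4 → Bool × Bool := ![(true, true), (true, false), (false, true), (false, false)]

theorem boolPair_injective : Function.Injective boolPair := by decide

theorem boolPair_surjective : Function.Surjective boolPair := by decide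

theorem Inv.bd_grad (hp : Par r L e μ η A c lam) (hs : Small L e μ η A c) (hR : 0 < R)
    (h : Inv r L e η A c R g P Q ψ) (b : Bool) :
    Bd (r * R / 4) 2 (fun p => c • WD b ψ p) := by
  have hr := hp.r_pos
  have hL := hp.L_ge
  have hc := hp.c_pos
  have he := hp.e_nonneg
  have hη : η ≤ 1 / 10 := by linarith [hs.e_le, hs.η_le]
  have he1 : e ≤ 1 := by nlinarith [hs.e_le]
  have h1 : ∀ p, ‖c • WD b ψ p‖ ≤ 11 / 10 := fun p => by
    have h1 := (abs_le.1 ((h.grad b b).abs_le p)).2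
    simp only [kd, if_true, real_inner_self_eq_norm_sq] at h1
    rw [norm_smul, Real.norm_of_nonneg hc.le]
    refine (abs_le_of_sq_le_sq' (b := 11 / 10) ?_ (by norm_num)).2
    rw [mul_pow]
    linarith
  have h2 := bd_of_norm_le_of_wd (r := r * R / 4) (by positivity)
    ((h.smooth.wd b).const_smul c) h1 (K := c * (32 * L / R)) fun b' => by
      have := (h.hess b' b).const_smul (by positivity) c
      rw [abs_of_pos hc] at this
      have h3 := wd_const_smul b' c (h.smooth.wd b)
      exact h3 ▸ this
  refine h2.le ?_
  have : 11 / 10 + 2 * (r * R / 4) * (c * (32 * L / R)) = 11 / 10 + 16 * (r * (c * L)) := by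
    field_simp; ring
  rw [this]
  have h4 : r * (c * L) ≤ 1 * (c * L) := mul_le_mul_of_nonneg_right hp.r_le (by positivity)
  have h5 : 1000 * (c * L) ≤ 1 := by
    refine le_trans ?_ (hs.c_le.trans (pow_le_one₀ he he1))
    nlinarith [mul_pos hc (by linarith : 0 < L)]
  linarith

theorem Good.hess_bd (hr : 0 < r) (hR : 0 < R) (hg : Good r L μ ζ R g) (b b' : Bool)
    (j : Fin 8) : Bd (r * R / 4) L (fun p => R * WD b (WD b' (g j)) p) :=
  ((hg.wdwd j b b').const_mul (by positivity) hR.le).le (le_of_eq (by field_simp))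

/-- The main part of the second derivatives of `ψ`. -/
def hessMain (R : ℝ) (g : Fin 8 → H → ℝ) (Q : Fin 8 → H → V) (b : Bool) : H → V :=
  layer (fun j p => R * WD b (WD b (g j)) p) Q

theorem Par.radius_le (hp : Par r L e μ η A c lam) (hR : 0 < R) :
    r * R / 4 ≤ r * (A * R) / 16 := by
  have : r * R * 3200 ≤ r * R * A :=
    mul_le_mul_of_nonneg_left hp.A_pos (mul_pos hp.r_pos hR).le
  nlinarith [mul_pos hp.r_pos hR]

theorem Inv.bd_hessMain (hp : Par r L e μ η A c lam) (hR : 0 < R)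
    (hg : Good r L μ ζ R g) (h : Inv r L e η A c R g P Q ψ) (b : Bool) :
    Bd (r * R / 4) (16 * L) (hessMain R g Q b) := by
  have hρ : 0 ≤ r * R / 4 := by have := hp.r_pos; positivity
  exact (bd_layer hρ (fun j => hg.hess_bd hp.r_pos hR b b j)
    fun j => (h.Q2 j).radius hρ (hp.radius_le hR)).le (by linarith)

theorem Inv.gram_obstruction (hp : Par r L e μ η A c lam) (hs : Small L e μ η A c) (hR : 0 < R)
    (hg : Good r L μ ζ R g) (h : Inv r L e η A c R g P Q ψ) (x y : Bool × Bool) :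
    Bd (r * R / 4) (100 * L ^ 2 * e)
      (fun p => ⟪obstruction c R ψ x p, obstruction c R ψ y p⟫ - kd x y) := by
  have hr := hp.r_pos
  have hL := hp.L_ge
  have hc := hp.c_pos
  have he := hp.e_nonneg
  have hA := hp.A_pos
  have he1 : e ≤ 1 := by nlinarith [hs.e_le]
  have he2 : e ^ 2 ≤ e := by nlinarith
  have hLe : e ≤ L ^ 2 * e := le_mul_of_one_le_left he (by nlinarith)
  have hρ : 0 ≤ r * R / 4 := by positivity
  have hT0 : 0 ≤ L ^ 2 / A := by positivity
  have hT := hp.T_le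
  have hLT : 2000 * L * (L ^ 2 / A) ≤ e ^ 2 := le_trans (le_of_eq (by ring)) hs.A_ge
  have hLT' : L ^ 2 / A ≤ L * (L ^ 2 / A) := by nlinarith
  have hu := h.bd_hessMain hp hR hg
  have hv : ∀ b, Bd (r * R / 4) (60 * (L ^ 2 / A))
      (fun p => R • WD b (WD b ψ) p - hessMain R g Q b p) := fun b =>
    (h.hess_approx b b).le (le_of_eq (by ring))
  have hmix : ∀ b b', Bd (r * R / 4) (100 * L ^ 2 * e)
      (fun p => ⟪c • WD b ψ p, R • WD b' (WD b' ψ) p⟫) := fun b b' => by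
    have h1 := (Bd.sum_const hρ fun j => (hg.hess_bd hr hR b' b' j).mul hρ
      (h.Qgrad j b)).const_mul hρ hc.le
    have h2 := (h.bd_grad hp hs hR b).inner hρ (hv b')
    refine ((h1.add h2 hρ).congr fun p => ?_).le ?_
    · rw [inner_sub_right]
      simp only [hessMain, layer, inner_sum, inner_smul_left, inner_smul_right, conj_trivial,
        Finset.mul_sum]
      rw [add_sub_assoc', eq_sub_iff_add_eq, add_comm, add_left_inj]
      exact Finset.sum_congr rfl fun j _ => by rw [real_inner_comm]; ring
    · push_cast
      have := hs.c_le
      nlinarith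
  obtain ⟨_ | _, b⟩ := x <;> obtain ⟨_ | _, b'⟩ := y
  · have h1 := bd_inner_layer hρ (hg.hess_bd hr hR b b) (hg.hess_bd hr hR b' b')
      (fun i j => (h.QQ i j).radius hρ (hp.radius_le hR)) (hg.hess b b')
    refine ((((h1.add ((hu b).inner hρ (hv b')) hρ).add ((hv b).inner hρ (hu b')) hρ).add
      ((hv b).inner hρ (hv b')) hρ).congr fun p => ?_).le ?_
    · have hk : kd (false, b) (false, b') = kd b b' := by simp [kd]
      rw [hk]
      simp only [obstruction, hessMain, inner_sub_left, inner_sub_right]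
      ring
    · have := hs.μ_le
      nlinarith [mul_le_mul_of_nonneg_left hT hT0]
  · refine (hmix b' b).congr fun p => ?_
    simp [obstruction, kd, real_inner_comm]
  · refine (hmix b b').congr fun p => ?_
    simp [obstruction, kd]
  · refine ((h.grad b b').congr fun p => ?_).le ?_
    · simp only [obstruction, kd, inner_smul_left, inner_smul_right, conj_trivial, Prod.mk.injEq,
        true_and]
      ring
    · nlinarith [hs.η_le]

theorem inner_corr_frame {m : ℕ} (P : V) (Q : Fin m → V) (l : Fin m) :
    ⟪corr P Q, Q l⟫ = -∑ k, ⟪P, Q k⟫ * gd Q k l := by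
  simp only [corr, gd, inner_sub_left, sum_inner, inner_smul_left, conj_trivial, mul_sub,
    Finset.sum_sub_distrib]
  simp [kd]

theorem Inv.corr_obstruction (hp : Par r L e μ η A c lam) (hs : Small L e μ η A c) (hR : 0 < R)
    (hg : Good r L μ ζ R g) (h : Inv r L e η A c R g P Q ψ) (j : Fin 8) (x : Bool × Bool) :
    Bd (r * R / 4) (100 * L ^ 2 * e ^ 2)
      (fun p => ⟪corr (P j p) (fun k => Q k p), obstruction c R ψ x p⟫) := by
  have hr := hp.r_pos
  have hL := hp.L_ge
  have hc := hp.c_pos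
  have he := hp.e_nonneg
  have hA := hp.A_pos
  have he1 : 1000 * e ≤ 1 := by nlinarith [hs.e_le]
  have hρ : 0 ≤ r * R / 4 := by positivity
  have hT0 : 0 ≤ L ^ 2 / A := by positivity
  have hLT : 2000 * L * (L ^ 2 / A) ≤ e ^ 2 := le_trans (le_of_eq (by ring)) hs.A_ge
  have hLT' : L ^ 2 / A ≤ L * (L ^ 2 / A) := by nlinarith
  have hPQ : ∀ i j, Bd (r * R / 4) e (fun p => ⟪P i p, Q j p⟫) := fun i j =>
    (h.PQ i j).radius hρ (hp.radius_le hR)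
  have hQQ : ∀ i j, Bd (r * R / 4) e (fun p => gd (fun k => Q k p) i j) := fun i j =>
    (h.QQ i j).radius hρ (hp.radius_le hR)
  have hQ2 : ∀ j, Bd (r * R / 4) 2 (Q j) := fun j => (h.Q2 j).radius hρ (hp.radius_le hR)
  have hP2 : Bd (r * R / 4) 2 (P j) := (h.P2 j).radius hρ (hp.radius_le hR)
  obtain ⟨_ | _, b⟩ := x
  · have hcQ : ∀ l, Bd (r * R / 4) (8 * e ^ 2)
        (fun p => ⟪corr (P j p) (fun k => Q k p), Q l p⟫) := fun l =>
      (((Bd.sum_const hρ fun k => (hPQ j k).mul hρ (hQQ k l)).neg hρ).congr fun p =>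
        inner_corr_frame _ _ _).le (by push_cast; nlinarith)
    have hcb : Bd (r * R / 4) 3 (fun p => corr (P j p) (fun k => Q k p)) :=
      ((hP2.sub (Bd.sum_const hρ fun k => (hPQ j k).smul hρ (hQ2 k)) hρ)).le
        (by push_cast; linarith)
    have h1 := Bd.sum_const hρ fun l => (hg.hess_bd hr hR b b l).mul hρ (hcQ l)
    have h2 := hcb.inner hρ (h.hess_approx b b)
    refine ((h1.add h2 hρ).congr fun p => ?_).le ?_
    · rw [inner_sub_right]
      simp only [obstruction, inner_sum, inner_smul_right]
      ring
    · push_cast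
      rw [mul_div_assoc]
      nlinarith [mul_nonneg (sq_nonneg e) (by linarith : 0 ≤ L)]
  · have h1 := ((h.Pgrad j b).sub (Bd.sum_const hρ fun k => (hPQ j k).mul hρ (h.Qgrad k b))
      hρ).const_mul hρ hc.le
    refine (h1.congr fun p => ?_).le ?_
    · simp only [obstruction, corr, inner_sub_left, sum_inner, inner_smul_left, inner_smul_right,
        conj_trivial, mul_sub, Finset.mul_sum]
    · push_cast
      have h3 : c * (100 * L + 8 * (e * (50 * L))) ≤ c * (1000 * L ^ 2) := by
        gcongr
        nlinarith
      have h4 : e ^ 2 ≤ 100 * L ^ 2 * e ^ 2 :=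
        le_mul_of_one_le_left (sq_nonneg e) (by nlinarith)
      linarith [hs.c_le]

variable (V) in
/-- Passing to the next scale. -/
theorem exists_pre_of_inv (L : ℝ) (hL : 1 ≤ L) : ∃ C : ℝ, 1 ≤ C ∧ ∀ {r e μ η A c lam ζ R : ℝ}
    {g : Fin 8 → H → ℝ} {P Q : Fin 8 → H → V} {ψ : H → V}, Par r L e μ η A c lam →
    Small L e μ η A c → C * e ≤ 1 → 0 < R → Good r L μ ζ R g → Inv r L e η A c R g P Q ψ →
    ∃ N : Fin 8 → H → V, Pre r L e η A c (R / A) N Q ψ := by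
  obtain ⟨C, hC, hframe⟩ := exists_frame V (100 * L ^ 2) (by nlinarith)
  refine ⟨C, hC, fun {r e μ η A c lam ζ R g P Q ψ} hp hs hCe hR hg h => ?_⟩
  have hr := hp.r_pos
  have hL := hp.L_ge
  have hc := hp.c_pos
  have hA := hp.A_pos
  have hρ : 0 ≤ r * R / 4 := by positivity
  have hle := hp.radius_le hR
  have hbd : ∀ x, Bd (r * R / 4) (100 * L ^ 2) (obstruction c R ψ x) := by
    rintro ⟨_ | _, b⟩
    · refine ((h.hess b b).const_smul hρ R).le ?_
      rw [abs_of_pos hR, mul_div_cancel₀ _ hR.ne']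
      nlinarith
    · exact (h.bd_grad hp hs hR b).le (by nlinarith)
  obtain ⟨N, hN2, hNw, hNN, hQN⟩ := hframe e (r * R / 4) hp.e_nonneg hCe hρ P Q
    (fun i => obstruction c R ψ (boolPair i)) (fun j => (h.P2 j).radius hρ hle)
    (fun j => (h.Q2 j).radius hρ hle) (fun i j => (h.PP i j).radius hρ hle)
    (fun i j => (h.QQ i j).radius hρ hle) (fun i j => (h.PQ i j).radius hρ hle)
    (fun i => hbd _) (fun i j => by
      refine (h.gram_obstruction hp hs hR hg (boolPair i) (boolPair j)).congr fun p => ?_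
      simp only [kd, boolPair_injective.eq_iff])
    (fun j i => h.corr_obstruction hp hs hR hg j _)
  have hNo : ∀ j x p, ⟪N j p, obstruction c R ψ x p⟫ = 0 := fun j x p => by
    obtain ⟨i, rfl⟩ := boolPair_surjective x
    exact hNw j i p
  have hAR : A * (R / A) = R := mul_div_cancel₀ _ (by linarith)
  have hd : r * (R / A) ≤ r * R / 4 := by
    rw [mul_div_assoc]
    gcongr
    linarith
  have hd0 : 0 ≤ r * (R / A) := by positivity
  have h16 : r * R / 16 = r * R / 4 / 4 := by ring
  refine ⟨N, h.smooth, ?_, ?_, ?_, ?_, ?_, fun j b p => ?_, fun j b p => ?_, ?_, ?_, ?_⟩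
  · rw [hAR, h16]; exact hN2
  · rw [hAR]; exact fun j => (h.Q2 j).radius (by positivity) (by linarith)
  · rw [hAR]; exact fun i j => (hNN i j).radius (by positivity) (by linarith)
  · rw [hAR]; exact fun i j => (h.QQ i j).radius (by positivity) (by linarith)
  · rw [hAR]; exact fun i j => (hQN i j).radius (by positivity) (by linarith)
  · have := hNo j (true, b) p
    simpa [obstruction, inner_smul_right, hc.ne'] using this
  · have := hNo j (false, b) p
    simpa [obstruction, inner_smul_right, hR.ne'] using this
  · exact fun b b' => (h.grad b b').radius hd0 hd
  · rw [hAR]; exact fun b b' => (h.hess b b').radius hd0 hd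
  · exact fun j b => (h.Qgrad j b).radius hd0 hd

end NextFrame

section Limits

open Filter Topology

variable {E : Type*} [NormedAddCommGroup E] [NormedSpace ℝ E]

/-- The linear map with values `a`, `b`, `d` on the vectors `X`, `Y`, `Z` at `p`. -/
def frameMap (p : H) (a b d : E) : H →L[ℝ] E :=
  (ContinuousLinearMap.fst ℝ ℝ (ℝ × ℝ)).smulRight (a - p.2.1 • d) +
    (((ContinuousLinearMap.fst ℝ ℝ ℝ).comp (ContinuousLinearMap.snd ℝ ℝ (ℝ × ℝ))).smulRight b +
    ((ContinuousLinearMap.snd ℝ ℝ ℝ).comp (ContinuousLinearMap.snd ℝ ℝ (ℝ × ℝ))).smulRight d)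

theorem frameMap_apply (p v : H) (a b d : E) :
    frameMap p a b d v = v.1 • (a - p.2.1 • d) + (v.2.1 • b + v.2.2 • d) := by
  simp [frameMap]

theorem fderiv_eq_frameMap (f : H → E) (p : H) :
    fderiv ℝ f p = frameMap p (WD true f p) (WD false f p) (ZD f p) := by
  refine ContinuousLinearMap.ext fun v => ?_
  rw [frameMap_apply]
  have hv : v = v.1 • ((1, 0, p.2.1) : H) + (v.2.1 • ((0, 1, 0) : H) +
      (v.2.2 - v.1 * p.2.1) • ((0, 0, 1) : H)) := by
    ext <;> simp
  conv_lhs => rw [hv]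
  simp only [map_add, map_smul, WD_eq, vec, ZD]
  module

theorem norm_frameMap_apply_le (p v : H) {a b d : E} {B : ℝ} (ha : ‖a‖ ≤ B) (hb : ‖b‖ ≤ B)
    (hd : ‖d‖ ≤ B) : ‖frameMap p a b d v‖ ≤ (3 + |p.2.1|) * B * ‖v‖ := by
  rw [frameMap_apply]
  have h1 : ‖v.1‖ ≤ ‖v‖ := norm_fst_le v
  have h2 : ‖v.2.1‖ ≤ ‖v‖ := (norm_fst_le v.2).trans (norm_snd_le v)
  have h3 : ‖v.2.2‖ ≤ ‖v‖ := (norm_snd_le v.2).trans (norm_snd_le v)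
  have hB : 0 ≤ B := (norm_nonneg _).trans ha
  calc ‖v.1 • (a - p.2.1 • d) + (v.2.1 • b + v.2.2 • d)‖
      ≤ ‖v.1‖ * (‖a‖ + |p.2.1| * ‖d‖) + (‖v.2.1‖ * ‖b‖ + ‖v.2.2‖ * ‖d‖) := by
        refine (norm_add_le _ _).trans (add_le_add ?_ ((norm_add_le _ _).trans ?_))
        · rw [norm_smul]
          gcongr
          refine (norm_sub_le _ _).trans ?_
          rw [norm_smul, Real.norm_eq_abs]
        · rw [norm_smul, norm_smul]
    _ ≤ ‖v‖ * (B + |p.2.1| * B) + (‖v‖ * B + ‖v‖ * B) := by gcongr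
    _ = _ := by ring

/-- A Lipschitz bound on strips. -/
theorem norm_sub_le_of_frame {f : H → E} (hf : Smooth f) {B m : ℝ}
    (hX : ∀ b p, ‖WD b f p‖ ≤ B) (hZ : ∀ p, ‖ZD f p‖ ≤ B) {x y : H} (hx : |x.2.1| ≤ m)
    (hy : |y.2.1| ≤ m) : ‖f x - f y‖ ≤ (3 + m) * B * ‖x - y‖ := by
  have hB : 0 ≤ B := (norm_nonneg _).trans (hX true x)
  have hconv : Convex ℝ {p : H | |p.2.1| ≤ m} := by
    have : {p : H | |p.2.1| ≤ m} = (fun p : H => p.2.1) ⁻¹' (Set.Icc (-m) m) := by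
      ext p; simp [abs_le]
    rw [this]
    exact (convex_Icc _ _).linear_preimage
      ((LinearMap.fst ℝ ℝ ℝ).comp (LinearMap.snd ℝ ℝ (ℝ × ℝ)))
  refine hconv.norm_image_sub_le_of_norm_fderiv_le (𝕜 := ℝ) (fun p _ => hf.diff p) (fun p hp => ?_) hy hx
  have hm : 0 ≤ m := (abs_nonneg _).trans hx
  refine ContinuousLinearMap.opNorm_le_bound _ (by positivity) fun v => ?_
  rw [fderiv_eq_frameMap]
  refine (norm_frameMap_apply_le p v (hX _ _) (hX _ _) (hZ _)).trans ?_
  have : |p.2.1| ≤ m := hp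
  gcongr

/-- A Taylor bound depending only on bounds for the horizontal derivatives. -/
theorem norm_taylor_le {f : H → E} (hf : Smooth f) {B : ℝ}
    (hZ : ∀ p, ‖ZD f p‖ ≤ B)
    (hXX : ∀ b b' p, ‖WD b (WD b' f) p‖ ≤ B) (hZX : ∀ b p, ‖ZD (WD b f) p‖ ≤ B)
    (hXZ : ∀ b p, ‖WD b (ZD f) p‖ ≤ B) (hZZ : ∀ p, ‖ZD (ZD f) p‖ ≤ B) (hZs : Smooth (ZD f))
    {p x : H} (hx : ‖x - p‖ ≤ 1) :
    ‖f x - f p - fderiv ℝ f p (x - p)‖ ≤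
      ((3 + (|p.2.1| + 1)) ^ 2 * B + B) * ‖x - p‖ * ‖x - p‖ := by
  have hB : 0 ≤ B := (norm_nonneg _).trans (hZ x)
  set m := |p.2.1| + 1 with hm
  have hm0 : 0 ≤ m := by positivity
  have hpm : |p.2.1| ≤ m := by linarith
  have hconv : Convex ℝ (Metric.closedBall p ‖x - p‖) := convex_closedBall _ _
  refine hconv.norm_image_sub_le_of_norm_fderiv_le' (𝕜 := ℝ) (fun q _ => hf.diff q)
    (fun q hq => ?_) (Metric.mem_closedBall_self (norm_nonneg _)) (by simp [dist_eq_norm])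
  rw [Metric.mem_closedBall, dist_eq_norm] at hq
  have hq1 : |q.2.1 - p.2.1| ≤ ‖q - p‖ := (norm_fst_le (q - p).2).trans (norm_snd_le (q - p))
  have hqm : |q.2.1| ≤ m := by
    have := abs_sub_abs_le_abs_sub q.2.1 p.2.1
    linarith
  have hX : ∀ b, ‖WD b f q - WD b f p‖ ≤ (3 + m) * B * ‖x - p‖ := fun b =>
    (norm_sub_le_of_frame (hf.wd b) (fun b' => hXX b' b) (hZX b) hqm hpm).trans (by gcongr)
  have hZl : ‖ZD f q - ZD f p‖ ≤ (3 + m) * B * ‖x - p‖ :=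
    (norm_sub_le_of_frame hZs hXZ hZZ hqm hpm).trans (by gcongr)
  refine ContinuousLinearMap.opNorm_le_bound _ (by positivity) fun v => ?_
  have hdec : (fderiv ℝ f q - fderiv ℝ f p) v =
      frameMap q (WD true f q - WD true f p) (WD false f q - WD false f p) (ZD f q - ZD f p) v -
        (v.1 * (q.2.1 - p.2.1)) • ZD f p := by
    rw [sub_apply, fderiv_eq_frameMap, fderiv_eq_frameMap, frameMap_apply,
      frameMap_apply, frameMap_apply]
    module
  rw [hdec]
  refine (norm_sub_le _ _).trans ?_
  have h1 := norm_frameMap_apply_le q v (hX true) (hX false) hZl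
  have h2 : ‖(v.1 * (q.2.1 - p.2.1)) • ZD f p‖ ≤ ‖v‖ * ‖x - p‖ * B := by
    rw [norm_smul, norm_mul]
    have h1 : ‖v.1‖ ≤ ‖v‖ := norm_fst_le v
    have := hZ p
    have h3 : ‖q.2.1 - p.2.1‖ ≤ ‖x - p‖ := hq1.trans hq
    gcongr
  have h3 : (3 + |q.2.1|) * ((3 + m) * B * ‖x - p‖) * ‖v‖ ≤
      (3 + m) * ((3 + m) * B * ‖x - p‖) * ‖v‖ := by gcongr
  refine (add_le_add (h1.trans h3) h2).trans (le_of_eq ?_)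
  ring

theorem norm_foldr_le (l : List Bool) (f : H → E) (p : H) :
    ‖l.foldr WD f p‖ ≤ wordSum l.length f p := by
  induction l using List.reverseRecOn generalizing f with
  | nil => exact le_rfl
  | append_singleton l b ih =>
    rw [List.foldr_append, List.length_append]
    refine (ih _).trans ?_
    cases b
    · exact le_add_of_nonneg_left (wordSum_nonneg _ _ _)
    · exact le_add_of_nonneg_right (wordSum_nonneg _ _ _)

/-- The bound for words of length `k` implied by `Bd r K`. -/
theorem Bd.norm_foldr_le {r K : ℝ} (hr : 0 < r) {f : H → E} (hf : Bd r K f) (l : List Bool)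
    (p : H) : ‖l.foldr WD f p‖ ≤ l.length.factorial * K / r ^ l.length := by
  refine (HeisenbergEmbedding.norm_foldr_le l f p).trans ?_
  rw [le_div_iff₀ (by positivity), mul_comm]
  exact hf.wordSum_le hr.le _ p

theorem smooth_zd {f : H → E} (hf : Smooth f) : Smooth (ZD f) := by
  rw [show ZD f = _ from funext (zd_eq hf)]
  exact ((hf.wd true).wd false).sub ((hf.wd false).wd true)

theorem wd_zd {f : H → E} (hf : Smooth f) (b : Bool) (p : H) : WD b (ZD f) p =
    WD b (WD false (WD true f)) p - WD b (WD true (WD false f)) p := by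
  rw [show ZD f = _ from funext (zd_eq hf),
    wd_sub b ((hf.wd true).wd false) ((hf.wd false).wd true)]

variable [FiniteDimensional ℝ E]

theorem exists_tendsto_of_bounded (F : Ultrafilter ℕ) {f : ℕ → E} {B : ℝ}
    (h : ∀ᶠ n in (F : Filter ℕ), ‖f n‖ ≤ B) : ∃ x, Tendsto f F (𝓝 x) := by
  have : ProperSpace E := FiniteDimensional.proper_real E
  have hc : IsCompact (Metric.closedBall (0 : E) B) := isCompact_closedBall _ _
  obtain ⟨x, -, hx⟩ := hc.ultrafilter_le_nhds (F.map f) (by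
    rw [Ultrafilter.coe_map, le_principal_iff, mem_map]
    filter_upwards [h] with n hn
    simpa using hn)
  exact ⟨x, hx⟩

/-- Limits of maps with uniformly bounded analytic norm. -/
theorem exists_limit (F : Ultrafilter ℕ) {r K : ℝ} (hr : 0 < r) {f : ℕ → H → E}
    (hf : ∀ᶠ n in (F : Filter ℕ), Bd r K (f n)) : ∃ h : H → E, Bd r K h ∧
      ∀ (l : List Bool) (p : H), Tendsto (fun n => l.foldr WD (f n) p) F (𝓝 (l.foldr WD h p)) := by
  have hex : ∀ (l : List Bool) (p : H), ∃ x, Tendsto (fun n => l.foldr WD (f n) p) F (𝓝 x) :=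
    fun l p => exists_tendsto_of_bounded F (hf.mono fun n hn => hn.norm_foldr_le hr l p)
  choose w hw using hex
  have hder : ∀ l p, HasFDerivAt (w l) (frameMap p (w (true :: l) p) (w (false :: l) p)
      (w (false :: true :: l) p - w (true :: false :: l) p)) p := by
    intro l p
    obtain ⟨B, hB⟩ : ∃ B : ℝ, ∀ k : ℕ, k ≤ 4 →
        2 * (2 * ((l.length + k).factorial * K / r ^ (l.length + k))) ≤ B := by
      obtain ⟨B, hB⟩ := ((Set.finite_Iic 4).image fun k : ℕ =>
        2 * (2 * ((l.length + k).factorial * K / r ^ (l.length + k)))).bddAbove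
      exact ⟨B, fun k hk => hB ⟨k, hk, rfl⟩⟩
    have htay : ∀ x : H, ‖x - p‖ ≤ 1 →
        ‖w l x - w l p - frameMap p (w (true :: l) p) (w (false :: l) p)
          (w (false :: true :: l) p - w (true :: false :: l) p) (x - p)‖ ≤
        ((3 + (|p.2.1| + 1)) ^ 2 * B + B) * ‖x - p‖ * ‖x - p‖ := by
      intro x hx
      have hlim : Tendsto (fun n => ‖l.foldr WD (f n) x - l.foldr WD (f n) p -
          frameMap p ((true :: l).foldr WD (f n) p) ((false :: l).foldr WD (f n) p)
          ((false :: true :: l).foldr WD (f n) p - (true :: false :: l).foldr WD (f n) p)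
            (x - p)‖) F
          (𝓝 ‖w l x - w l p - frameMap p (w (true :: l) p) (w (false :: l) p)
          (w (false :: true :: l) p - w (true :: false :: l) p) (x - p)‖) := by
        simp only [frameMap_apply]
        have hd := (hw (false :: true :: l) p).sub (hw (true :: false :: l) p)
        exact (((hw l x).sub (hw l p)).sub
          ((((hw (true :: l) p).sub (hd.const_smul _)).const_smul _).add
            (((hw (false :: l) p).const_smul _).add (hd.const_smul _)))).norm
      refine le_of_tendsto hlim (hf.mono fun n hn => ?_)
      have hs : Smooth (l.foldr WD (f n)) := hn.1.foldr l
      have hb : ∀ (l' : List Bool) (k : ℕ), k ≤ 4 → l'.length = l.length + k → ∀ q,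
          2 * (2 * ‖l'.foldr WD (f n) q‖) ≤ B := fun l' k hk hl q => by
        refine le_trans ?_ (hB k hk)
        have := hn.norm_foldr_le hr l' q
        rw [hl] at this
        linarith
      have hb1 : ∀ b q, 2 * (2 * ‖WD b (l.foldr WD (f n)) q‖) ≤ B := fun b q =>
        hb (b :: l) 1 (by norm_num) rfl q
      have hb2 : ∀ b b' q, 2 * (2 * ‖WD b (WD b' (l.foldr WD (f n))) q‖) ≤ B := fun b b' q =>
        hb (b :: b' :: l) 2 (by norm_num) rfl q
      have hb3 : ∀ b b' b'' q, 2 * (2 * ‖WD b (WD b' (WD b'' (l.foldr WD (f n)))) q‖) ≤ B :=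
        fun b b' b'' q => hb (b :: b' :: b'' :: l) 3 (by norm_num) rfl q
      have hb4 : ∀ b b' b'' b3 q,
          2 * (2 * ‖WD b (WD b' (WD b'' (WD b3 (l.foldr WD (f n))))) q‖) ≤ B :=
        fun b b' b'' b3 q => hb (b :: b' :: b'' :: b3 :: l) 4 (by norm_num) rfl q
      have key := norm_taylor_le hs (B := B) (p := p) (x := x) (fun q => ?_) (fun b b' q => ?_)
        (fun b q => ?_) (fun b q => ?_) (fun q => ?_) (smooth_zd hs) hx
      · rw [fderiv_eq_frameMap, zd_eq hs] at key
        exact key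
      · rw [zd_eq hs]
        refine (norm_sub_le _ _).trans ?_
        linarith [hb2 false true q, hb2 true false q,
          norm_nonneg (WD false (WD true (l.foldr WD (f n))) q),
          norm_nonneg (WD true (WD false (l.foldr WD (f n))) q)]
      · linarith [hb2 b b' q, norm_nonneg (WD b (WD b' (l.foldr WD (f n))) q)]
      · rw [zd_eq (hs.wd b)]
        refine (norm_sub_le _ _).trans ?_
        linarith [hb3 false true b q, hb3 true false b q,
          norm_nonneg (WD false (WD true (WD b (l.foldr WD (f n)))) q),
          norm_nonneg (WD true (WD false (WD b (l.foldr WD (f n)))) q)]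
      · rw [wd_zd hs]
        refine (norm_sub_le _ _).trans ?_
        linarith [hb3 b false true q, hb3 b true false q,
          norm_nonneg (WD b (WD false (WD true (l.foldr WD (f n)))) q),
          norm_nonneg (WD b (WD true (WD false (l.foldr WD (f n)))) q)]
      · have hss : ∀ b b', Smooth (WD b (WD b' (l.foldr WD (f n)))) := fun b b' => (hs.wd b').wd b
        have hZ1 : ∀ b, WD b (ZD (l.foldr WD (f n))) = fun q =>
            WD b (WD false (WD true (l.foldr WD (f n)))) q -
              WD b (WD true (WD false (l.foldr WD (f n)))) q := fun b => funext (wd_zd hs b)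
        rw [zd_eq (smooth_zd hs), hZ1, hZ1, wd_sub _ ((hss _ _).wd _) ((hss _ _).wd _),
          wd_sub _ ((hss _ _).wd _) ((hss _ _).wd _)]
        refine (norm_sub_le _ _).trans
          ((add_le_add (norm_sub_le _ _) (norm_sub_le _ _)).trans ?_)
        linarith [hb4 false true false true q, hb4 false true true false q,
          hb4 true false false true q, hb4 true false true false q]
    refine HasFDerivAt.of_isLittleO (Asymptotics.isLittleO_iff.2 fun δ hδ => ?_)
    set K' := (3 + (|p.2.1| + 1)) ^ 2 * B + B with hK'
    have hnear : ∀ᶠ x in 𝓝 p, ‖x - p‖ < min 1 (δ / (|K'| + 1)) := by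
      have : Tendsto (fun x => ‖x - p‖) (𝓝 p) (𝓝 0) := tendsto_norm_sub_self p
      exact this.eventually_lt_const (by positivity)
    filter_upwards [hnear] with x hx
    rw [lt_min_iff] at hx
    refine (htay x hx.1.le).trans ?_
    gcongr
    have h1 := hx.2
    rw [lt_div_iff₀ (by positivity)] at h1
    nlinarith [le_abs_self K', norm_nonneg (x - p)]
  have hsm : ∀ (n : ℕ) l, ContDiff ℝ n (w l) := by
    intro n
    induction n with
    | zero =>
      intro l
      exact contDiff_zero.2 (continuous_iff_continuousAt.2 fun p => (hder l p).continuousAt)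
    | succ n ih =>
      intro l
      push_cast
      rw [contDiff_succ_iff_fderiv]
      refine ⟨fun p => (hder l p).differentiableAt, by simp, ?_⟩
      rw [show fderiv ℝ (w l) = _ from funext fun p => (hder l p).fderiv]
      unfold frameMap
      have hy : ContDiff ℝ n (fun p : H => p.2.1) := contDiff_fst.comp contDiff_snd
      have hd := (ih (false :: true :: l)).sub (ih (true :: false :: l))
      exact (contDiff_const.smulRight ((ih _).sub (hy.smul hd))).add
        ((contDiff_const.smulRight (ih _)).add (contDiff_const.smulRight hd))
  have hsmooth : ∀ l, Smooth (w l) := fun l => contDiff_infty.2 fun n => hsm n l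
  have hWw : ∀ b l, WD b (w l) = w (b :: l) := by
    intro b l
    funext p
    rw [WD_eq, (hder l p).fderiv, frameMap_apply]
    cases b <;> simp [vec]
  have hfold : ∀ l, l.foldr WD (w []) = w l := fun l => by
    induction l with
    | nil => rfl
    | cons b l ih => rw [List.foldr_cons, ih, hWw]
  have hws : ∀ k l p, Tendsto (fun n => wordSum k (l.foldr WD (f n)) p) F
      (𝓝 (wordSum k (w l) p)) := by
    intro k
    induction k with
    | zero => exact fun l p => (hw l p).norm
    | succ k ih =>
      intro l p
      simp only [wordSum, hWw]
      exact (ih (true :: l) p).add (ih (false :: l) p)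
  refine ⟨w [], ⟨hsmooth [], fun p n => ?_⟩, fun l p => ?_⟩
  · have hlim : Tendsto (fun m => partialNorm r n (f m) p) F (𝓝 (partialNorm r n (w []) p)) :=
      tendsto_finsetSum _ fun k _ => (hws k [] p).const_mul _
    exact le_of_tendsto hlim (hf.mono fun m hm => hm.2 p n)
  · rw [hfold]
    exact hw l p

end Limits

section Tower

open Filter Topology

variable {V : Type*} [NormedAddCommGroup V] [InnerProductSpace ℝ V]
  {r L e μ η A c lam ζ R : ℝ}

theorem exists_seq {α : Type*} {P : ℕ → α → Prop} {S : ℕ → α → α → Prop} (h0 : ∃ a, P 0 a)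
    (hnext : ∀ k a, P k a → ∃ b, P (k + 1) b ∧ S k a b) :
    ∃ f : ℕ → α, ∀ k, P k (f k) ∧ S k (f k) (f (k + 1)) := by
  obtain ⟨a, ha⟩ := h0
  choose! F hF using hnext
  let f : ℕ → α := fun k => Nat.rec a (fun k x => F k x) k
  have hf : ∀ k, P k (f k) := fun k => by
    induction k with
    | zero => exact ha
    | succ k ih => exact (hF k _ ih).1
  exact ⟨f, fun k => ⟨hf k, (hF k _ (hf k)).2⟩⟩

theorem inner_eq_kd {ι : Type*} [DecidableEq ι] {v : ι → V} (hv : Orthonormal ℝ v) (i j : ι) :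
    ⟪v i, v j⟫ = kd i j := by
  rw [orthonormal_iff_ite.1 hv]; rfl

/-- The linear map used to start the construction. -/
def startMap (c : ℝ) (v : Fin 18 → V) : H →L[ℝ] V :=
  (ContinuousLinearMap.fst ℝ ℝ (ℝ × ℝ)).smulRight (c⁻¹ • v 16) +
    ((ContinuousLinearMap.fst ℝ ℝ ℝ).comp (ContinuousLinearMap.snd ℝ ℝ (ℝ × ℝ))).smulRight
      (c⁻¹ • v 17)

/-- The index of the direction of the start map. -/
def startIndex (b : Bool) : Fin 18 := if b then 16 else 17

theorem wd_startMap (c : ℝ) (v : Fin 18 → V) (b : Bool) :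
    WD b (startMap c v) = fun _ => c⁻¹ • v (startIndex b) := by
  funext p
  rw [WD_eq, (startMap c v).fderiv]
  cases b <;> simp [startMap, vec, startIndex]

theorem pre_start (hp : Par r L e μ η A c lam) (hη : 0 ≤ η) (hR : 0 < R) {v : Fin 18 → V}
    (hv : Orthonormal ℝ v) :
    Pre r L e η A c R (fun j _ => v (Fin.castAdd 2 (Fin.natAdd 8 j)))
      (fun j _ => v (Fin.castAdd 2 (Fin.castAdd 8 j))) (startMap c v) := by
  have hc := hp.c_pos
  have hA := hp.A_pos
  have hL := hp.L_ge
  have h2 : ∀ i, Bd (r * (A * R) / 16) 2 (fun _ : H => v i) := fun i =>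
    (bd_const _ _).le (by rw [hv.1]; norm_num)
  have hconst : ∀ {ρ K a : ℝ}, a = 0 → 0 ≤ K → Bd ρ K (fun _ : H => a) := fun {ρ K a} ha hK =>
    (bd_const ρ a).le (by simpa [ha] using hK)
  refine ⟨(startMap c v).contDiff, fun j => h2 _, fun j => h2 _, fun i j => ?_, fun i j => ?_,
    fun i j => ?_, fun j b p => ?_, fun j b p => ?_, fun b b' => ?_, fun b b' => ?_,
    fun j b => ?_⟩
  · refine hconst ?_ hp.e_nonneg
    simp [gd, inner_eq_kd hv, kd, Fin.ext_iff]
  · refine hconst ?_ hp.e_nonneg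
    simp [gd, inner_eq_kd hv, kd, Fin.ext_iff]
  · refine hconst ?_ hp.e_nonneg
    rw [inner_eq_kd hv, kd, if_neg]
    intro h
    have := congrArg Fin.val h
    simp at this
    omega
  · rw [wd_startMap, inner_smul_right, inner_eq_kd hv, kd, if_neg, mul_zero]
    intro h
    have := congrArg Fin.val h
    cases b <;> simp [startIndex] at this <;> omega
  · rw [wd_startMap, wd_const, inner_zero_right]
  · simp only [wd_startMap, inner_smul_left, inner_smul_right, conj_trivial, inner_eq_kd hv]
    refine hconst ?_ hη
    have : kd (startIndex b) (startIndex b') = kd b b' := by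
      cases b <;> cases b' <;> simp [kd, startIndex]
    rw [this]
    field_simp
    ring
  · rw [wd_startMap, wd_const]
    exact (bd_zero _).le (by positivity)
  · simp only [wd_startMap, inner_smul_right, inner_eq_kd hv]
    refine hconst ?_ (by positivity)
    rw [kd, if_neg, mul_zero]
    intro h
    have := congrArg Fin.val h
    cases b <;> simp [startIndex] at this <;> omega

/-- The construction from scale `A ^ M` downwards. -/
theorem exists_tower (hp : Par r L e μ η A c lam) (hη : 0 ≤ η) {v : Fin 18 → V}
    (hv : Orthonormal ℝ v)
    (hnext : ∀ {R : ℝ} {g : Fin 8 → H → ℝ} {P Q : Fin 8 → H → V} {ψ : H → V}, 0 < R →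
      Good r L μ ζ R g → Inv r L e η A c R g P Q ψ →
      ∃ N : Fin 8 → H → V, Pre r L e η A c (R / A) N Q ψ)
    {g : ℤ → Fin 8 → H → ℝ} (hg : ∀ n : ℤ, Good r L μ ζ (A ^ n) (g n)) (M : ℤ) :
    ∃ (N Q : ℤ → Fin 8 → H → V) (ψ : ℤ → H → V), ∀ n ≤ M,
      Pre r L e η A c (A ^ n) (N n) (Q n) (ψ (n + 1)) ∧
        ψ n = fun p => layer (g n) (N n) p + lam • ψ (n + 1) p := by
  have hA : 0 < A := by linarith [hp.A_pos]
  obtain ⟨f, hf⟩ := exists_seq (α := (Fin 8 → H → V) × (Fin 8 → H → V) × (H → V))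
    (P := fun k a => Pre r L e η A c (A ^ (M - (k : ℤ))) a.1 a.2.1 a.2.2)
    (S := fun k a b => b.2.2 = fun p => layer (g (M - (k : ℤ))) a.1 p + lam • a.2.2 p)
    ⟨(_, _, _), pre_start hp hη (zpow_pos hA _) hv⟩ (fun k a ha => by
      have hR : 0 < A ^ (M - (k : ℤ)) := zpow_pos hA _
      obtain ⟨N, hN⟩ := hnext hR (hg _) (inv_add_layer hp hR (hg _) ha)
      refine ⟨(N, a.1, _), ?_, rfl⟩
      rw [div_eq_mul_inv, ← zpow_sub_one₀ hA.ne'] at hN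
      convert hN using 2
      push_cast
      ring)
  refine ⟨fun n => (f (M - n).toNat).1, fun n => (f (M - n).toNat).2.1,
    fun n => (f (M + 1 - n).toNat).2.2, fun n hn => ?_⟩
  have h1 : M + 1 - (n + 1) = M - n := by ring
  have h2 : (M + 1 - n).toNat = (M - n).toNat + 1 := by omega
  have h3 : M - ((M - n).toNat : ℤ) = n := by omega
  have := hf (M - n).toNat
  rw [h3] at this
  beta_reduce
  rw [h1, h2]
  exact this

theorem sum_sq_le_norm_layer_sq {f : Fin 8 → H → ℝ} {N : Fin 8 → H → V} {p : H} (he : 0 ≤ e)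
    (hN : ∀ i j, |gd (fun k => N k p) i j| ≤ e) :
    (1 - 8 * e) * ∑ j, f j p ^ 2 ≤ ‖layer f N p‖ ^ 2 := by
  rw [← real_inner_self_eq_norm_sq, inner_layer_layer]
  have h1 : |∑ i, ∑ j, f i p * (f j p * gd (fun k => N k p) i j)| ≤
      ∑ i, ∑ j, |f i p| * (|f j p| * e) := by
    refine (Finset.abs_sum_le_sum_abs _ _).trans (Finset.sum_le_sum fun i _ =>
      (Finset.abs_sum_le_sum_abs _ _).trans (Finset.sum_le_sum fun j _ => ?_))
    rw [abs_mul, abs_mul]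
    gcongr
    exact hN i j
  have h2 : ∑ i, ∑ j, |f i p| * (|f j p| * e) = e * (∑ i, |f i p|) ^ 2 := by
    rw [sq, Finset.sum_mul_sum, Finset.mul_sum]
    refine Finset.sum_congr rfl fun i _ => ?_
    rw [Finset.mul_sum]
    exact Finset.sum_congr rfl fun j _ => by ring
  have h3 : (∑ i, |f i p|) ^ 2 ≤ 8 * ∑ i, f i p ^ 2 := by
    simpa using sq_sum_le_card_mul_sum_sq (s := Finset.univ) (f := fun i : Fin 8 => |f i p|)
  have h4 := (abs_le.1 (h1.trans h2.le)).1
  simp only [← sq]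
  nlinarith [mul_le_mul_of_nonneg_left h3 he]

variable {g : Fin 8 → H → ℝ} {N P Q : Fin 8 → H → V} {ψ : H → V}

/-- Estimates for the `Z`-derivative of the partial map. -/
theorem Inv.zd_bounds (hp : Par r L e μ η A c lam) (hs : Small L e μ η A c) (hR : 0 < R)
    (hζ : 0 < ζ) (hδ : 800 * c * L ^ 2 + 240 * L ^ 2 / A ≤ ζ / 20)
    (hg : Good r L μ ζ R g) (h : Inv r L e η A c R g P Q ψ) (p : H) :
    ‖R • ZD ψ p‖ ≤ 64 * L ∧ ζ / 2 ≤ ‖R • ZD ψ p‖ ∧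
      ∀ b, |⟪c • WD b ψ p, R • ZD ψ p⟫| ≤ ζ / 20 := by
  have hA := hp.A_pos
  have hr := hp.r_pos
  have hL := hp.L_ge
  have hc := hp.c_pos
  have hρ : 0 ≤ r * R / 4 := by positivity
  have hle := hp.radius_le hR
  set S : H → V := layer (fun j p => R * ZD (g j) p) Q with hS
  have hZψ := zd_eq h.smooth p
  have hZg : ∀ j, R * ZD (g j) p =
      R * WD false (WD true (g j)) p - R * WD true (WD false (g j)) p := fun j => by
    rw [zd_eq (hg.bd j).1, mul_sub]
  have hup : ‖R • ZD ψ p‖ ≤ 64 * L := by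
    rw [hZψ, norm_smul, Real.norm_eq_abs, abs_of_pos hR]
    have h1 := (norm_sub_le (WD false (WD true ψ) p) (WD true (WD false ψ) p)).trans
      (add_le_add ((h.hess _ _).norm_le p) ((h.hess _ _).norm_le p))
    refine (mul_le_mul_of_nonneg_left h1 hR.le).trans (le_of_eq ?_)
    field_simp
    ring
  have herr : ‖R • ZD ψ p - S p‖ ≤ 120 * L ^ 2 / A := by
    have h1 := (norm_sub_le _ _).trans (add_le_add ((h.hess_approx false true).norm_le p)
      ((h.hess_approx true false).norm_le p))
    have h2 : R • ZD ψ p - S p = (R • WD false (WD true ψ) p -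
        ∑ j, (R * WD false (WD true (g j)) p) • Q j p) - (R • WD true (WD false ψ) p -
        ∑ j, (R * WD true (WD false (g j)) p) • Q j p) := by
      rw [hZψ, hS, layer]
      simp only [hZg, sub_smul, Finset.sum_sub_distrib, smul_sub]
      abel
    rw [h2]
    refine h1.trans (le_of_eq ?_)
    ring
  have herr' : 120 * L ^ 2 / A ≤ ζ / 40 := by
    have : 0 ≤ 800 * c * L ^ 2 := by positivity
    have h2 : 240 * L ^ 2 / A = 2 * (120 * L ^ 2 / A) := by ring
    linarith
  have he : e ≤ 1 / 100 := by nlinarith [hs.e_le, hp.e_nonneg]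
  have hS2 : 9 / 16 * ζ ^ 2 ≤ ‖S p‖ ^ 2 := by
    refine le_trans ?_ (sum_sq_le_norm_layer_sq (e := e) hp.e_nonneg fun i j => (h.QQ i j).abs_le p)
    have := hg.zlow p
    calc 9 / 16 * ζ ^ 2 ≤ (1 - 8 * e) * ζ ^ 2 := by gcongr; linarith
      _ ≤ _ := by gcongr; linarith
  have hS1 : 3 / 4 * ζ ≤ ‖S p‖ := by
    refine le_of_sq_le_sq ?_ (norm_nonneg _)
    linarith
  refine ⟨hup, ?_, fun b => ?_⟩
  · have := norm_sub_norm_le (S p) (R • ZD ψ p)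
    rw [norm_sub_rev] at this
    linarith
  · have hz : ∀ j, |R * ZD (g j) p| ≤ 2 * L := fun j => by
      rw [hZg, ← mul_sub, abs_mul, abs_of_pos hR]
      have h1 := (abs_sub (WD false (WD true (g j)) p) (WD true (WD false (g j)) p)).trans
        (add_le_add ((hg.wdwd j _ _).abs_le p) ((hg.wdwd j _ _).abs_le p))
      refine (mul_le_mul_of_nonneg_left h1 hR.le).trans (le_of_eq ?_)
      field_simp
      ring
    have h1 : |⟪c • WD b ψ p, S p⟫| ≤ 800 * c * L ^ 2 := by
      rw [inner_smul_left, conj_trivial, hS, layer, inner_sum, abs_mul, abs_of_pos hc]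
      have : |∑ j, ⟪WD b ψ p, (R * ZD (g j) p) • Q j p⟫| ≤ ∑ _j : Fin 8, 2 * L * (50 * L) := by
        refine (Finset.abs_sum_le_sum_abs _ _).trans (Finset.sum_le_sum fun j _ => ?_)
        rw [inner_smul_right, abs_mul, real_inner_comm]
        have h2 := (h.Qgrad j b).abs_le p
        have h3 := hz j
        gcongr
      refine (mul_le_mul_of_nonneg_left this hc.le).trans (le_of_eq ?_)
      simp
      ring
    have h2 : |⟪c • WD b ψ p, R • ZD ψ p - S p⟫| ≤ 2 * (120 * L ^ 2 / A) := by
      refine (abs_real_inner_le_norm _ _).trans ?_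
      have := (h.bd_grad hp hs hR b).norm_le p
      gcongr
    have h3 : R • ZD ψ p = S p + (R • ZD ψ p - S p) := by abel
    rw [h3, inner_add_right]
    refine (abs_add_le _ _).trans ((add_le_add h1 h2).trans ?_)
    have h4 : 240 * L ^ 2 / A = 2 * (120 * L ^ 2 / A) := by ring
    linarith

end Tower

section Family

open Filter Topology

variable {V : Type*} [NormedAddCommGroup V] [InnerProductSpace ℝ V]
  {r L e μ η A c lam ζ R : ℝ}

/-- The derivatives at a point of a map with almost orthonormal horizontal derivatives and
transversal `Z`-derivative, rescaled by `c` and `R`. -/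
structure Transversal (L ζ c R : ℝ) (s : Bool → V) (z : V) : Prop where
  gram : ∀ b b', |c ^ 2 * ⟪s b, s b'⟫ - kd b b'| ≤ 1 / 10
  le : ‖R • z‖ ≤ 64 * L
  ge : ζ / 2 ≤ ‖R • z‖
  cross : ∀ b, |⟪c • s b, R • z⟫| ≤ ζ / 20

/-- A family of maps `φ n` oscillating at scale `A ^ n`, with `s b n` and `z n` standing for the
derivatives of `∑ m, lam ^ m • φ (n + m)`. -/
structure Family (r L A c lam ζ : ℝ) (φ : ℤ → H → V) (s : Bool → ℤ → H → V) (z : ℤ → H → V) :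
    Prop where
  bd : ∀ n : ℤ, Bd (r * A ^ n) (16 * L * A ^ n) (φ n)
  s_rec : ∀ b n p, s b n p = WD b (φ n) p + lam • s b (n + 1) p
  z_rec : ∀ n p, z n p = ZD (φ n) p + lam • z (n + 1) p
  norm_wd : ∀ b n p, |‖WD b (φ n) p‖ ^ 2 - 1| ≤ 1 / 10
  transversal : ∀ (n : ℤ) p, Transversal L ζ c (A ^ n) (fun b => s b n p) (z n p)

theorem Inv.transversal {g : Fin 8 → H → ℝ} {P Q : Fin 8 → H → V} {ψ : H → V}
    (hp : Par r L e μ η A c lam) (hs : Small L e μ η A c) (hR : 0 < R)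
    (hζ : 0 < ζ) (hδ : 800 * c * L ^ 2 + 240 * L ^ 2 / A ≤ ζ / 20)
    (hg : Good r L μ ζ R g) (h : Inv r L e η A c R g P Q ψ) (p : H) :
    Transversal L ζ c R (fun b => WD b ψ p) (ZD ψ p) := by
  obtain ⟨h1, h2, h3⟩ := h.zd_bounds hp hs hR hζ hδ hg p
  refine ⟨fun b b' => ((h.grad b b').abs_le p).trans ?_, h1, h2, h3⟩
  nlinarith [hs.η_le, hs.e_le, hp.e_nonneg, sq_nonneg L]

theorem Transversal.limit {F : Ultrafilter ℕ} {s : ℕ → Bool → V} {z : ℕ → V} {s' : Bool → V} {z' : V}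
    (h : ∀ᶠ k in (F : Filter ℕ), Transversal L ζ c R (s k) (z k))
    (hs : ∀ b, Tendsto (fun k => s k b) F (𝓝 (s' b))) (hz : Tendsto z F (𝓝 z')) :
    Transversal L ζ c R s' z' where
  gram b b' := le_of_tendsto ((((hs b).inner (hs b')).const_mul _).sub_const _).abs
    (h.mono fun _ hk => hk.gram b b')
  le := le_of_tendsto (hz.const_smul R).norm (h.mono fun _ hk => hk.le)
  ge := ge_of_tendsto (hz.const_smul R).norm (h.mono fun _ hk => hk.ge)
  cross b := le_of_tendsto (((hs b).const_smul c).inner (hz.const_smul R)).abs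
    (h.mono fun _ hk => hk.cross b)

theorem Transversal.norm_le {s : Bool → V} {z : V} (h : Transversal L ζ c R s z) (b : Bool) :
    ‖c • s b‖ ≤ 2 := by
  have := (abs_le.1 (h.gram b b)).2
  rw [real_inner_self_eq_norm_sq, kd, if_pos rfl] at this
  rw [norm_smul, Real.norm_eq_abs]
  refine le_of_sq_le_sq ?_ zero_le_two
  rw [mul_pow, sq_abs]
  linarith

theorem Transversal.norm_le_div {s : Bool → V} {z : V} (h : Transversal L ζ c R s z) (hc : 0 < c)
    (b : Bool) : ‖s b‖ ≤ 2 / c := by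
  have := h.norm_le b
  rw [norm_smul, Real.norm_eq_abs, abs_of_pos hc] at this
  rw [le_div_iff₀ hc]
  linarith

theorem Transversal.norm_z_le {s : Bool → V} {z : V} (h : Transversal L ζ c R s z) (hR : 0 < R) :
    ‖z‖ ≤ 64 * L / R := by
  have := h.le
  rw [norm_smul, Real.norm_eq_abs, abs_of_pos hR] at this
  rw [le_div_iff₀ hR]
  linarith

/-- The construction over all scales, in the almost undamped case. -/
theorem exists_family [FiniteDimensional ℝ V] (hp : Par r L e μ η A c lam)
    (hs : Small L e μ η A c) (hη : 0 ≤ η) (hζ : 0 < ζ)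
    (hδ : 800 * c * L ^ 2 + 240 * L ^ 2 / A ≤ ζ / 20) {v : Fin 18 → V} (hv : Orthonormal ℝ v)
    (hnext : ∀ {R : ℝ} {g : Fin 8 → H → ℝ} {P Q : Fin 8 → H → V} {ψ : H → V}, 0 < R →
      Good r L μ ζ R g → Inv r L e η A c R g P Q ψ →
      ∃ N : Fin 8 → H → V, Pre r L e η A c (R / A) N Q ψ)
    {g : ℤ → Fin 8 → H → ℝ} (hg : ∀ n : ℤ, Good r L μ ζ (A ^ n) (g n)) :
    ∃ (φ : ℤ → H → V) (s : Bool → ℤ → H → V) (z : ℤ → H → V), Family r L A c lam ζ φ s z ∧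
      ∀ b n p, ⟪WD b (φ n) p, s b (n + 1) p⟫ = 0 := by
  have hA : 0 < A := by linarith [hp.A_pos]
  have hr := hp.r_pos
  have hR : ∀ n : ℤ, 0 < A ^ n := fun n => zpow_pos hA n
  choose N Q ψ hψ using fun M : ℕ => exists_tower hp hη hv hnext hg (M : ℤ)
  set F : Ultrafilter ℕ := Filter.hyperfilter ℕ
  have hev : ∀ n : ℤ, ∀ᶠ M : ℕ in (F : Filter ℕ), n ≤ M := fun n => by
    have : ∀ᶠ M : ℕ in atTop, n ≤ M := by
      filter_upwards [eventually_ge_atTop n.toNat] with M hM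
      omega
    refine this.filter_mono ?_
    rw [← Nat.cofinite_eq_atTop]
    exact Filter.hyperfilter_le_cofinite
  have hinv : ∀ (M : ℕ) (n : ℤ), n ≤ M →
      Inv r L e η A c (A ^ n) (g n) (Q M n) (N M n) (ψ M n) := fun M n hn => by
    have := inv_add_layer hp (hR n) (hg n) (hψ M n hn).1
    rwa [← (hψ M n hn).2] at this
  have htr : ∀ (n : ℤ) (p : H), ∀ᶠ M : ℕ in (F : Filter ℕ), Transversal L ζ c (A ^ n)
      (fun b => WD b (ψ M n) p) (ZD (ψ M n) p) := fun n p => (hev n).mono fun M hM =>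
    (hinv M n hM).transversal hp hs (hR n) hζ hδ (hg n) p
  choose φ hφ hφlim using fun n : ℤ => exists_limit F (mul_pos hr (hR n))
    ((hev n).mono fun M hM => (hψ M n hM).1.bd_layer hp (hR n) (hg n))
  choose s hslim using fun (b : Bool) (n : ℤ) (p : H) => exists_tendsto_of_bounded F
    ((htr n p).mono fun M hM => hM.norm_le_div hp.c_pos b)
  choose z hzlim using fun (n : ℤ) (p : H) => exists_tendsto_of_bounded F
    ((htr n p).mono fun M hM => hM.norm_z_le (hR n))
  have hφ1 : ∀ b n p, Tendsto (fun M => WD b (layer (g n) (N M n)) p) F (𝓝 (WD b (φ n) p)) :=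
    fun b n p => hφlim n [b] p
  have hls : ∀ (M : ℕ) (n : ℤ), n ≤ M → Smooth (layer (g n) (N M n)) := fun M n hM =>
    (hψ M n hM).1.smooth_layer (hg n)
  have hφz : ∀ n p, Tendsto (fun M => ZD (layer (g n) (N M n)) p) F (𝓝 (ZD (φ n) p)) := by
    intro n p
    rw [zd_eq (hφ n).1]
    refine ((hφlim n [false, true] p).sub (hφlim n [true, false] p)).congr' ?_
    exact (hev n).mono fun M hM => (zd_eq (hls M n hM) p).symm
  have hwd : ∀ b (M : ℕ) (n : ℤ) p, n ≤ M → WD b (ψ M n) p =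
      WD b (layer (g n) (N M n)) p + lam • WD b (ψ M (n + 1)) p := fun b M n p hM => by
    conv_lhs => rw [(hψ M n hM).2]
    rw [wd_add b (hls M n hM) ((hψ M n hM).1.smooth.const_smul lam),
      wd_const_smul b lam (hψ M n hM).1.smooth]
  have hzd : ∀ (M : ℕ) (n : ℤ) p, n ≤ M → ZD (ψ M n) p =
      ZD (layer (g n) (N M n)) p + lam • ZD (ψ M (n + 1)) p := fun M n p hM => by
    conv_lhs => rw [(hψ M n hM).2]
    simp only [ZD]
    rw [fderiv_fun_add ((hls M n hM).diff p) (((hψ M n hM).1.smooth.diff p).fun_const_smul lam),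
      fderiv_fun_const_smul ((hψ M n hM).1.smooth.diff p)]
    rfl
  refine ⟨φ, s, z, ⟨hφ, fun b n p => ?_, fun n p => ?_, fun b n p => ?_, fun n p => ?_⟩,
    fun b n p => ?_⟩
  · refine tendsto_nhds_unique (hslim b n p) (((hφ1 b n p).add
      ((hslim b (n + 1) p).const_smul lam)).congr' ?_)
    exact (hev n).mono fun M hM => (hwd b M n p hM).symm
  · refine tendsto_nhds_unique (hzlim n p) (((hφz n p).add
      ((hzlim (n + 1) p).const_smul lam)).congr' ?_)
    exact (hev n).mono fun M hM => (hzd M n p hM).symm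
  · refine le_of_tendsto (((hφ1 b n p).norm.pow 2).sub_const 1).abs ((hev n).mono fun M hM => ?_)
    have h1 := ((hψ M n hM).1.gram_layer hp (hR n) (hg n) b b).abs_le p
    rw [real_inner_self_eq_norm_sq, kd, if_pos rfl] at h1
    refine h1.trans ?_
    have h2 := hp.η_ge
    have h3 : 0 ≤ L ^ 3 / A := by have := hp.L_ge; positivity
    rw [mul_div_assoc] at h2 ⊢
    nlinarith [hs.η_le, hs.e_le, hp.e_nonneg, sq_nonneg L]
  · exact Transversal.limit (htr n p) (fun b => hslim b n p) (hzlim n p)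
  · refine tendsto_nhds_unique ((hφ1 b n p).inner (hslim b (n + 1) p))
      (tendsto_const_nhds.congr' ?_)
    exact (hev n).mono fun M hM => ((hψ M n hM).1.inner_wd_layer_self (hg n) b p).symm

end Family

section Conclusions

open Filter Topology

variable {V : Type*} [NormedAddCommGroup V] [InnerProductSpace ℝ V]
  {r L e μ η A c lam ζ R : ℝ}

/-- Summation of a recursion `x m = a m + lam • x (m + 1)`. -/
theorem hasSum_of_rec [CompleteSpace V] {a x : ℕ → V} {B K : ℝ} (h0 : 0 ≤ lam) (h1 : lam < 1)
    (hx : ∀ m, x m = a m + lam • x (m + 1)) (hB : ∀ m, ‖a m‖ ≤ B) (hK : ∀ m, ‖x m‖ ≤ K) :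
    HasSum (fun m : ℕ => lam ^ m • a m) (x 0) := by
  have hs : Summable (fun m : ℕ => lam ^ m • a m) := by
    refine Summable.of_norm_bounded ((summable_geometric_of_lt_one h0 h1).mul_right B) fun m => ?_
    rw [norm_smul, Real.norm_eq_abs, abs_of_nonneg (pow_nonneg h0 m)]
    exact mul_le_mul_of_nonneg_left (hB m) (pow_nonneg h0 m)
  have hsum : ∀ N : ℕ, ∑ m ∈ Finset.range N, lam ^ m • a m = x 0 - lam ^ N • x N := fun N => by
    induction N with
    | zero => simp
    | succ N ih =>
      rw [Finset.sum_range_succ, ih]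
      conv_lhs => rw [hx N]
      module
  have hlim : Tendsto (fun N : ℕ => x 0 - lam ^ N • x N) atTop (𝓝 (x 0)) := by
    have : Tendsto (fun N : ℕ => lam ^ N • x N) atTop (𝓝 0) := by
      refine squeeze_zero_norm (a := fun N => lam ^ N * K) (fun N => ?_) ?_
      · rw [norm_smul, Real.norm_eq_abs, abs_of_nonneg (pow_nonneg h0 N)]
        exact mul_le_mul_of_nonneg_left (hK N) (pow_nonneg h0 N)
      · simpa using (tendsto_pow_atTop_nhds_zero_of_lt_one h0 h1).mul_const K
    simpa using tendsto_const_nhds.sub this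
  have := hs.hasSum.tendsto_sum_nat
  simp only [hsum] at this
  rw [← tendsto_nhds_unique this hlim]
  exact hs.hasSum

theorem Transversal.wedgeNorm_ge {D : ℕ} {s : Bool → EuclideanSpace ℝ (Fin D)}
    {z : EuclideanSpace ℝ (Fin D)} (h : Transversal L ζ c R s z) (hc : 0 < c) (hR : 0 < R)
    (hζ : 0 < ζ) : ζ / 4 / R / c ^ 2 ≤ wedgeNorm ![s true, s false, z] := by
  have hdet : Matrix.det (Matrix.of fun i j : Fin 3 =>
      ⟪(![s true, s false, z] : Fin 3 → EuclideanSpace ℝ (Fin D)) i,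
        (![s true, s false, z] : Fin 3 → EuclideanSpace ℝ (Fin D)) j⟫) =
      (⟪s true, s true⟫ * ⟪s false, s false⟫ - ⟪s true, s false⟫ ^ 2) * ‖z‖ ^ 2
      - ⟪s true, s true⟫ * ⟪s false, z⟫ ^ 2 - ⟪s false, s false⟫ * ⟪s true, z⟫ ^ 2
      + 2 * ⟪s true, s false⟫ * ⟪s true, z⟫ * ⟪s false, z⟫ := by
    rw [Matrix.det_fin_three]
    simp only [Matrix.of_apply, Matrix.cons_val]
    rw [real_inner_comm (s true) (s false), real_inner_comm (s true) z,
      real_inner_comm (s false) z, real_inner_self_eq_norm_sq z]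
    ring
  rw [wedgeNorm, hdet]
  refine Real.le_sqrt_of_sq_le ?_
  have hg := fun b b' => abs_le.1 (h.gram b b')
  have h11 := hg true true
  have h22 := hg false false
  have h12 := hg true false
  have hx1 := abs_le.1 (h.cross true)
  have hx2 := abs_le.1 (h.cross false)
  have hz := h.ge
  rw [norm_smul, Real.norm_eq_abs, abs_of_pos hR] at hz
  simp only [inner_smul_left, inner_smul_right, conj_trivial] at hx1 hx2
  simp only [kd] at h11 h22 h12
  simp only [if_true, Bool.true_eq_false, if_false] at h11 h22 h12
  rw [div_div, div_pow, div_le_iff₀ (by positivity)]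
  set a := c ^ 2 * ⟪s true, s true⟫ with ha
  set b := c ^ 2 * ⟪s false, s false⟫ with hb
  set d := c ^ 2 * ⟪s true, s false⟫ with hd
  set x := R * (c * ⟪s true, z⟫) with hx
  set y := R * (c * ⟪s false, z⟫) with hy
  have key : (a * b - d ^ 2) * (R * ‖z‖) ^ 2 - a * y ^ 2 - b * x ^ 2 + 2 * d * x * y =
      ((⟪s true, s true⟫ * ⟪s false, s false⟫ - ⟪s true, s false⟫ ^ 2) * ‖z‖ ^ 2
      - ⟪s true, s true⟫ * ⟪s false, z⟫ ^ 2 - ⟪s false, s false⟫ * ⟪s true, z⟫ ^ 2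
      + 2 * ⟪s true, s false⟫ * ⟪s true, z⟫ * ⟪s false, z⟫) * (R * c ^ 2) ^ 2 := by
    simp only [ha, hb, hd, hx, hy]
    ring
  rw [← key]
  have hxsq : x ^ 2 ≤ (ζ / 20) ^ 2 := sq_le_sq' (by linarith) (by linarith)
  have hysq : y ^ 2 ≤ (ζ / 20) ^ 2 := sq_le_sq' (by linarith) (by linarith)
  have hzsq : (ζ / 2) ^ 2 ≤ (R * ‖z‖) ^ 2 := by gcongr
  have hab : 1 / 2 ≤ a * b - d ^ 2 := by nlinarith
  have h1 : 1 / 2 * (ζ / 2) ^ 2 ≤ (a * b - d ^ 2) * (R * ‖z‖) ^ 2 := by gcongr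
  have h2 : a * y ^ 2 ≤ 2 * (ζ / 20) ^ 2 := by
    refine mul_le_mul (by linarith) hysq (sq_nonneg _) (by norm_num)
  have h3 : b * x ^ 2 ≤ 2 * (ζ / 20) ^ 2 := by
    refine mul_le_mul (by linarith) hxsq (sq_nonneg _) (by norm_num)
  have h4 : |2 * d * x * y| ≤ 1 * (ζ / 20) ^ 2 := by
    have : |2 * d * x * y| = |2 * d| * (|x| * |y|) := by rw [mul_assoc, abs_mul, abs_mul x]
    rw [this, sq]
    have h5 : |2 * d| ≤ 1 := abs_le.2 ⟨by linarith, by linarith⟩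
    have h6 : |x| ≤ ζ / 20 := abs_le.2 hx1
    have h7 : |y| ≤ ζ / 20 := abs_le.2 hx2
    gcongr
  have h5 := (abs_le.1 h4).1
  nlinarith [sq_nonneg ζ]

theorem Bd.gradNorm_le {E : Type*} [NormedAddCommGroup E] [NormedSpace ℝ E] {K : ℝ} (hr : 0 < r)
    {f : H → E} (hf : Bd r K f) (k : ℕ) (p : H) :
    gradNorm k f p ≤ 2 ^ k * (k.factorial * K / r ^ k) := by
  have hK := hf.nonneg
  unfold gradNorm
  rw [Real.sqrt_le_left (by positivity)]
  have h1 : ∀ w : Fin k → Bool, ‖(List.ofFn w).foldr WD f p‖ ^ 2 ≤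
      (k.factorial * K / r ^ k) ^ 2 := fun w => by
    have := hf.norm_foldr_le hr (List.ofFn w) p
    rw [List.length_ofFn] at this
    gcongr
  refine (Finset.sum_le_sum fun w _ => h1 w).trans ?_
  rw [Finset.sum_const, nsmul_eq_mul, mul_pow]
  refine mul_le_mul_of_nonneg_right ?_ (sq_nonneg _)
  simp only [Finset.card_univ, Fintype.card_fun, Fintype.card_bool, Fintype.card_fin]
  push_cast
  exact le_self_pow₀ (one_le_pow₀ one_le_two) two_ne_zero

theorem Bd.ckR_le {E : Type*} [NormedAddCommGroup E] [NormedSpace ℝ E] {K : ℝ} (hr : 0 < r)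
    (hR : 0 < R) {f : H → E} (hf : Bd (r * R) K f) (k : ℕ) :
    CkR k R f ≤ ENNReal.ofReal ((∑ j ∈ Finset.range (k + 1), 2 ^ j * j.factorial / r ^ j) * K) := by
  have hK := hf.nonneg
  unfold CkR CkRS
  rw [Finset.sum_mul, ENNReal.ofReal_sum_of_nonneg fun j _ => by positivity]
  refine Finset.sum_le_sum fun j _ => ?_
  have h1 : (⨆ p : H, ENNReal.ofReal (gradNorm (0 + j) f p)) ≤
      ENNReal.ofReal (2 ^ j * (j.factorial * K / (r * R) ^ j)) := by
    refine iSup_le fun p => ENNReal.ofReal_le_ofReal ?_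
    rw [zero_add]
    exact hf.gradNorm_le (by positivity) j p
  refine (mul_le_mul_right h1 _).trans ?_
  rw [← ENNReal.ofReal_mul (by positivity)]
  refine ENNReal.ofReal_le_ofReal (le_of_eq ?_)
  rw [mul_pow]
  field_simp

end Conclusions

section Assembly

open Filter Topology

variable {r L A c lam ζ : ℝ}

theorem rpow_neg_mul_natCast (hA : 0 < A) (ε : ℝ) (m : ℕ) : A ^ (-(ε * (m : ℝ))) = (A ^ (-ε)) ^ m := by
  rw [← neg_mul, Real.rpow_mul hA.le, Real.rpow_natCast]

section

variable {V : Type*} [NormedAddCommGroup V] [InnerProductSpace ℝ V]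
  {φ : ℤ → H → V} {s : Bool → ℤ → H → V} {z : ℤ → H → V}

theorem Family.norm_zd_le (h : Family r L A c lam ζ φ s z) (hr : 0 < r) (hA : 0 < A) (n : ℤ) (p : H) :
    ‖ZD (φ n) p‖ ≤ 64 * L / r ^ 2 / A ^ n := by
  have hR : 0 < A ^ n := zpow_pos hA n
  rw [zd_eq (h.bd n).1]
  have h1 := (h.bd n).norm_foldr_le (mul_pos hr hR) [false, true] p
  have h2 := (h.bd n).norm_foldr_le (mul_pos hr hR) [true, false] p
  refine ((norm_sub_le _ _).trans (add_le_add h1 h2)).trans (le_of_eq ?_)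
  simp only [List.length_cons, List.length_nil]
  norm_num
  field_simp
  ring

theorem Family.norm_wd_bounds (h : Family r L A c lam ζ φ s z) (b : Bool) (n : ℤ) (p : H) :
    1 / 2 ≤ ‖WD b (φ n) p‖ ∧ ‖WD b (φ n) p‖ ≤ 2 := by
  have := abs_le.1 (h.norm_wd b n p)
  constructor
  · exact le_of_sq_le_sq (by linarith) (norm_nonneg _)
  · exact le_of_sq_le_sq (by linarith) zero_le_two

theorem Family.hasSum_wd [CompleteSpace V] (h : Family r L A c lam ζ φ s z) (hc : 0 < c)
    (h0 : 0 ≤ lam) (h1 : lam < 1) (b : Bool) (n : ℤ) (p : H) :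
    HasSum (fun m : ℕ => lam ^ m • WD b (φ (n + (m : ℤ))) p) (s b n p) := by
  have := hasSum_of_rec (a := fun m : ℕ => WD b (φ (n + (m : ℤ))) p)
    (x := fun m : ℕ => s b (n + (m : ℤ)) p) (B := 2) (K := 2 / c) h0 h1
    (fun m => by
      rw [h.s_rec b (n + (m : ℤ)) p, add_assoc, Nat.cast_succ])
    (fun m => (h.norm_wd_bounds b _ p).2) (fun m => (h.transversal _ p).norm_le_div hc b)
  simpa using this

theorem Family.hasSum_zd [CompleteSpace V] (h : Family r L A c lam ζ φ s z) (hr : 0 < r)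
    (hA : 1 ≤ A) (hL : 0 ≤ L) (h0 : 0 ≤ lam) (h1 : lam < 1) (n : ℤ) (p : H) :
    HasSum (fun m : ℕ => lam ^ m • ZD (φ (n + (m : ℤ))) p) (z n p) := by
  have hA0 : 0 < A := by linarith
  have hR : ∀ k : ℤ, 0 < A ^ k := fun k => zpow_pos hA0 k
  have hle : ∀ m : ℕ, A ^ n ≤ A ^ (n + (m : ℤ)) := fun m => zpow_le_zpow_right₀ hA (by omega)
  have := hasSum_of_rec (a := fun m : ℕ => ZD (φ (n + (m : ℤ))) p)
    (x := fun m : ℕ => z (n + (m : ℤ)) p) (B := 64 * L / r ^ 2 / A ^ n) (K := 64 * L / A ^ n) h0 h1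
    (fun m => by
      rw [h.z_rec (n + (m : ℤ)) p, add_assoc, Nat.cast_succ])
    (fun m => (h.norm_zd_le hr hA0 _ p).trans
      (div_le_div_of_nonneg_left (by positivity) (hR n) (hle m)))
    (fun m => ((h.transversal _ p).norm_z_le (hR _)).trans
      (div_le_div_of_nonneg_left (by positivity) (hR n) (hle m)))
  simpa using this

theorem Family.hasSum_inner [CompleteSpace V] (h : Family r L A c lam ζ φ s z) (hc : 0 < c)
    (h0 : 0 ≤ lam) (h1 : lam < 1) {b : Bool} {n : ℤ} {p : H}
    (horth : ⟪WD b (φ n) p, s b (n + 1) p⟫ = 0) :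
    HasSum (fun m : ℕ => lam ^ (m + 1) * ⟪WD b (φ n) p, WD b (φ (n + (m : ℤ) + 1)) p⟫) 0 := by
  have h2 := ((h.hasSum_wd hc h0 h1 b (n + 1) p).mapL (innerSL ℝ (WD b (φ n) p))).mul_left lam
  simp only [innerSL_apply_apply, horth, mul_zero, inner_smul_right] at h2
  refine h2.congr_fun fun m => ?_
  rw [show n + 1 + (m : ℤ) = n + (m : ℤ) + 1 by ring]
  ring

end

/-- The constant of the main theorem. -/
def finalConst (r L ζ : ℝ) : ℝ :=
  2 + (∑ j ∈ Finset.range 7, 2 ^ j * j.factorial / r ^ j) * (16 * L) + 64 * L / r ^ 2 + 4 / ζ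

theorem le_finalConst (hr : 0 < r) (hL : 0 < L) (hζ : 0 < ζ) : 2 ≤ finalConst r L ζ ∧
    (∑ j ∈ Finset.range 7, 2 ^ j * j.factorial / r ^ j) * (16 * L) ≤ finalConst r L ζ ∧
    64 * L / r ^ 2 ≤ finalConst r L ζ ∧ 4 / ζ ≤ finalConst r L ζ := by
  have h1 : 0 ≤ (∑ j ∈ Finset.range 7, 2 ^ j * (j.factorial : ℝ) / r ^ j) * (16 * L) := by positivity
  have h2 : 0 ≤ 64 * L / r ^ 2 := by positivity
  have h3 : 0 ≤ 4 / ζ := by positivity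
  unfold finalConst
  refine ⟨?_, ?_, ?_, ?_⟩ <;> linarith

theorem Family.conclusion {φ : ℤ → H → EuclideanSpace ℝ (Fin 29)}
    {s : Bool → ℤ → H → EuclideanSpace ℝ (Fin 29)} {z : ℤ → H → EuclideanSpace ℝ (Fin 29)} {ε : ℝ}
    (h : Family r L A c (A ^ (-ε)) ζ φ s z) (hr : 0 < r) (hL : 0 < L) (hζ : 0 < ζ) (hA : 1 < A)
    (hc : 0 < c) (hε : 0 < ε) (hcl : c ^ 2 + (A ^ (-ε)) ^ 2 = 1)
    (horth : ε ≤ 1 / A → ∀ b n p, ⟪WD b (φ n) p, s b (n + 1) p⟫ = 0) :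
    (∀ n : ℤ, ContDiff ℝ (⊤ : ℕ∞) (φ n)) ∧
    (∀ n : ℤ, CkR 6 (A ^ (n : ℝ)) (φ n) ≤ ENNReal.ofReal (finalConst r L ζ * A ^ (n : ℝ))) ∧
    (∀ n : ℤ, ∀ p : H, ‖XD (φ n) p‖ ≤ finalConst r L ζ ∧ ‖YD (φ n) p‖ ≤ finalConst r L ζ ∧
      ‖ZD (φ n) p‖ ≤ finalConst r L ζ * A ^ (-(n : ℝ))) ∧
    (ε ≤ 1 / A → ∀ n : ℤ, ∀ p : H,
      (Summable fun m : ℕ =>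
        A ^ (-(ε * ((m : ℝ) + 1))) * ⟪XD (φ n) p, XD (φ (n + (m : ℤ) + 1)) p⟫) ∧
      (Summable fun m : ℕ =>
        A ^ (-(ε * ((m : ℝ) + 1))) * ⟪YD (φ n) p, YD (φ (n + (m : ℤ) + 1)) p⟫) ∧
      (∑' m : ℕ,
        A ^ (-(ε * ((m : ℝ) + 1))) * ⟪XD (φ n) p, XD (φ (n + (m : ℤ) + 1)) p⟫) = 0 ∧
      (∑' m : ℕ,
        A ^ (-(ε * ((m : ℝ) + 1))) * ⟪YD (φ n) p, YD (φ (n + (m : ℤ) + 1)) p⟫) = 0) ∧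
    (∀ n : ℤ, ∀ p : H, (finalConst r L ζ)⁻¹ ≤ ‖XD (φ n) p‖ ∧
      (finalConst r L ζ)⁻¹ ≤ ‖YD (φ n) p‖) ∧
    (∀ n : ℤ, ∀ p : H,
      (Summable fun m : ℕ => A ^ (-(ε * (m : ℝ))) • XD (φ (n + (m : ℤ))) p) ∧
      (Summable fun m : ℕ => A ^ (-(ε * (m : ℝ))) • YD (φ (n + (m : ℤ))) p) ∧
      (Summable fun m : ℕ => A ^ (-(ε * (m : ℝ))) • ZD (φ (n + (m : ℤ))) p) ∧
      (finalConst r L ζ)⁻¹ * A ^ (-(n : ℝ)) * (∑' m : ℕ, A ^ (-(2 * ε * (m : ℝ)))) ≤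
        wedgeNorm
          ![∑' m : ℕ, A ^ (-(ε * (m : ℝ))) • XD (φ (n + (m : ℤ))) p,
            ∑' m : ℕ, A ^ (-(ε * (m : ℝ))) • YD (φ (n + (m : ℤ))) p,
            ∑' m : ℕ, A ^ (-(ε * (m : ℝ))) • ZD (φ (n + (m : ℤ))) p]) := by
  have hA0 : 0 < A := by linarith
  obtain ⟨hC2, hCs, hCz, hCζ⟩ := le_finalConst hr hL hζ
  have hC : 0 < finalConst r L ζ := by linarith
  have hR : ∀ n : ℤ, 0 < A ^ n := fun n => zpow_pos hA0 n
  have h0 : 0 ≤ A ^ (-ε) := (Real.rpow_pos_of_pos hA0 _).le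
  have h1 : A ^ (-ε) < 1 := Real.rpow_lt_one_of_one_lt_of_neg hA (by linarith)
  have hpow : ∀ m : ℕ, A ^ (-(ε * ((m : ℝ) + 1))) = (A ^ (-ε)) ^ (m + 1) := fun m => by
    rw [← rpow_neg_mul_natCast hA0, Nat.cast_succ]
  have hneg : ∀ n : ℤ, A ^ (-(n : ℝ)) = (A ^ n)⁻¹ := fun n => by
    rw [Real.rpow_neg hA0.le, Real.rpow_intCast]
  refine ⟨fun n => (h.bd n).1, fun n => ?_, fun n p => ⟨?_, ?_, ?_⟩, fun hεA n p => ?_,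
    fun n p => ⟨?_, ?_⟩, fun n p => ?_⟩
  · rw [Real.rpow_intCast]
    refine ((h.bd n).ckR_le hr (hR n) 6).trans (ENNReal.ofReal_le_ofReal ?_)
    rw [← mul_assoc]
    exact mul_le_mul_of_nonneg_right hCs (hR n).le
  · exact (h.norm_wd_bounds true n p).2.trans hC2
  · exact (h.norm_wd_bounds false n p).2.trans hC2
  · refine (h.norm_zd_le hr hA0 n p).trans ?_
    rw [hneg, div_eq_mul_inv]
    exact mul_le_mul_of_nonneg_right hCz (inv_nonneg.2 (hR n).le)
  · have h2 := h.hasSum_inner hc h0 h1 (horth hεA true n p)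
    have h3 := h.hasSum_inner hc h0 h1 (horth hεA false n p)
    simp only [hpow]
    exact ⟨h2.summable, h3.summable, h2.tsum_eq, h3.tsum_eq⟩
  · exact (inv_le_of_inv_le₀ (by norm_num) (by norm_num; exact hC2)).trans
      (h.norm_wd_bounds true n p).1
  · exact (inv_le_of_inv_le₀ (by norm_num) (by norm_num; exact hC2)).trans
      (h.norm_wd_bounds false n p).1
  · have hX : HasSum _ _ := h.hasSum_wd hc h0 h1 true n p
    have hY : HasSum _ _ := h.hasSum_wd hc h0 h1 false n p
    have hZ := h.hasSum_zd hr hA.le hL.le h0 h1 n p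
    simp only [rpow_neg_mul_natCast hA0]
    refine ⟨hX.summable, hY.summable, hZ.summable, ?_⟩
    have hX' : ∑' m : ℕ, (A ^ (-ε)) ^ m • XD (φ (n + (m : ℤ))) p = s true n p := hX.tsum_eq
    have hY' : ∑' m : ℕ, (A ^ (-ε)) ^ m • YD (φ (n + (m : ℤ))) p = s false n p := hY.tsum_eq
    rw [hX', hY', hZ.tsum_eq]
    refine le_trans ?_ ((h.transversal n p).wedgeNorm_ge hc (hR n) hζ)
    have hgeo : ∑' m : ℕ, (A ^ (-(2 * ε))) ^ m = (c ^ 2)⁻¹ := by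
      have h4 : A ^ (-(2 * ε)) = (A ^ (-ε)) ^ 2 := by
        rw [← rpow_neg_mul_natCast hA0]
        push_cast
        rw [mul_comm]
      rw [h4, tsum_geometric_of_lt_one (sq_nonneg _) (pow_lt_one₀ h0 h1 two_ne_zero)]
      congr 1
      linarith
    rw [hgeo, hneg, div_eq_mul_inv, div_eq_mul_inv]
    have h5 : (finalConst r L ζ)⁻¹ ≤ ζ / 4 := by
      rw [inv_le_comm₀ hC (by positivity), inv_div]
      exact hCζ
    have := hR n
    gcongr

end Assembly

section Theta

variable {E : Type*} [NormedAddCommGroup E] [NormedSpace ℝ E]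

theorem fderiv_apply_eq_of_hasDerivAt {f : H → E} {p v : H} (hf : DifferentiableAt ℝ f p) {d : E}
    (h : HasDerivAt (fun t : ℝ => f (p + t • v)) d 0) : fderiv ℝ f p v = d := by
  rw [← hf.lineDeriv_eq_fderiv]
  exact h.deriv

/-- The factorial growth of derivatives that gives a positive analytic radius. -/
theorem bd_of_wordSum_le {C W : ℝ} (hC : 0 < C) {f : H → E} (hf : Smooth f)
    (h : ∀ k p, wordSum k f p ≤ C ^ k * k.factorial * W) : Bd (1 / (2 * C)) (2 * W) f := by
  refine ⟨hf, fun p n => ?_⟩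
  have hW : 0 ≤ W := by simpa using (wordSum_nonneg 0 f p).trans (h 0 p)
  have h1 : partialNorm (1 / (2 * C)) n f p ≤ ∑ k ∈ Finset.range n, (1 / 2 : ℝ) ^ k * W := by
    refine Finset.sum_le_sum fun k _ => ?_
    refine (mul_le_mul_of_nonneg_left (h k p) (by positivity)).trans (le_of_eq ?_)
    have := k.factorial_ne_zero
    rw [div_pow, div_pow, mul_pow]
    field_simp
  refine h1.trans ?_
  rw [← Finset.sum_mul]
  refine mul_le_mul_of_nonneg_right ?_ hW
  exact (summable_geometric_two.sum_le_tsum _ fun i _ => by positivity).trans_eq tsum_geometric_two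

/-- A finite part of a theta series on the Heisenberg group. -/
def thetaSum (s : Finset ℤ) (θ : ℝ) (j : ℕ) (φ : ℝ) (p : H) : ℝ :=
  ∑ k ∈ s, Real.cos (p.2.2 + k * p.1 + φ) *
    ((p.2.1 + k + θ) ^ j * Real.exp (-4 * (p.2.1 + k + θ) ^ 2))

theorem smooth_thetaSum (s : Finset ℤ) (θ : ℝ) (j : ℕ) (φ : ℝ) : Smooth (thetaSum s θ j φ) := by
  unfold Smooth thetaSum
  exact ContDiff.sum fun k _ => by fun_prop

theorem wd_true_thetaSum (s : Finset ℤ) (θ : ℝ) (j : ℕ) (φ : ℝ) :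
    WD true (thetaSum s θ j φ) = fun p =>
      thetaSum s θ (j + 1) (φ + Real.pi / 2) p + (-θ) • thetaSum s θ j (φ + Real.pi / 2) p := by
  funext p
  rw [WD_eq]
  refine fderiv_apply_eq_of_hasDerivAt ((smooth_thetaSum s θ j φ).diff p) ?_
  simp only [thetaSum, smul_eq_mul, Finset.mul_sum, ← Finset.sum_add_distrib]
  refine HasDerivAt.fun_sum fun k _ => ?_
  simp only [vec, Prod.smul_mk, smul_eq_mul, mul_one, mul_zero, Prod.fst_add, Prod.snd_add,
    add_zero]
  have h : HasDerivAt (fun t : ℝ => p.2.2 + t * p.2.1 + k * (p.1 + t) + φ) (p.2.1 + k) 0 := by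
    have h1 := (((hasDerivAt_id (0 : ℝ)).mul_const p.2.1).const_add p.2.2).add
      (((hasDerivAt_id (0 : ℝ)).const_add p.1).const_mul (k : ℝ))
    simpa using h1.add_const φ
  refine (h.cos.mul_const ((p.2.1 + k + θ) ^ j *
    Real.exp (-4 * (p.2.1 + k + θ) ^ 2))).congr_deriv ?_
  rw [← add_assoc, Real.cos_add_pi_div_two]
  simp only [zero_mul, add_zero]
  ring

theorem wd_false_thetaSum (s : Finset ℤ) (θ : ℝ) (j : ℕ) (φ : ℝ) :
    WD false (thetaSum s θ j φ) = fun p =>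
      (j : ℝ) • thetaSum s θ (j - 1) φ p + (-8 : ℝ) • thetaSum s θ (j + 1) φ p := by
  funext p
  rw [WD_eq]
  refine fderiv_apply_eq_of_hasDerivAt ((smooth_thetaSum s θ j φ).diff p) ?_
  simp only [thetaSum, smul_eq_mul, Finset.mul_sum, ← Finset.sum_add_distrib]
  refine HasDerivAt.fun_sum fun k _ => ?_
  simp only [vec, Prod.smul_mk, smul_eq_mul, mul_one, mul_zero, Prod.fst_add, Prod.snd_add,
    add_zero]
  have h : HasDerivAt (fun t : ℝ => p.2.1 + t + k + θ) 1 0 := by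
    simpa using (((hasDerivAt_id (0 : ℝ)).const_add p.2.1).add_const (k : ℝ)).add_const θ
  refine (((h.fun_pow j).fun_mul ((h.fun_pow 2).const_mul (-4 : ℝ)).exp).const_mul
    (Real.cos (p.2.2 + k * p.1 + φ))).congr_deriv ?_
  simp only [add_zero]
  ring

theorem zd_thetaSum (s : Finset ℤ) (θ : ℝ) (j : ℕ) (φ : ℝ) (p : H) :
    ZD (thetaSum s θ j φ) p = thetaSum s θ j (φ + Real.pi / 2) p := by
  refine fderiv_apply_eq_of_hasDerivAt ((smooth_thetaSum s θ j φ).diff p) ?_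
  simp only [thetaSum]
  refine HasDerivAt.fun_sum fun k _ => ?_
  simp only [Prod.smul_mk, smul_eq_mul, mul_one, mul_zero, Prod.fst_add, Prod.snd_add,
    add_zero]
  have h : HasDerivAt (fun t : ℝ => p.2.2 + t + k * p.1 + φ) 1 0 := by
    simpa using (((hasDerivAt_id (0 : ℝ)).const_add p.2.2).add_const (k * p.1)).add_const φ
  refine (h.cos.mul_const ((p.2.1 + k + θ) ^ j *
    Real.exp (-4 * (p.2.1 + k + θ) ^ 2))).congr_deriv ?_
  rw [← add_assoc, Real.cos_add_pi_div_two]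
  simp only [add_zero]
  ring

theorem sum_pow_natAbs_sub_le (s : Finset ℤ) (m : ℤ) {q : ℝ} (h0 : 0 ≤ q) (h1 : q ≤ 1 / 8)
    (hs : m ∉ s) : ∑ k ∈ s, q ^ (k - m).natAbs ≤ 2 / 7 := by
  have key : ∀ t : Finset ℤ, m ∉ t → Set.InjOn (fun k : ℤ => (k - m).natAbs) t →
      ∑ k ∈ t, q ^ (k - m).natAbs ≤ 1 / 7 := by
    intro t ht hinj
    rw [← Finset.sum_image (f := fun n : ℕ => q ^ n) hinj]
    have hsub : ∀ n ∈ t.image (fun k : ℤ => (k - m).natAbs), n ≠ 0 := by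
      intro n hn h
      obtain ⟨k, hk, rfl⟩ := Finset.mem_image.1 hn
      have : k = m := by omega
      exact ht (this ▸ hk)
    have hsum : Summable fun n : ℕ => (1 / 8 : ℝ) ^ n :=
      summable_geometric_of_lt_one (by norm_num) (by norm_num)
    have h2 := hsum.sum_le_tsum (insert 0 (t.image (fun k : ℤ => (k - m).natAbs)))
      fun i _ => by positivity
    rw [Finset.sum_insert fun h => hsub 0 h rfl,
      tsum_geometric_of_lt_one (by norm_num) (by norm_num)] at h2
    have h3 : ∑ n ∈ t.image (fun k : ℤ => (k - m).natAbs), q ^ n ≤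
        ∑ n ∈ t.image (fun k : ℤ => (k - m).natAbs), (1 / 8 : ℝ) ^ n :=
      Finset.sum_le_sum fun n _ => by gcongr
    norm_num at h2 h3 ⊢
    linarith
  rw [← Finset.sum_filter_add_sum_filter_not s (fun k => m ≤ k)]
  have h1 := key (s.filter fun k => m ≤ k) (fun h => hs (Finset.mem_filter.1 h).1) (by
    intro a ha b hb h
    have ha := (Finset.mem_filter.1 ha).2
    have hb := (Finset.mem_filter.1 hb).2
    simp only at h
    omega)
  have h2 := key (s.filter fun k => ¬ m ≤ k) (fun h => hs (Finset.mem_filter.1 h).1) (by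
    intro a ha b hb h
    have ha := (Finset.mem_filter.1 ha).2
    have hb := (Finset.mem_filter.1 hb).2
    simp only at h
    omega)
  linarith

theorem exp_neg_nine_fourths_le : Real.exp (-(9 / 4)) ≤ 1 / 8 := by
  have h : (8 : ℝ) ≤ Real.exp (9 / 4) := by
    have h2 : Real.exp (9 / 4) = Real.exp 1 ^ 2 * Real.exp (1 / 4) := by
      rw [← Real.exp_nat_mul, ← Real.exp_add]; norm_num
    have h3 := Real.exp_one_gt_d9
    have h4 : (1 / 4 : ℝ) + 1 ≤ Real.exp (1 / 4) := Real.add_one_le_exp _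
    rw [h2]
    nlinarith
  rw [Real.exp_neg, inv_eq_one_div]
  exact one_div_le_one_div_of_le (by norm_num) h

theorem abs_thetaSum_le (s : Finset ℤ) (θ : ℝ) (j : ℕ) (φ : ℝ) (p : H) :
    |thetaSum s θ j φ p| ≤ j.factorial * (2 * Real.exp (5 / 2)) := by
  set m : ℤ := -round (p.2.1 + θ) with hm
  have hq0 := (Real.exp_pos (-(9 / 4))).le
  have hterm : ∀ k : ℤ, |Real.cos (p.2.2 + k * p.1 + φ) *
      ((p.2.1 + k + θ) ^ j * Real.exp (-4 * (p.2.1 + k + θ) ^ 2))| ≤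
      j.factorial * Real.exp (5 / 2) * Real.exp (-(9 / 4)) ^ (k - m).natAbs := by
    intro k
    set t := p.2.1 + k + θ with ht
    have h1 : |t| ^ j ≤ j.factorial * Real.exp |t| := by
      have := Real.pow_div_factorial_le_exp |t| (abs_nonneg t) j
      rwa [div_le_iff₀ (by positivity), mul_comm] at this
    have h2 : ((k - m).natAbs : ℝ) ≤ |t| + 1 / 2 := by
      have h3 : ((k - m).natAbs : ℝ) = |(k : ℝ) - m| := by
        rw [Nat.cast_natAbs]; push_cast; rfl
      have h4 := abs_sub_round (p.2.1 + θ)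
      rw [h3, show (k : ℝ) - m = t - (p.2.1 + θ - round (p.2.1 + θ)) by
        rw [hm, ht]; push_cast; ring]
      exact (abs_sub _ _).trans (by linarith)
    rw [abs_mul, abs_mul, abs_pow, Real.abs_exp]
    calc |Real.cos (p.2.2 + k * p.1 + φ)| * (|t| ^ j * Real.exp (-4 * t ^ 2))
        ≤ 1 * (j.factorial * Real.exp |t| * Real.exp (-4 * t ^ 2)) := by
          gcongr
          exact Real.abs_cos_le_one _
      _ = j.factorial * Real.exp (|t| - 4 * t ^ 2) := by
          rw [one_mul, mul_assoc, ← Real.exp_add]; ring_nf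
      _ ≤ j.factorial * Real.exp (5 / 2 + (k - m).natAbs * (-(9 / 4))) := by
          gcongr
          nlinarith [sq_abs t, sq_nonneg (|t| - 1 / 2), abs_nonneg t]
      _ = _ := by rw [Real.exp_add, Real.exp_nat_mul, mul_assoc]
  refine (Finset.abs_sum_le_sum_abs _ _).trans ((Finset.sum_le_sum fun k _ => hterm k).trans ?_)
  rw [← Finset.mul_sum, mul_assoc, mul_comm 2]
  gcongr
  refine (Finset.sum_le_sum_of_subset_of_nonneg (Finset.insert_erase_subset m s) fun _ _ _ => by positivity).trans ?_
  rw [Finset.sum_insert (Finset.notMem_erase m s)]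
  have := sum_pow_natAbs_sub_le (s.erase m) m hq0 exp_neg_nine_fourths_le
    (Finset.notMem_erase m s)
  simp only [sub_self, Int.natAbs_zero, pow_zero]
  linarith

theorem wordSum_thetaSum_le (s : Finset ℤ) {θ : ℝ} (hθ : |θ| ≤ 1) (n j : ℕ) (φ : ℝ) (p : H) :
    wordSum n (thetaSum s θ j φ) p ≤ 11 ^ n * (j + n).factorial * (2 * Real.exp (5 / 2)) := by
  induction n generalizing j φ with
  | zero => simpa [wordSum] using abs_thetaSum_le s θ j φ p
  | succ n ih =>
    set W := 2 * Real.exp (5 / 2) with hW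
    have hW0 : 0 ≤ W := by positivity
    have hsm := smooth_thetaSum s θ
    have hsmul : ∀ (c : ℝ) (i : ℕ) (ψ : ℝ), wordSum n (fun p => c • thetaSum s θ i ψ p) p ≤
        |c| * wordSum n (thetaSum s θ i ψ) p := fun c i ψ =>
      wordSum_clm_le n (c • ContinuousLinearMap.id ℝ ℝ) (fun x => by simp) (hsm i ψ) p
    have hsm' : ∀ (c : ℝ) (i : ℕ) (ψ : ℝ), Smooth (fun p => c • thetaSum s θ i ψ p) :=
      fun c i ψ => (hsm i ψ).const_smul c
    rw [wordSum, wd_true_thetaSum, wd_false_thetaSum]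
    have h1 := (wordSum_add_le n (hsm (j + 1) (φ + Real.pi / 2)) (hsm' (-θ) j (φ + Real.pi / 2)) p)
    have h2 := wordSum_add_le n (hsm' j (j - 1) φ) (hsm' (-8) (j + 1) φ) p
    have h3 := hsmul (-θ) j (φ + Real.pi / 2)
    have h4 := hsmul j (j - 1) φ
    have h5 := hsmul (-8) (j + 1) φ
    have i1 := ih (j + 1) (φ + Real.pi / 2)
    have i2 := ih j (φ + Real.pi / 2)
    have i3 := ih (j - 1) φ
    have i4 := ih (j + 1) φ
    have e1 : j + 1 + n = j + (n + 1) := by ring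
    rw [e1] at i1 i4
    set M : ℝ := ((j + (n + 1)).factorial : ℝ) with hM
    have f1 : ((j + n).factorial : ℝ) ≤ M := by
      exact Nat.cast_le.2 (Nat.factorial_le (by omega))
    have f2 : (j : ℝ) * ((j - 1 + n).factorial : ℝ) ≤ M := by
      rcases Nat.eq_zero_or_pos j with rfl | hj
      · simp [hM]
      · refine le_trans ?_ f1
        have : j + n = (j - 1 + n) + 1 := by omega
        rw [this, Nat.factorial_succ]
        push_cast
        refine mul_le_mul_of_nonneg_right ?_ (by positivity)
        rw [Nat.cast_sub hj]
        push_cast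
        linarith [(Nat.cast_nonneg n : (0 : ℝ) ≤ n)]
    have j2 : |-θ| * wordSum n (thetaSum s θ j (φ + Real.pi / 2)) p ≤ 11 ^ n * M * W := by
      rw [abs_neg]
      refine (mul_le_of_le_one_left (wordSum_nonneg _ _ _) hθ).trans (i2.trans ?_)
      gcongr
    have j3 : |(j : ℝ)| * wordSum n (thetaSum s θ (j - 1) φ) p ≤ 11 ^ n * M * W := by
      rw [Nat.abs_cast]
      refine (mul_le_mul_of_nonneg_left i3 (by positivity)).trans ?_
      calc (j : ℝ) * (11 ^ n * ((j - 1 + n).factorial : ℝ) * W)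
          = 11 ^ n * ((j : ℝ) * ((j - 1 + n).factorial : ℝ)) * W := by ring
        _ ≤ _ := by gcongr
    have h8 : |(-8 : ℝ)| = 8 := by norm_num
    rw [h8] at h5
    rw [pow_succ]
    linarith

theorem le_thetaSum_sq_add_sq {s : Finset ℤ} {θ : ℝ} (φ : ℝ) {p : H} {m : ℤ} (hm : m ∈ s)
    (h : |p.2.1 + m + θ| ≤ 1 / 4) :
    1 / 16 ≤ thetaSum s θ 0 φ p ^ 2 + thetaSum s θ 0 (φ + Real.pi / 2) p ^ 2 := by
  set a : ℤ → ℝ := fun k => Real.exp (-4 * (p.2.1 + k + θ) ^ 2) with ha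
  set α : ℤ → ℝ := fun k => p.2.2 + k * p.1 + φ with hα
  have hc : thetaSum s θ 0 φ p = ∑ k ∈ s, Real.cos (α k) * a k := by simp [thetaSum, ha, hα]
  have hd : thetaSum s θ 0 (φ + Real.pi / 2) p = -∑ k ∈ s, Real.sin (α k) * a k := by
    rw [← Finset.sum_neg_distrib]
    refine Finset.sum_congr rfl fun k _ => ?_
    rw [← add_assoc, Real.cos_add_pi_div_two]
    simp [ha, hα]
  have hsum : thetaSum s θ 0 φ p * Real.cos (α m) -
      thetaSum s θ 0 (φ + Real.pi / 2) p * Real.sin (α m) =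
      ∑ k ∈ s, Real.cos (α k - α m) * a k := by
    rw [hc, hd, neg_mul, sub_neg_eq_add, Finset.sum_mul, Finset.sum_mul, ← Finset.sum_add_distrib]
    refine Finset.sum_congr rfl fun k _ => ?_
    rw [Real.cos_sub]
    ring
  have hpos : ∀ k, 0 < a k := fun k => Real.exp_pos _
  have ham : 3 / 4 ≤ a m := by
    have h1 := Real.add_one_le_exp (-4 * (p.2.1 + m + θ) ^ 2)
    have h2 : (p.2.1 + m + θ) ^ 2 ≤ (1 / 4) ^ 2 := sq_le_sq' (abs_le.1 h).1 (abs_le.1 h).2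
    have h3 : a m = Real.exp (-4 * (p.2.1 + m + θ) ^ 2) := rfl
    linarith
  have hrest : ∑ k ∈ s.erase m, a k ≤ 2 / 7 := by
    refine (Finset.sum_le_sum fun k hk => ?_).trans (sum_pow_natAbs_sub_le (s.erase m) m
      (Real.exp_pos _).le exp_neg_nine_fourths_le (Finset.notMem_erase m s))
    rw [← Real.exp_nat_mul]
    refine Real.exp_le_exp.2 ?_
    have h1 : (1 : ℝ) ≤ ((k - m).natAbs : ℝ) := by
      have : k ≠ m := (Finset.mem_erase.1 hk).1
      exact_mod_cast (by omega : 1 ≤ (k - m).natAbs)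
    have h2 : ((k - m).natAbs : ℝ) ≤ |p.2.1 + k + θ| + 1 / 4 := by
      have h3 : ((k - m).natAbs : ℝ) = |(k : ℝ) - m| := by
        rw [Nat.cast_natAbs]; push_cast; rfl
      rw [h3, show (k : ℝ) - m = p.2.1 + k + θ - (p.2.1 + m + θ) by ring]
      exact (abs_sub _ _).trans (by linarith)
    nlinarith [sq_abs (p.2.1 + k + θ)]
  have hlow : 1 / 4 ≤ ∑ k ∈ s, Real.cos (α k - α m) * a k := by
    rw [← Finset.add_sum_erase s _ hm, sub_self, Real.cos_zero, one_mul]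
    have : -∑ k ∈ s.erase m, a k ≤ ∑ k ∈ s.erase m, Real.cos (α k - α m) * a k := by
      rw [← Finset.sum_neg_distrib]
      exact Finset.sum_le_sum fun k _ => by nlinarith [Real.neg_one_le_cos (α k - α m), hpos k]
    linarith
  rw [← hsum] at hlow
  set c := thetaSum s θ 0 φ p
  set d := thetaSum s θ 0 (φ + Real.pi / 2) p
  nlinarith [Real.sin_sq_add_cos_sq (α m), sq_nonneg (c * Real.sin (α m) + d * Real.cos (α m))]

/-- Two real theta functions: the real and imaginary part of a theta function with
characteristic `θ`, whose vertical derivative is large away from its zeros. -/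
theorem exists_theta {θ : ℝ} (hθ : |θ| ≤ 1) : ∃ f : Bool → H → ℝ,
    (∀ i, Bd (1 / 22) (4 * Real.exp (5 / 2)) (f i)) ∧
    ∀ p : H, (∃ m : ℤ, |p.2.1 + m + θ| ≤ 1 / 4) →
      1 / 16 ≤ ZD (f false) p ^ 2 + ZD (f true) p ^ 2 := by
  have hbd : ∀ (s : Finset ℤ) (φ : ℝ), Bd (1 / 22) (4 * Real.exp (5 / 2)) (thetaSum s θ 0 φ) := by
    intro s φ
    have := bd_of_wordSum_le (C := 11) (by norm_num) (smooth_thetaSum s θ 0 φ)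
      (W := 2 * Real.exp (5 / 2)) fun k p => by simpa using wordSum_thetaSum_le s hθ k 0 φ p
    refine this.mono (by norm_num) (by norm_num) (le_of_eq (by ring))
  set F := Filter.hyperfilter ℕ with hF
  have hlim : ∀ φ, ∃ h : H → ℝ, Bd (1 / 22) (4 * Real.exp (5 / 2)) h ∧
      ∀ (l : List Bool) (p : H), Filter.Tendsto (fun n : ℕ =>
        l.foldr WD (thetaSum (Finset.Icc (-(n : ℤ)) n) θ 0 φ) p) F (nhds (l.foldr WD h p)) :=
    fun φ => exists_limit F (by norm_num) (Filter.Eventually.of_forall fun n => hbd _ φ)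
  choose h hh hlim using hlim
  have hz : ∀ φ p, Filter.Tendsto (fun n : ℕ =>
      thetaSum (Finset.Icc (-(n : ℤ)) n) θ 0 (φ + Real.pi / 2) p) F (nhds (ZD (h φ) p)) := by
    intro φ p
    rw [zd_eq (hh φ).1]
    refine ((hlim φ [false, true] p).sub (hlim φ [true, false] p)).congr fun n => ?_
    rw [← zd_thetaSum, zd_eq (smooth_thetaSum _ _ _ _)]
    rfl
  refine ⟨fun i => h (if i then 0 + Real.pi / 2 else 0), fun i => hh _, fun p ⟨m, hm⟩ => ?_⟩
  refine ge_of_tendsto (((hz 0 p).pow 2).add ((hz (0 + Real.pi / 2) p).pow 2)) ?_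
  have hev : ∀ᶠ n : ℕ in Filter.atTop, m.natAbs ≤ n := Filter.eventually_ge_atTop _
  have hev' : ∀ᶠ n : ℕ in (F : Filter ℕ), m.natAbs ≤ n := Nat.hyperfilter_le_atTop hev
  refine hev'.mono fun n hn => ?_
  exact le_thetaSum_sq_add_sq (0 + Real.pi / 2) (Finset.mem_Icc.2 (by omega)) hm

end Theta

section GoodFamily

variable {E : Type*} [NormedAddCommGroup E] [NormedSpace ℝ E]

theorem smooth_dilate (lam : ℝ) : Smooth (dilate lam) := by
  unfold Smooth dilate
  fun_prop

theorem Smooth.comp_dilate {f : H → E} (hf : Smooth f) (lam : ℝ) :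
    Smooth (fun p => f (dilate lam p)) :=
  ContDiff.comp (f := dilate lam) hf (smooth_dilate lam)

theorem fderiv_comp_dilate {f : H → E} (hf : Smooth f) (lam : ℝ) (p v : H) :
    fderiv ℝ (fun p => f (dilate lam p)) p v = fderiv ℝ f (dilate lam p) (dilate lam v) := by
  have h2 : HasFDerivAt (fun p => f (dilate lam p)) _ p :=
    (hf.diff (dilate lam p)).hasFDerivAt.comp p
      (ContinuousLinearMap.hasFDerivAt (x := p) ((lam • ContinuousLinearMap.fst ℝ ℝ (ℝ × ℝ)).prod
        (((lam • ContinuousLinearMap.fst ℝ ℝ ℝ).prod (lam ^ 2 • ContinuousLinearMap.snd ℝ ℝ ℝ)).comp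
          (ContinuousLinearMap.snd ℝ ℝ (ℝ × ℝ)))))
  rw [h2.fderiv]
  rfl

theorem wd_comp_dilate (b : Bool) {f : H → E} (hf : Smooth f) (lam : ℝ) :
    WD b (fun p => f (dilate lam p)) = fun p => lam • WD b f (dilate lam p) := by
  funext p
  rw [WD_eq, WD_eq, fderiv_comp_dilate hf, ← map_smul]
  cases b
  · simp [vec, dilate]
  · simp [vec, dilate, pow_two, mul_assoc]

theorem wordSum_comp_dilate_le (k : ℕ) {f : H → E} (hf : Smooth f) {lam : ℝ} (h0 : 0 ≤ lam)
    (p : H) : wordSum k (fun p => f (dilate lam p)) p ≤ lam ^ k * wordSum k f (dilate lam p) := by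
  induction k generalizing f with
  | zero => simp [wordSum]
  | succ k ih =>
    have key : ∀ b, wordSum k (WD b (fun p => f (dilate lam p))) p ≤
        lam * (lam ^ k * wordSum k (WD b f) (dilate lam p)) := fun b => by
      rw [wd_comp_dilate b hf]
      exact (wordSum_clm_le k (lam • ContinuousLinearMap.id ℝ E)
        (fun x => by simp [norm_smul, abs_of_nonneg h0]) ((hf.wd b).comp_dilate lam) p).trans
        (mul_le_mul_of_nonneg_left (ih (hf.wd b)) h0)
    simp only [wordSum]
    refine (add_le_add (key true) (key false)).trans (le_of_eq ?_)
    ring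

theorem Bd.comp_dilate {r K R : ℝ} {f : H → E} (h : Bd r K f) (hr : 0 ≤ r) (hR : 0 < R) :
    Bd (r * R) K (fun p => f (dilate R⁻¹ p)) := by
  refine ⟨h.1.comp_dilate _, fun p n => le_trans ?_ (h.2 (dilate R⁻¹ p) n)⟩
  refine Finset.sum_le_sum fun k _ => ?_
  refine (mul_le_mul_of_nonneg_left (wordSum_comp_dilate_le k h.1 (inv_nonneg.2 hR.le) p)
    (by positivity)).trans (le_of_eq ?_)
  rw [mul_pow, inv_pow]
  field_simp

theorem Good.dilate {r L μ ζ R : ℝ} {f : Fin 8 → H → ℝ} (h : Good r L μ ζ 1 f) (hr : 0 ≤ r)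
    (hR : 0 < R) : Good r L μ ζ R (fun j p => R * f j (dilate R⁻¹ p)) := by
  have hs : ∀ j, Smooth (f j) := fun j => (h.bd j).1
  have hRR : R * R⁻¹ = 1 := mul_inv_cancel₀ hR.ne'
  have hw : ∀ j b, WD b (fun p => R * f j (Heisenberg.dilate R⁻¹ p)) =
      fun p => WD b (f j) (Heisenberg.dilate R⁻¹ p) := by
    intro j b
    have h1 := wd_const_smul b R ((hs j).comp_dilate R⁻¹)
    simp only [smul_eq_mul] at h1
    rw [h1, wd_comp_dilate b (hs j)]
    funext p
    exact (mul_assoc _ _ _).symm.trans (by rw [hRR, one_mul])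
  have hww : ∀ j b b', WD b (WD b' (fun p => R * f j (Heisenberg.dilate R⁻¹ p))) =
      fun p => R⁻¹ * WD b (WD b' (f j)) (Heisenberg.dilate R⁻¹ p) := by
    intro j b b'
    rw [hw, wd_comp_dilate b ((hs j).wd b')]
    rfl
  have hz : ∀ j p, R * ZD (fun p => R * f j (Heisenberg.dilate R⁻¹ p)) p =
      ZD (f j) (Heisenberg.dilate R⁻¹ p) := by
    intro j p
    rw [zd_eq (contDiff_const.mul ((hs j).comp_dilate R⁻¹)), hww, hww, zd_eq (hs j), ← mul_sub,
      ← mul_assoc, hRR, one_mul]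
  have hcancel : ∀ x, R * (R⁻¹ * x) = x := fun x => by rw [← mul_assoc, hRR, one_mul]
  refine ⟨fun j => ?_, fun j b => ?_, fun j b b' => ?_, fun b b' => ?_, fun b b' => ?_,
    fun p => ?_, fun b p => ?_⟩
  · have := ((h.bd j).comp_dilate (by linarith) hR).const_mul (by positivity) hR.le
    rw [mul_one, mul_one, mul_comm R] at this
    exact this
  · rw [hw]
    refine ((h.wd j b).comp_dilate (by linarith) hR).radius (by positivity) (le_of_eq (by ring))
  · rw [hww]
    refine (((h.wdwd j b b').comp_dilate (by linarith) hR).const_mul (by positivity)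
      (inv_nonneg.2 hR.le)).mono (by positivity) (le_of_eq (by ring)) (le_of_eq ?_)
    rw [div_one, div_eq_mul_inv, mul_comm]
  · simp only [hw]
    exact ((h.grad b b').comp_dilate (by linarith) hR).radius (by positivity) (le_of_eq (by ring))
  · simp only [hww, hcancel]
    have := ((h.hess b b').comp_dilate (by linarith) hR)
    simp only [one_mul] at this
    exact this.radius (by positivity) (le_of_eq (by ring))
  · simp only [hz]
    simpa only [one_mul] using h.zlow (Heisenberg.dilate R⁻¹ p)
  · simp only [hz, hw]
    simpa only [one_mul] using h.zcross b (Heisenberg.dilate R⁻¹ p)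

/-- A plane wave in the direction of the horizontal vector field `b`. -/
def wave (b : Bool) (φ : ℝ) (p : H) : ℝ := Real.cos ((if b then p.1 else p.2.1) + φ)

theorem smooth_wave (b : Bool) (φ : ℝ) : Smooth (wave b φ) := by
  unfold Smooth wave
  cases b <;> simp <;> fun_prop

theorem wd_wave (b b' : Bool) (φ : ℝ) :
    WD b (wave b' φ) = fun p => kd b b' * wave b' (φ + Real.pi / 2) p := by
  funext p
  rw [WD_eq]
  refine fderiv_apply_eq_of_hasDerivAt ((smooth_wave b' φ).diff p) ?_
  cases b <;> cases b' <;>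
    simp only [wave, vec, kd, Prod.smul_mk, smul_eq_mul, mul_one, mul_zero, Prod.fst_add, Prod.snd_add,
      add_zero, if_true, if_false, Bool.false_eq_true, Bool.true_eq_false, zero_mul, one_mul]
  · have h : HasDerivAt (fun t : ℝ => p.2.1 + t + φ) 1 0 :=
      ((hasDerivAt_id (0 : ℝ)).const_add p.2.1).add_const φ
    refine h.cos.congr_deriv ?_
    rw [← add_assoc, Real.cos_add_pi_div_two]
    simp
  · exact hasDerivAt_const _ _
  · exact hasDerivAt_const _ _
  · have h : HasDerivAt (fun t : ℝ => p.1 + t + φ) 1 0 :=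
      ((hasDerivAt_id (0 : ℝ)).const_add p.1).add_const φ
    refine h.cos.congr_deriv ?_
    rw [← add_assoc, Real.cos_add_pi_div_two]
    simp

theorem zd_wave (b : Bool) (φ : ℝ) (p : H) : ZD (wave b φ) p = 0 := by
  refine fderiv_apply_eq_of_hasDerivAt ((smooth_wave b φ).diff p) ?_
  cases b <;> simpa [wave] using hasDerivAt_const (0 : ℝ) _

theorem bd_wave (b : Bool) (φ : ℝ) : Bd (1 / 22) 2 (wave b φ) := by
  have key : ∀ k φ p, wordSum k (wave b φ) p ≤ 1 := by
    intro k
    induction k with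
    | zero => exact fun φ p => Real.abs_cos_le_one _
    | succ k ih =>
      intro φ p
      simp only [wordSum, wd_wave]
      cases b <;> simpa [kd, wordSum_zero] using ih (φ + Real.pi / 2) p
  have := bd_of_wordSum_le (C := 11) (W := 1) (by norm_num) (smooth_wave b φ) fun k p => by
    refine (key k φ p).trans ?_
    rw [mul_one]
    exact one_le_mul_of_one_le_of_one_le (one_le_pow₀ (by norm_num))
      (Nat.one_le_cast.2 k.factorial_pos)
  norm_num at this
  simpa using this

theorem wave_sq_add_sq (b : Bool) (φ : ℝ) (p : H) :
    wave b φ p ^ 2 + wave b (φ + Real.pi / 2) p ^ 2 = 1 := by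
  unfold wave
  rw [← add_assoc, Real.cos_add_pi_div_two, neg_sq, Real.cos_sq_add_sin_sq]

end GoodFamily

section GoodFamily

theorem wd_const_mul (b : Bool) (c : ℝ) {f : H → ℝ} (hf : Smooth f) :
    WD b (fun p => c * f p) = fun p => c * WD b f p := wd_const_smul b c hf

theorem wd_wd_wave (b b' b'' : Bool) (φ : ℝ) :
    WD b (WD b' (wave b'' φ)) =
      fun p => kd b' b'' * (kd b b'' * wave b'' (φ + Real.pi / 2 + Real.pi / 2) p) := by
  rw [wd_wave, wd_const_mul b _ (smooth_wave _ _), wd_wave]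

/-- Four plane waves with orthonormal gradients and orthonormal pure second derivatives. -/
def waves : Fin 4 → H → ℝ :=
  ![wave true 0, wave true (0 + Real.pi / 2), wave false 0, wave false (0 + Real.pi / 2)]

theorem exists_waves_eq (i : Fin 4) : ∃ b φ, waves i = wave b φ := by
  fin_cases i <;> exact ⟨_, _, rfl⟩

theorem sum_wd_waves (b b' : Bool) (p : H) :
    ∑ i, WD b (waves i) p * WD b' (waves i) p = kd b b' := by
  have h1 := fun b φ => wave_sq_add_sq b φ p
  simp only [Fin.sum_univ_four, waves, Matrix.cons_val, wd_wave]
  cases b <;> cases b'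
  rotate_left
  · simp [kd]
  · simp [kd]
  rotate_left
  · simpa [kd, pow_two] using h1 false (0 + Real.pi / 2)
  · simpa [kd, pow_two] using h1 true (0 + Real.pi / 2)

theorem sum_wd_wd_waves (b b' : Bool) (p : H) :
    ∑ i, WD b (WD b (waves i)) p * WD b' (WD b' (waves i)) p = kd b b' := by
  have h1 := fun b φ => wave_sq_add_sq b φ p
  simp only [Fin.sum_univ_four, waves, Matrix.cons_val, wd_wd_wave]
  cases b <;> cases b'
  rotate_left
  · simp [kd]
  · simp [kd]
  rotate_left
  · simpa [kd, pow_two] using h1 false (0 + Real.pi / 2 + Real.pi / 2)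
  · simpa [kd, pow_two] using h1 true (0 + Real.pi / 2 + Real.pi / 2)

theorem exists_abs_add_le (y : ℝ) :
    (∃ m : ℤ, |y + m + 0| ≤ 1 / 4) ∨ ∃ m : ℤ, |y + m + 1 / 2| ≤ 1 / 4 := by
  have h := abs_le.1 (abs_sub_round y)
  by_cases h1 : |y - round y| ≤ 1 / 4
  · exact .inl ⟨-round y, by push_cast; rw [add_zero]; exact h1⟩
  · right
    rcases lt_abs.1 (not_le.1 h1) with h2 | h2
    · exact ⟨-round y - 1, by push_cast; rw [abs_le]; constructor <;> linarith [h.2]⟩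
    · exact ⟨-round y, by push_cast; rw [abs_le]; constructor <;> linarith [h.1]⟩

theorem exists_thetas : ∃ (K : ℝ) (T : Fin 4 → H → ℝ), 2 ≤ K ∧ (∀ i, Bd (1 / 22) K (T i)) ∧
    ∀ p, 1 / 16 ≤ ∑ i, ZD (T i) p ^ 2 := by
  obtain ⟨f, hf, hfz⟩ := exists_theta (θ := 0) (by norm_num)
  obtain ⟨g, hg, hgz⟩ := exists_theta (θ := 1 / 2) (by norm_num [abs_of_pos])
  refine ⟨4 * Real.exp (5 / 2), ![f false, f true, g false, g true], ?_, ?_, fun p => ?_⟩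
  · linarith [Real.add_one_le_exp (5 / 2 : ℝ)]
  · intro i
    fin_cases i
    exacts [hf _, hf _, hg _, hg _]
  · simp only [Fin.sum_univ_four, Matrix.cons_val]
    have := sq_nonneg (ZD (f false) p)
    have := sq_nonneg (ZD (f true) p)
    have := sq_nonneg (ZD (g false) p)
    have := sq_nonneg (ZD (g true) p)
    rcases exists_abs_add_le p.2.1 with h | h
    · linarith [hfz p h]
    · linarith [hgz p h]

/-- Oscillating functions at scale `1` built from plane waves and small multiples of
theta functions. -/
theorem exists_good : ∃ r L : ℝ, 0 < r ∧ r ≤ 1 ∧ 1 ≤ L ∧ 32 ≤ L * r ∧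
    ∀ κ, 0 < κ → 3200 * L ^ 2 * κ ≤ 1 → ∃ f, Good r L (4 * L ^ 2 * κ ^ 2) (κ / 4) 1 f := by
  obtain ⟨K, T, hK, hT, hTz⟩ := exists_thetas
  refine ⟨1 / 22, 968 * K, by norm_num, by norm_num, by linarith, by linarith,
    fun κ hκ hκL => ?_⟩
  set L := 968 * K with hL
  set r : ℝ := 1 / 22 with hr
  have hr0 : 0 < r := by norm_num
  have hL0 : 0 < L := by linarith
  have hL1 : 1 ≤ L := by linarith
  have hκ1 : κ ≤ 1 := by nlinarith [one_le_pow₀ hL1 (n := 2)]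
  have bounds : ∀ f : H → ℝ, Bd r K f → Bd r L f ∧ (∀ b, Bd (r / 2) L (WD b f)) ∧
      ∀ b b', Bd (r / 4) L (WD b (WD b' f)) := fun f hf =>
    ⟨hf.le (by linarith), fun b => (hf.wd hr0 b).le (by rw [hr, hL]; linarith),
      fun b b' => (hf.wd_wd hr0 b b').le (le_of_eq (by rw [hr, hL]; ring))⟩
  have hWb : ∀ i, Bd r L (waves i) ∧ (∀ b, Bd (r / 2) L (WD b (waves i))) ∧
      ∀ b b', Bd (r / 4) L (WD b (WD b' (waves i))) := fun i => by
    obtain ⟨b, φ, h⟩ := exists_waves_eq i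
    rw [h]
    exact bounds _ ((bd_wave b φ).le hK)
  have hTb := fun i => bounds _ (hT i)
  have hTs : ∀ i, Smooth (T i) := fun i => (hT i).1
  have hWz : ∀ i p, ZD (waves i) p = 0 := fun i p => by
    obtain ⟨b, φ, h⟩ := exists_waves_eq i
    rw [h, zd_wave]
  have hw : ∀ i b, WD b (fun p => κ * T i p) = fun p => κ * WD b (T i) p :=
    fun i b => wd_const_mul b κ (hTs i)
  have hww : ∀ i b b', WD b (WD b' (fun p => κ * T i p)) = fun p => κ * WD b (WD b' (T i)) p :=
    fun i b b' => by rw [hw, wd_const_mul b κ ((hTs i).wd b')]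
  have hz : ∀ i p, ZD (fun p => κ * T i p) p = κ * ZD (T i) p := fun i p => by
    rw [zd_eq (contDiff_const.mul (hTs i)), hww, hww, zd_eq (hTs i), mul_sub]
  have hκL' : κ * L ≤ L := mul_le_of_le_one_left hL0.le hκ1
  let f : Fin (4 + 4) → H → ℝ := Fin.append waves fun i p => κ * T i p
  have hsum : ∀ F : (H → ℝ) → ℝ, ∑ j : Fin 8, F (f j) =
      ∑ i, F (waves i) + ∑ i, F (fun p => κ * T i p) := fun F => by
    refine (Fin.sum_univ_add (a := 4) (b := 4) fun j => F (f j)).trans ?_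
    simp only [f, Fin.append_left, Fin.append_right]
  have hall : ∀ {Q : (H → ℝ) → Prop}, (∀ i, Q (waves i)) → (∀ i, Q (fun p => κ * T i p)) →
      ∀ j : Fin 8, Q (f j) := fun {Q} h1 h2 j =>
    Fin.addCases (m := 4) (n := 4) (motive := fun j => Q (f j))
      (fun i => by simpa only [f, Fin.append_left] using h1 i)
      (fun i => by simpa only [f, Fin.append_right] using h2 i) j
  have hpert : ∀ a b : Fin 4 → H → ℝ, (∀ i, Bd (r / 4) L (a i)) → (∀ i, Bd (r / 4) L (b i)) →
      Bd (r / 4) (4 * L ^ 2 * κ ^ 2) (fun p => ∑ i, κ * a i p * (κ * b i p)) := by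
    intro a b ha hb
    refine ((Bd.sum_const (by positivity) fun i => ((ha i).mul (by positivity) (hb i)).const_mul
      (by positivity) (sq_nonneg κ)).congr fun p => ?_).le (le_of_eq ?_)
    · exact Finset.sum_congr rfl fun i _ => by ring
    · push_cast
      ring
  refine ⟨f, ⟨?_, fun j b => ?_, fun j b b' => ?_, fun b b' => ?_, fun b b' => ?_, fun p => ?_,
    fun b p => ?_⟩⟩
  · rw [mul_one, mul_one]
    exact hall (fun i => (hWb i).1) fun i =>
      ((hTb i).1.const_mul hr0.le hκ.le).le hκL'
  · rw [mul_one]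
    refine hall (Q := fun g => Bd (r / 2) L (WD b g)) (fun i => (hWb i).2.1 b) (fun i => ?_) j
    rw [hw]
    exact (((hTb i).2.1 b).const_mul (by positivity) hκ.le).le hκL'
  · rw [mul_one, div_one]
    refine hall (Q := fun g => Bd (r / 4) L (WD b (WD b' g))) (fun i => (hWb i).2.2 b b')
      (fun i => ?_) j
    rw [hww]
    exact (((hTb i).2.2 b b').const_mul (by positivity) hκ.le).le hκL'
  · rw [mul_one]
    refine (hpert (fun i => WD b (T i)) (fun i => WD b' (T i))
      (fun i => ((hTb i).2.1 b).radius (by positivity) (by linarith))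
      (fun i => ((hTb i).2.1 b').radius (by positivity) (by linarith))).congr fun p => ?_
    rw [hsum fun g => WD b g p * WD b' g p, sum_wd_waves, add_sub_cancel_left]
    simp only [hw]
  · rw [mul_one]
    refine (hpert (fun i => WD b (WD b (T i))) (fun i => WD b' (WD b' (T i)))
      (fun i => (hTb i).2.2 b b) (fun i => (hTb i).2.2 b' b')).congr fun p => ?_
    simp only [one_mul]
    rw [hsum fun g => WD b (WD b g) p * WD b' (WD b' g) p, sum_wd_wd_waves, add_sub_cancel_left]
    simp only [hww]
  · rw [hsum fun g => (1 * ZD g p) ^ 2]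
    simp only [hWz, hz, one_mul, mul_pow, ← Finset.mul_sum]
    have := hTz p
    have : κ ^ 2 * (1 / 16) ≤ κ ^ 2 * ∑ i, ZD (T i) p ^ 2 := by gcongr
    simp
    linarith
  · rw [hsum fun g => WD b g p * (1 * ZD g p)]
    simp only [hWz, hz, hw, one_mul, mul_zero, Finset.sum_const_zero, zero_add]
    have hterm : ∀ i, |κ * WD b (T i) p * (κ * ZD (T i) p)| ≤ κ ^ 2 * (L * (2 * L)) := by
      intro i
      have h1 := ((hTb i).2.1 b).abs_le p
      have h2 : |ZD (T i) p| ≤ 2 * L := by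
        rw [zd_eq (hTs i), two_mul]
        exact (abs_sub _ _).trans
          (add_le_add (((hTb i).2.2 _ _).abs_le p) (((hTb i).2.2 _ _).abs_le p))
      rw [abs_mul, abs_mul, abs_mul, abs_of_pos hκ]
      calc κ * |WD b (T i) p| * (κ * |ZD (T i) p|)
          = κ ^ 2 * (|WD b (T i) p| * |ZD (T i) p|) := by ring
        _ ≤ _ := by gcongr
    refine (Finset.abs_sum_le_sum_abs _ _).trans ((Finset.sum_le_sum fun i _ => hterm i).trans ?_)
    simp only [Finset.sum_const, Finset.card_univ, Fintype.card_fin, nsmul_eq_mul]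
    push_cast
    nlinarith

end GoodFamily

section Damped

variable {V : Type*} [NormedAddCommGroup V] [InnerProductSpace ℝ V]
  {r L μ A c lam ζ : ℝ}

theorem exists_rec [CompleteSpace V] (h0 : 0 ≤ lam) (h1 : lam ≤ 1 / 2) {a : ℤ → V} {B : ℤ → ℝ}
    (ha : ∀ n, ‖a n‖ ≤ B n) (hB : Antitone B) :
    ∃ x : ℤ → V, (∀ n, x n = a n + lam • x (n + 1)) ∧ ∀ n, ‖x n‖ ≤ 2 * B n := by
  have hlam : lam < 1 := by linarith
  have hnorm : ∀ (n : ℤ) (m : ℕ), ‖lam ^ m • a (n + m)‖ ≤ lam ^ m * B n := fun n m => by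
    rw [norm_smul, Real.norm_eq_abs, abs_of_nonneg (pow_nonneg h0 m)]
    exact mul_le_mul_of_nonneg_left ((ha _).trans (hB (by omega))) (pow_nonneg h0 m)
  have hgeo : ∀ n, HasSum (fun m : ℕ => lam ^ m * B n) ((1 - lam)⁻¹ * B n) := fun n =>
    (hasSum_geometric_of_lt_one h0 hlam).mul_right _
  have hsum : ∀ n : ℤ, Summable fun m : ℕ => lam ^ m • a (n + m) := fun n =>
    Summable.of_norm_bounded (hgeo n).summable (hnorm n)
  refine ⟨fun n => ∑' m : ℕ, lam ^ m • a (n + m), fun n => ?_, fun n => ?_⟩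
  · beta_reduce
    rw [(hsum n).tsum_eq_zero_add, ← (hsum (n + 1)).tsum_const_smul]
    congr 1
    · simp
    · refine tsum_congr fun m => ?_
      rw [smul_smul, ← pow_succ']
      push_cast
      congr 2
      ring
  · refine (tsum_of_norm_bounded (hgeo n) (hnorm n)).trans ?_
    refine mul_le_mul_of_nonneg_right ?_ ((norm_nonneg _).trans (ha n))
    rw [inv_le_comm₀ (by linarith) (by norm_num)]
    linarith

theorem inner_sum_smul_sum_smul {v : Fin 8 → V} (hv : Orthonormal ℝ v) (f g : Fin 8 → ℝ) :
    ⟪∑ j, f j • v j, ∑ j, g j • v j⟫ = ∑ j, f j * g j := by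
  rw [hv.inner_sum]
  simp

theorem wd_sum_smul_const (b : Bool) {g : Fin 8 → H → ℝ} (hg : ∀ j, Smooth (g j)) (v : Fin 8 → V) :
    WD b (fun p => ∑ j, g j p • v j) = fun p => ∑ j, WD b (g j) p • v j := by
  rw [wd_sum b _ (f := fun j p => g j p • v j) fun j => (hg j).smul contDiff_const]
  funext p
  refine Finset.sum_congr rfl fun j _ => ?_
  simp [wd_smul b (hg j) contDiff_const, wd_const]

/-- The construction over all scales, in the strongly damped case: the maps at all scales use the
same orthonormal frame. -/
theorem exists_family_of_damped [CompleteSpace V] (hr : 0 ≤ r) (hL : 1 ≤ L) (hA : 1 ≤ A)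
    (hc : 0 < c) (h0 : 0 ≤ lam) (hcl : c ^ 2 + lam ^ 2 = 1) (hζ : 0 < ζ) (hζ1 : ζ ≤ 1)
    (hμ : μ ≤ 1 / 20) (hlam : 10000 * L * lam ≤ ζ) {v : Fin 8 → V} (hv : Orthonormal ℝ v)
    {g : ℤ → Fin 8 → H → ℝ} (hg : ∀ n : ℤ, Good r L μ ζ (A ^ n) (g n)) :
    ∃ (φ : ℤ → H → V) (s : Bool → ℤ → H → V) (z : ℤ → H → V), Family r L A c lam ζ φ s z := by
  have hA0 : 0 < A := by linarith
  have hR : ∀ n : ℤ, 0 < A ^ n := fun n => zpow_pos hA0 n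
  have hLlam : lam ≤ L * lam := le_mul_of_one_le_left h0 hL
  have hc1 : c ≤ 1 := by nlinarith [sq_nonneg lam]
  set φ : ℤ → H → V := fun n p => ∑ j, g n j p • v j with hφ
  have hgs : ∀ n j, Smooth (g n j) := fun n j => ((hg n).bd j).1
  have hbd : ∀ n, Bd (r * A ^ n) (16 * L * A ^ n) (φ n) := fun n => by
    have hRn := hR n
    refine (bd_layer (g := g n) (N := fun j _ => v j) (by positivity) (hg n).bd fun j =>
      (bd_const _ (v j)).le (hv.1 j).le).le ?_
    have : 0 ≤ L * A ^ n := by positivity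
    linarith
  have hwd : ∀ b n p, WD b (φ n) p = ∑ j, WD b (g n j) p • v j := fun b n p => by
    rw [hφ, wd_sum_smul_const b (hgs n)]
  have hzd : ∀ n p, A ^ n • ZD (φ n) p = ∑ j, (A ^ n * ZD (g n j) p) • v j := fun n p => by
    have hφs : Smooth (φ n) := (hbd n).1
    rw [zd_eq hφs, hφ, wd_sum_smul_const false (hgs n), wd_sum_smul_const true (hgs n),
      wd_sum_smul_const false fun j => (hgs n j).wd true,
      wd_sum_smul_const true fun j => (hgs n j).wd false, ← Finset.sum_sub_distrib,
      Finset.smul_sum]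
    refine Finset.sum_congr rfl fun j _ => ?_
    rw [zd_eq (hgs n j), ← sub_smul, smul_smul]
  have hgram : ∀ b b' n p, |⟪WD b (φ n) p, WD b' (φ n) p⟫ - kd b b'| ≤ μ := fun b b' n p => by
    rw [hwd, hwd, inner_sum_smul_sum_smul hv]
    exact ((hg n).grad b b').abs_le p
  have hcross : ∀ b n p, |⟪WD b (φ n) p, A ^ n • ZD (φ n) p⟫| ≤ ζ / 100 := fun b n p => by
    rw [hwd, hzd, inner_sum_smul_sum_smul hv]
    exact (hg n).zcross b p
  have hzlow : ∀ n p, ζ ≤ ‖A ^ n • ZD (φ n) p‖ := fun n p => by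
    refine le_of_sq_le_sq ?_ (norm_nonneg _)
    rw [← real_inner_self_eq_norm_sq, hzd, inner_sum_smul_sum_smul hv]
    simpa only [← pow_two] using (hg n).zlow p
  have hzup : ∀ n p, ‖ZD (φ n) p‖ ≤ 16 * L / A ^ n := fun n p => by
    have hRn := hR n
    rw [le_div_iff₀ hRn, mul_comm, ← abs_of_pos hRn, ← Real.norm_eq_abs, ← norm_smul, hzd]
    refine (norm_sum_le_of_le (n := fun _ => 2 * L) _ fun j _ => ?_).trans (by simp; linarith)
    rw [norm_smul, hv.1, mul_one, norm_mul, Real.norm_eq_abs, Real.norm_eq_abs, abs_of_pos hRn,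
      zd_eq (hgs n j)]
    have h1 := ((hg n).wdwd j false true).abs_le p
    have h2 := ((hg n).wdwd j true false).abs_le p
    rw [le_div_iff₀ hRn] at h1 h2
    have := abs_sub (WD false (WD true (g n j)) p) (WD true (WD false (g n j)) p)
    nlinarith
  have hnorm : ∀ b n p, ‖WD b (φ n) p‖ ≤ 2 := fun b n p => by
    have := (abs_le.1 (hgram b b n p)).2
    rw [real_inner_self_eq_norm_sq, kd, if_pos rfl] at this
    refine le_of_sq_le_sq ?_ zero_le_two
    linarith
  choose s hs hs4 using fun b p => exists_rec (a := fun n => WD b (φ n) p) (B := fun _ => 2) h0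
    (by linarith) (fun n => hnorm b n p) antitone_const
  choose z hz hz' using fun p => exists_rec (a := fun n => ZD (φ n) p)
    (B := fun n => 16 * L / A ^ n) h0 (by linarith) (fun n => hzup n p) (fun m n hmn => by
      have := hR m
      have := zpow_le_zpow_right₀ hA hmn
      beta_reduce
      gcongr)
  refine ⟨φ, fun b n p => s b p n, fun n p => z p n, hbd, fun b n p => hs b p n,
    fun n p => hz p n, fun b n p => ?_, fun n p => ?_⟩
  · have := hgram b b n p
    rw [real_inner_self_eq_norm_sq, kd, if_pos rfl] at this
    linarith
  · have hRn := hR n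
    have hds : ∀ b, ‖s b p n - WD b (φ n) p‖ ≤ 4 * lam := fun b => by
      rw [hs, add_sub_cancel_left, norm_smul, Real.norm_eq_abs, abs_of_nonneg h0]
      nlinarith [hs4 b p (n + 1)]
    have hdz : ‖A ^ n • z p n - A ^ n • ZD (φ n) p‖ ≤ 32 * L * lam := by
      rw [hz, ← smul_sub, add_sub_cancel_left, norm_smul, norm_smul, Real.norm_eq_abs,
        Real.norm_eq_abs, abs_of_nonneg h0, abs_of_pos hRn]
      have h1 : A ^ n * ‖z p (n + 1)‖ ≤ 32 * L := by
        rw [← le_div_iff₀' hRn]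
        refine (hz' p (n + 1)).trans ?_
        rw [← mul_div_assoc, ← mul_assoc]
        norm_num
        have := zpow_le_zpow_right₀ hA (by omega : n ≤ n + 1)
        gcongr
      nlinarith
    have hzn : ‖A ^ n • z p n‖ ≤ 32 * L := by
      rw [norm_smul, Real.norm_eq_abs, abs_of_pos hRn, ← le_div_iff₀' hRn]
      exact (hz' p n).trans (le_of_eq (by ring))
    have hs4' : ∀ b, ‖s b p n‖ ≤ 4 := fun b => (hs4 b p n).trans (by norm_num)
    have hzl := hzlow n p
    refine ⟨fun b b' => ?_, hzn.trans (by linarith), ?_, fun b => ?_⟩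
    · have h1 : |⟪s b p n - WD b (φ n) p, s b' p n⟫| ≤ 4 * lam * 4 :=
        (abs_real_inner_le_norm _ _).trans
          (mul_le_mul (hds b) (hs4' b') (norm_nonneg _) (by linarith))
      have h2 : |⟪WD b (φ n) p, s b' p n - WD b' (φ n) p⟫| ≤ 2 * (4 * lam) :=
        (abs_real_inner_le_norm _ _).trans
          (mul_le_mul (hnorm b n p) (hds b') (norm_nonneg _) (by linarith))
      have h3 : |⟪s b p n, s b' p n⟫| ≤ 4 * 4 := (abs_real_inner_le_norm _ _).trans
          (mul_le_mul (hs4' b) (hs4' b') (norm_nonneg _) (by linarith))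
      have h4 : |lam ^ 2 * ⟪s b p n, s b' p n⟫| ≤ lam * 16 := by
        rw [abs_mul, abs_of_nonneg (sq_nonneg lam)]
        have : lam ^ 2 ≤ lam := by nlinarith
        nlinarith [abs_nonneg ⟪s b p n, s b' p n⟫]
      have h5 := hgram b b' n p
      rw [inner_sub_left] at h1
      rw [inner_sub_right] at h2
      have h6 : c ^ 2 = 1 - lam ^ 2 := by linarith
      rw [h6]
      rw [abs_le] at *
      constructor <;> linarith [h1.1, h1.2, h2.1, h2.2, h4.1, h4.2, h5.1, h5.2]
    · have := norm_sub_norm_le (A ^ n • ZD (φ n) p) (A ^ n • z p n)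
      rw [norm_sub_rev] at this
      linarith
    · have h1 : |⟪s b p n - WD b (φ n) p, A ^ n • z p n⟫| ≤ 4 * lam * (32 * L) :=
        (abs_real_inner_le_norm _ _).trans
          (mul_le_mul (hds b) hzn (norm_nonneg _) (by linarith))
      have h2 : |⟪WD b (φ n) p, A ^ n • z p n - A ^ n • ZD (φ n) p⟫| ≤ 2 * (32 * L * lam) :=
        (abs_real_inner_le_norm _ _).trans
          (mul_le_mul (hnorm b n p) hdz (norm_nonneg _) (by linarith))
      have h5 := hcross b n p
      rw [inner_sub_left] at h1
      rw [inner_sub_right] at h2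
      rw [real_inner_smul_left, abs_mul, abs_of_pos hc]
      have h7 : |⟪s b p n, A ^ n • z p n⟫| ≤ 200 * (L * lam) + ζ / 100 := by
        rw [abs_le] at *
        constructor <;> linarith [h1.1, h1.2, h2.1, h2.2, h5.1, h5.2]
      have h8 := mul_le_of_le_one_left (abs_nonneg ⟪s b p n, A ^ n • z p n⟫) hc1
      linarith

end Damped

section Parameters

open Filter

theorem exists_orthonormal {k d : ℕ} (h : k ≤ d) :
    ∃ v : Fin k → EuclideanSpace ℝ (Fin d), Orthonormal ℝ v :=
  ⟨_, (EuclideanSpace.basisFun (Fin d) ℝ).orthonormal.comp _ (Fin.castLE_injective h)⟩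

theorem eventually_log_div_le {δ : ℝ} (hδ : 0 < δ) :
    ∀ᶠ A : ℝ in atTop, 2 * (Real.log A / A) ≤ δ := by
  filter_upwards [(Real.isLittleO_log_id_atTop.bound (by positivity : 0 < δ / 2)),
    eventually_gt_atTop 1] with A hA h1
  have h0 : 0 < A := by linarith
  rw [id, Real.norm_eq_abs, Real.norm_eq_abs, abs_of_pos h0] at hA
  have := (le_abs_self _).trans hA
  have : Real.log A / A ≤ δ / 2 := by rwa [div_le_iff₀ h0]
  linarith

theorem eventually_div_le (a : ℝ) {δ : ℝ} (hδ : 0 < δ) : ∀ᶠ A : ℝ in atTop, a / A ≤ δ :=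
  (tendsto_const_nhds.div_atTop tendsto_id).eventually_le_const hδ

theorem eventually_rpow_neg_le {δ : ℝ} (hδ : 0 < δ) :
    ∀ᶠ A : ℝ in atTop, ∀ ε, Real.log A ^ (-(1 / 2 : ℝ)) < ε → A ^ (-ε) ≤ δ := by
  have h := ((Real.tendsto_exp_neg_atTop_nhds_zero.comp
    (tendsto_rpow_atTop (by norm_num : (0 : ℝ) < 1 / 2))).comp
    Real.tendsto_log_atTop).eventually_le_const hδ
  filter_upwards [h, eventually_gt_atTop 1] with A hA h1 ε hε
  have hlog := Real.log_pos h1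
  refine le_trans ?_ hA
  rw [Real.rpow_def_of_pos (by linarith), Function.comp_apply, Function.comp_apply,
    Real.exp_le_exp, mul_neg, neg_le_neg_iff]
  calc Real.log A ^ (1 / 2 : ℝ) = Real.log A * Real.log A ^ (-(1 / 2 : ℝ)) := by
        rw [← Real.rpow_one_add' hlog.le (by norm_num)]
        norm_num
    _ ≤ Real.log A * ε := mul_le_mul_of_nonneg_left hε.le hlog.le

theorem one_div_le_log_rpow {A : ℝ} (hA : 3 ≤ A) : 1 / A ≤ Real.log A ^ (-(1 / 2 : ℝ)) := by
  have h0 : 0 < A := by linarith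
  have hlog : 1 ≤ Real.log A := by
    rw [Real.le_log_iff_exp_le h0]
    linarith [Real.exp_one_lt_three]
  rw [Real.rpow_neg (by linarith), one_div]
  refine inv_anti₀ (by positivity) ((Real.rpow_le_rpow_of_exponent_le hlog
    (by norm_num : (1 / 2 : ℝ) ≤ 1)).trans ?_)
  rw [Real.rpow_one]
  linarith [Real.log_le_sub_one_of_pos h0]

theorem one_sub_rpow_sq_le {A ε : ℝ} (hA : 1 < A) (h : ε ≤ 1 / A) :
    1 - (A ^ (-ε)) ^ 2 ≤ 2 * (Real.log A / A) := by
  have h0 : 0 < A := by linarith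
  rw [Real.rpow_def_of_pos h0, ← Real.exp_nat_mul]
  have h1 := Real.add_one_le_exp (((2 : ℕ) : ℝ) * (Real.log A * -ε))
  have h2 : Real.log A * ε ≤ Real.log A / A := by
    rw [div_eq_mul_one_div]
    exact mul_le_mul_of_nonneg_left h (Real.log_pos hA).le
  push_cast at h1 ⊢
  linarith

/-- The construction with absolute constants, in the two ranges of the damping exponent. -/
theorem exists_families : ∃ r L ζ A₀ : ℝ, 0 < r ∧ 0 < L ∧ 0 < ζ ∧ 3 ≤ A₀ ∧
    ∀ A, A₀ ≤ A → ∀ ε c : ℝ, 0 < ε → 0 < c → c ^ 2 + (A ^ (-ε)) ^ 2 = 1 →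
      (ε < 1 / A ∨ Real.log A ^ (-(1 / 2 : ℝ)) < ε) →
      ∃ (φ : ℤ → H → EuclideanSpace ℝ (Fin 29)) (s : Bool → ℤ → H → EuclideanSpace ℝ (Fin 29))
        (z : ℤ → H → EuclideanSpace ℝ (Fin 29)), Family r L A c (A ^ (-ε)) ζ φ s z ∧
        (ε ≤ 1 / A → ∀ b n p, ⟪WD b (φ n) p, s b (n + 1) p⟫ = 0) := by
  obtain ⟨r, L, hr, hr1, hL, hrL, hgood⟩ := exists_good
  obtain ⟨C, hC, hnext⟩ := exists_pre_of_inv (EuclideanSpace ℝ (Fin 29)) L hL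
  have hL0 : 0 < L := by linarith
  obtain ⟨e, he, heL, heC⟩ : ∃ e : ℝ, 0 < e ∧ 1000 * L ^ 2 * e ≤ 1 ∧ C * e ≤ 1 := by
    refine ⟨(1000 * L ^ 2 + C)⁻¹, by positivity, ?_, ?_⟩ <;>
    · rw [mul_inv_le_iff₀ (by positivity)]
      nlinarith [sq_nonneg L]
  have he1 : e ≤ 1 / 1000 := by nlinarith
  obtain ⟨κ, hκ, hκL, hκe⟩ : ∃ κ : ℝ, 0 < κ ∧ 3200 * L ^ 2 * κ ≤ 1 ∧ 4 * L ^ 2 * κ ^ 2 ≤ e := by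
    refine ⟨e * (3200 * L ^ 2)⁻¹, by positivity, ?_, ?_⟩
    · rw [mul_left_comm, mul_inv_cancel₀ (by positivity)]
      linarith
    · have h1 : (3200 * L ^ 2) * (3200 * L ^ 2)⁻¹ = 1 := mul_inv_cancel₀ (by positivity)
      have h2 : 0 < (3200 * L ^ 2)⁻¹ := by positivity
      have h3 : (3200 * L ^ 2)⁻¹ ≤ 1 := inv_le_one_of_one_le₀ (by nlinarith)
      have h4 : 4 * L ^ 2 * (e * (3200 * L ^ 2)⁻¹) ^ 2 =
        e * (e * (1 / 800)) * (((3200 * L ^ 2) * (3200 * L ^ 2)⁻¹) * (3200 * L ^ 2)⁻¹) := by ring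
      rw [h4, h1, one_mul]
      have h5 : e * (e * (1 / 800)) ≤ e := by nlinarith
      exact (mul_le_of_le_one_right (by positivity) h3).trans h5
  obtain ⟨f, hf⟩ := hgood κ hκ hκL
  set μ := 4 * L ^ 2 * κ ^ 2 with hμ
  set ζ := κ / 4 with hζ
  have hζ0 : 0 < ζ := by positivity
  have hκ1 : κ ≤ 1 := by nlinarith
  have hμ0 : 0 ≤ μ := by positivity
  have heL2 : e ≤ L ^ 2 * e := le_mul_of_one_le_left he.le (one_le_pow₀ hL)
  have hee : e ^ 2 ≤ e := by nlinarith
  have hζ1 : ζ ≤ 1 := by linarith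
  have hμ1 : μ ≤ 1 / 20 := by linarith
  clear_value μ ζ
  obtain ⟨δ, hδ, hδe, hδζ⟩ : ∃ δ : ℝ, 0 < δ ∧ 1000 * L ^ 2 * δ ≤ e ^ 2 ∧
      800 * δ * L ^ 2 ≤ ζ / 40 := by
    refine ⟨min (e ^ 2 / (1000 * L ^ 2)) (ζ / 40 / (800 * L ^ 2)), by positivity, ?_, ?_⟩
    · rw [← le_div_iff₀' (by positivity)]
      exact min_le_left _ _
    · rw [mul_right_comm, ← le_div_iff₀' (by positivity)]
      exact min_le_right _ _
  obtain ⟨A₀, hA₀⟩ := eventually_atTop.1 ((eventually_ge_atTop 3).and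
    ((eventually_ge_atTop (100 * L ^ 2)).and
    ((eventually_div_le (2000 * L ^ 3) (by positivity : 0 < e ^ 2)).and
    ((eventually_div_le (240 * L ^ 2) (by positivity : 0 < ζ / 40)).and
    ((eventually_log_div_le (by positivity : 0 < δ ^ 2)).and
    (eventually_rpow_neg_le (by positivity : 0 < ζ / (10000 * L))))))))
  refine ⟨r, L, ζ, max A₀ 3, hr, hL0, hζ0, le_max_right _ _,
    fun A hA ε c hε hc hcl hεA => ?_⟩
  obtain ⟨h3, hAL, hAe, hAζ, hlog, hpow⟩ := hA₀ A ((le_max_left _ _).trans hA)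
  have hA0 : 0 < A := by linarith
  have hg : ∀ n : ℤ, Good r L μ ζ (A ^ n) (fun j p => A ^ n * f j (dilate (A ^ n)⁻¹ p)) :=
    fun n => hf.dilate hr.le (zpow_pos hA0 n)
  have hlam : 0 ≤ A ^ (-ε) := (Real.rpow_pos_of_pos hA0 _).le
  rcases hεA with hεA | hεA
  · obtain ⟨v, hv⟩ := exists_orthonormal (by norm_num : 18 ≤ 29)
    have hcδ : c ≤ δ := by
      refine le_of_sq_le_sq ?_ hδ.le
      linarith [one_sub_rpow_sq_le (by linarith) hεA.le]
    have hp : Par r L e μ (64 * L ^ 2 * e + μ + 2000 * L ^ 3 / A) A c (A ^ (-ε)) :=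
      ⟨hr, hr1, by linarith, hAL, hc, hlam, hcl, he.le, le_rfl⟩
    have hs : Small L e μ (64 * L ^ 2 * e + μ + 2000 * L ^ 3 / A) A c := by
      refine ⟨hκe, hAe, le_trans (by gcongr) hδe, ?_, heL⟩
      linarith
    have hcL := mul_le_mul_of_nonneg_right hcδ (sq_nonneg L)
    obtain ⟨φ, s, z, h, hort⟩ := exists_family hp hs (by positivity) hζ0 (by linarith) hv
      (fun hR hG hI => hnext hp hs heC hR hG hI) hg
    exact ⟨φ, s, z, h, fun _ => hort⟩
  · obtain ⟨v, hv⟩ := exists_orthonormal (by norm_num : 8 ≤ 29)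
    obtain ⟨φ, s, z, h⟩ := exists_family_of_damped hr.le hL (by linarith) hc hlam hcl hζ0
      hζ1 hμ1 (by
        rw [← le_div_iff₀' (by positivity)]
        exact hpow ε hεA) hv hg
    exact ⟨φ, s, z, h, fun hle => absurd (hεA.trans_le hle) (one_div_le_log_rpow h3).not_gt⟩

end Parameters

end HeisenbergEmbedding

/-- **A lacunary family of oscillating maps on the Heisenberg group**
(Theorem 3 of the paper).  For all dyadic `A` beyond an absolute threshold and all
`0 < ε ≤ 1/2` avoiding `[1/A, (log A)^{-1/2}]`, there are smooth maps
`φ_n : H → ℝ²⁹` that are smooth at scale `A^n`, satisfy the orthogonality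
condition when `ε ≤ 1/A`, are non-degenerate, and form quantitative immersions. -/
theorem statement2 :
    ∃ C : ℝ, 1 ≤ C ∧ ∃ A₀ : ℝ, 1 ≤ A₀ ∧
      ∀ A : ℝ, IsDyadic A → A₀ ≤ A →
        ∀ ε : ℝ, 0 < ε → ε ≤ 1 / 2 →
          ¬ (1 / A ≤ ε ∧ ε ≤ (Real.log A) ^ (-(1 / 2 : ℝ))) →
            ∃ φ : ℤ → H → EuclideanSpace ℝ (Fin 29),
              -- smoothness
              (∀ n : ℤ, ContDiff ℝ (⊤ : ℕ∞) (φ n)) ∧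
              -- (smoothness at scale `A^n`)
              (∀ n : ℤ, CkR 6 (A ^ (n : ℝ)) (φ n) ≤ ENNReal.ofReal (C * A ^ (n : ℝ))) ∧
              -- (in particular, first derivative bounds)
              (∀ n : ℤ, ∀ p : H,
                ‖XD (φ n) p‖ ≤ C ∧ ‖YD (φ n) p‖ ≤ C ∧
                ‖ZD (φ n) p‖ ≤ C * A ^ (-(n : ℝ))) ∧
              -- (orthogonality, when `ε ≤ 1/A`)
              (ε ≤ 1 / A → ∀ n : ℤ, ∀ p : H,
                (Summable fun m : ℕ =>
                  A ^ (-(ε * ((m : ℝ) + 1))) * ⟪XD (φ n) p, XD (φ (n + (m : ℤ) + 1)) p⟫) ∧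
                (Summable fun m : ℕ =>
                  A ^ (-(ε * ((m : ℝ) + 1))) * ⟪YD (φ n) p, YD (φ (n + (m : ℤ) + 1)) p⟫) ∧
                (∑' m : ℕ,
                  A ^ (-(ε * ((m : ℝ) + 1))) * ⟪XD (φ n) p, XD (φ (n + (m : ℤ) + 1)) p⟫) = 0 ∧
                (∑' m : ℕ,
                  A ^ (-(ε * ((m : ℝ) + 1))) * ⟪YD (φ n) p, YD (φ (n + (m : ℤ) + 1)) p⟫) = 0) ∧
              -- (non-degeneracy)
              (∀ n : ℤ, ∀ p : H, C⁻¹ ≤ ‖XD (φ n) p‖ ∧ C⁻¹ ≤ ‖YD (φ n) p‖) ∧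
              -- (immersion)
              (∀ n : ℤ, ∀ p : H,
                (Summable fun m : ℕ => A ^ (-(ε * (m : ℝ))) • XD (φ (n + (m : ℤ))) p) ∧
                (Summable fun m : ℕ => A ^ (-(ε * (m : ℝ))) • YD (φ (n + (m : ℤ))) p) ∧
                (Summable fun m : ℕ => A ^ (-(ε * (m : ℝ))) • ZD (φ (n + (m : ℤ))) p) ∧
                C⁻¹ * A ^ (-(n : ℝ)) * (∑' m : ℕ, A ^ (-(2 * ε * (m : ℝ)))) ≤
                  wedgeNorm
                    ![∑' m : ℕ, A ^ (-(ε * (m : ℝ))) • XD (φ (n + (m : ℤ))) p,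
                      ∑' m : ℕ, A ^ (-(ε * (m : ℝ))) • YD (φ (n + (m : ℤ))) p,
                      ∑' m : ℕ, A ^ (-(ε * (m : ℝ))) • ZD (φ (n + (m : ℤ))) p]) := by
  obtain ⟨r, L, ζ, A₀, hr, hL, hζ, hA₀, H⟩ := HeisenbergEmbedding.exists_families
  have hC := (HeisenbergEmbedding.le_finalConst hr hL hζ).1
  refine ⟨HeisenbergEmbedding.finalConst r L ζ, by linarith, A₀, by linarith,
    fun A _ hA ε hε _ hεA => ?_⟩
  have hA1 : 1 < A := by linarith
  have hlam : (A ^ (-ε)) ^ 2 < 1 := by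
    have h0 := Real.rpow_pos_of_pos (by linarith : 0 < A) (-ε)
    have h1 : A ^ (-ε) < 1 := Real.rpow_lt_one_of_one_lt_of_neg hA1 (by linarith)
    nlinarith
  have hc : 0 < √(1 - (A ^ (-ε)) ^ 2) := Real.sqrt_pos.2 (by linarith)
  have hcl : √(1 - (A ^ (-ε)) ^ 2) ^ 2 + (A ^ (-ε)) ^ 2 = 1 := by
    rw [Real.sq_sqrt (by linarith), sub_add_cancel]
  rw [not_and_or, not_le, not_le] at hεA
  obtain ⟨φ, s, z, h, horth⟩ := H A hA ε _ hε hc hcl hεA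
  exact ⟨φ, h.conclusion hr hL hζ hA1 hc hε hcl horth⟩
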